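/- Let r > 0, θ ∈ ℝ, σ > 0, and let h : ℝ → ℝ be bounded and measurable. Let f_h be the solution of the VG(r,θ,σ,0) Stein equation with test function h. Then for every x ≠ 0, every function g : ℝ → ℝ such that f_h has derivative g(y) at every y ≠ 0 in some neighborhood of x, and every d ∈ ℝ such that g has derivative d at x, one has |x·d| ≤ (1/σ²)·{5 + 2r·A(r,θ,σ) + (5 + 4θ²/σ²)·(1 + 6/r + B(r,θ,σ))} · sup_{t∈ℝ} |h̃(t)|. -/

import Mathlib

open MeasureTheory Real Filter

/-- Modified Bessel function of the second kind. -/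
noncomputable def besselK (ν x : ℝ) : ℝ :=
  ∫ t in Set.Ioi (0:ℝ), Real.exp (-x * Real.cosh t) * Real.cosh (ν * t)

/-- Modified Bessel function of the first kind. -/
noncomputable def besselI (ν x : ℝ) : ℝ :=
  ∑' k : ℕ, (x / 2) ^ (ν + 2 * (k : ℝ)) / (Real.Gamma (ν + (k : ℝ) + 1) * (Nat.factorial k))

/-- The VG(r,θ,σ,0) density. -/
noncomputable def vgDensity (r θ σ x : ℝ) : ℝ :=
  (σ * Real.sqrt Real.pi * Real.Gamma (r / 2))⁻¹ * Real.exp (θ * x / σ ^ 2) *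
    (|x| / (2 * Real.sqrt (θ ^ 2 + σ ^ 2))) ^ ((r - 1) / 2) *
    besselK ((r - 1) / 2) (Real.sqrt (θ ^ 2 + σ ^ 2) * |x| / σ ^ 2)

/-- The centred test function h̃(x) = h(x) − E h(Z). -/
noncomputable def htilde (r θ σ : ℝ) (h : ℝ → ℝ) (x : ℝ) : ℝ :=
  h x - ∫ t, h t * vgDensity r θ σ t

/-- The solution of the VG(r,θ,σ,0) Stein equation with test function h. -/
noncomputable def steinSolution (r θ σ : ℝ) (h : ℝ → ℝ) (x : ℝ) : ℝ :=
  -(Real.exp (-(θ / σ ^ 2) * x) *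
      besselK ((r - 1) / 2) (Real.sqrt (θ ^ 2 + σ ^ 2) / σ ^ 2 * |x|) /
      (σ ^ 2 * |x| ^ ((r - 1) / 2))) *
    (∫ t in (0:ℝ)..x, Real.exp ((θ / σ ^ 2) * t) * |t| ^ ((r - 1) / 2) *
      besselI ((r - 1) / 2) (Real.sqrt (θ ^ 2 + σ ^ 2) / σ ^ 2 * |t|) * htilde r θ σ h t) -
  (Real.exp (-(θ / σ ^ 2) * x) *
      besselI ((r - 1) / 2) (Real.sqrt (θ ^ 2 + σ ^ 2) / σ ^ 2 * |x|) /
      (σ ^ 2 * |x| ^ ((r - 1) / 2))) *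
    (∫ t in Set.Ioi x, Real.exp ((θ / σ ^ 2) * t) * |t| ^ ((r - 1) / 2) *
      besselK ((r - 1) / 2) (Real.sqrt (θ ^ 2 + σ ^ 2) / σ ^ 2 * |t|) * htilde r θ σ h t)

/-- The constant A(r,θ,σ). -/
noncomputable def Aconst (r θ σ : ℝ) : ℝ :=
  if 2 ≤ r then 2 * Real.sqrt Real.pi / Real.sqrt (2 * r - 1) * (1 + θ ^ 2 / σ ^ 2) ^ (r / 2)
  else 12 * Real.Gamma (r / 2) * (1 + θ ^ 2 / σ ^ 2)

/-- The constant B(r,θ,σ). -/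
noncomputable def Bconst (r θ σ : ℝ) : ℝ :=
  if 2 ≤ r then Real.sqrt (Real.pi * (r - 1) / 2) * (1 + θ ^ 2 / σ ^ 2) ^ (r / 2 - 1)
  else 2

/-- The constant C(r,θ,σ). -/
noncomputable def Cconst (r θ σ : ℝ) : ℝ :=
  6 + 2 * Real.sqrt 2 / Real.sqrt r +
    2 * Real.sqrt (2 * Real.pi * (r + 1)) * (|θ| / σ) * (1 + θ ^ 2 / σ ^ 2) ^ ((r - 1) / 2) +
    2 * (Real.sqrt (2 * r) + r) * Aconst r θ σ

section GK
open Set Topology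

/-- Integral `∫ exp (μ t - e^t - z e^{-t}) dt`, i.e. the Bessel `K` in logarithmic variables. -/
noncomputable def gK (μ z : ℝ) : ℝ := ∫ t : ℝ, Real.exp (μ * t - Real.exp t - z * Real.exp (-t))

lemma gK_bound (μ : ℝ) {z : ℝ} (hz : 0 < z) (t : ℝ) :
    Real.exp (μ * t - Real.exp t - z * Real.exp (-t)) ≤
      Real.exp (μ ^ 2 / (2 * min 1 z)) * Real.exp (-(min 1 z / 2) * t ^ 2) := by
  set m := min 1 z with hm
  have hm0 : 0 < m := lt_min one_pos hz
  have hc : 1 + t ^ 2 / 2 ≤ Real.cosh t := by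
    have h := Real.abs_sinh (t / 2)
    have h1 : |t / 2| ≤ Real.sinh |t / 2| := Real.self_le_sinh_iff.2 (abs_nonneg _)
    have h2 : Real.cosh t = 1 + 2 * (Real.sinh (t / 2)) ^ 2 := by
      have h3 := Real.cosh_two_mul (t / 2)
      have h4 := Real.cosh_sq (t / 2)
      rw [show 2 * (t / 2) = t by ring] at h3
      rw [h3, h4]; ring
    rw [← h] at h1
    have h5 := sq_le_sq' (by linarith [abs_nonneg (t/2), abs_nonneg (Real.sinh (t/2))]) h1
    rw [sq_abs, sq_abs] at h5
    rw [h2]; nlinarith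
  rw [Real.cosh_eq] at hc
  rw [← Real.exp_add, Real.exp_le_exp]
  have h1 : m * Real.exp t ≤ 1 * Real.exp t :=
    mul_le_mul_of_nonneg_right (min_le_left _ _) (Real.exp_pos _).le
  have h2 : m * Real.exp (-t) ≤ z * Real.exp (-t) :=
    mul_le_mul_of_nonneg_right (min_le_right _ _) (Real.exp_pos _).le
  have h3 : m * (2 + t ^ 2) ≤ m * (Real.exp t + Real.exp (-t)) :=
    mul_le_mul_of_nonneg_left (by linarith) hm0.le
  have h4 : μ * t ≤ μ ^ 2 / (2 * m) + m / 2 * t ^ 2 := by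
    have : μ ^ 2 / (2 * m) + m / 2 * t ^ 2 - μ * t = (μ - m * t) ^ 2 / (2 * m) := by
      field_simp; ring
    have h5 : 0 ≤ (μ - m * t) ^ 2 / (2 * m) := by positivity
    linarith
  nlinarith

lemma gK_integrable (μ : ℝ) {z : ℝ} (hz : 0 < z) :
    Integrable (fun t : ℝ => Real.exp (μ * t - Real.exp t - z * Real.exp (-t))) := by
  have hm0 : 0 < min 1 z / 2 := by have := lt_min one_pos hz; positivity
  refine Integrable.mono' ((integrable_exp_neg_mul_sq hm0).const_mul
    (Real.exp (μ ^ 2 / (2 * min 1 z)))) (by fun_prop) (ae_of_all _ fun t => ?_)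
  rw [Real.norm_of_nonneg (Real.exp_pos _).le]
  exact gK_bound μ hz t

lemma gK_pos (μ : ℝ) {z : ℝ} (hz : 0 < z) : 0 < gK μ z :=
  integral_exp_pos (gK_integrable μ hz)

lemma gK_hasDerivAt (μ : ℝ) {z : ℝ} (hz : 0 < z) :
    HasDerivAt (gK μ) (-gK (μ - 1) z) z := by
  have key := hasDerivAt_integral_of_dominated_loc_of_deriv_le
    (F := fun z t : ℝ => Real.exp (μ * t - Real.exp t - z * Real.exp (-t)))
    (F' := fun z t : ℝ => -Real.exp ((μ - 1) * t - Real.exp t - z * Real.exp (-t)))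
    (μ := volume) (x₀ := z) (s := Ioi (z / 2))
    (bound := fun t => Real.exp ((μ - 1) * t - Real.exp t - (z / 2) * Real.exp (-t)))
    (Ioi_mem_nhds (by linarith)) (Eventually.of_forall fun w => by fun_prop)
    (gK_integrable μ hz) (by fun_prop)
    (ae_of_all _ fun t w hw => ?_) (gK_integrable (μ - 1) (by linarith))
    (ae_of_all _ fun t w hw => ?_)
  · have h2 := key.2
    rw [integral_neg] at h2
    exact h2
  · rw [norm_neg, Real.norm_of_nonneg (Real.exp_pos _).le, Real.exp_le_exp]
    have : z / 2 * Real.exp (-t) ≤ w * Real.exp (-t) :=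
      mul_le_mul_of_nonneg_right (le_of_lt hw) (Real.exp_pos _).le
    linarith
  · have h1 : HasDerivAt (fun w : ℝ => μ * t - Real.exp t - w * Real.exp (-t))
        (-Real.exp (-t)) w := by
      simpa using ((hasDerivAt_id w).mul_const (Real.exp (-t))).const_sub (μ * t - Real.exp t)
    have h2 := h1.exp
    refine h2.congr_deriv ?_
    rw [mul_neg, ← Real.exp_add]
    congr 2; ring

lemma gK_rec (μ : ℝ) {z : ℝ} (hz : 0 < z) :
    μ * gK μ z - gK (μ + 1) z + z * gK (μ - 1) z = 0 := by
  have hi0 := gK_integrable μ hz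
  have hi1 := gK_integrable (μ + 1) hz
  have hi2 := gK_integrable (μ - 1) hz
  have key := integral_eq_zero_of_hasDerivAt_of_integrable
    (f := fun t : ℝ => Real.exp (μ * t - Real.exp t - z * Real.exp (-t)))
    (f' := fun t : ℝ => μ * Real.exp (μ * t - Real.exp t - z * Real.exp (-t))
      - Real.exp ((μ + 1) * t - Real.exp t - z * Real.exp (-t))
      + z * Real.exp ((μ - 1) * t - Real.exp t - z * Real.exp (-t)))
    (fun t => ?_) (((hi0.const_mul μ).sub hi1).add (hi2.const_mul z)) hi0
  · rw [integral_add (f := fun t : ℝ => μ * Real.exp (μ * t - Real.exp t - z * Real.exp (-t))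
      - Real.exp ((μ + 1) * t - Real.exp t - z * Real.exp (-t)))
      ((hi0.const_mul μ).sub hi1) (hi2.const_mul z), integral_sub (hi0.const_mul μ) hi1, integral_const_mul, integral_const_mul] at key
    exact key
  · have h1 : HasDerivAt (fun t : ℝ => μ * t - Real.exp t - z * Real.exp (-t))
        (μ - Real.exp t + z * Real.exp (-t)) t := by
      have := (((hasDerivAt_id t).const_mul μ).sub (Real.hasDerivAt_exp t)).sub
        (((hasDerivAt_id t).neg.exp).const_mul z)
      refine this.congr_deriv ?_
      simp
    refine h1.exp.congr_deriv ?_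
    have e1 : Real.exp ((μ + 1) * t - Real.exp t - z * Real.exp (-t))
      = Real.exp (μ * t - Real.exp t - z * Real.exp (-t)) * Real.exp t := by
      rw [← Real.exp_add]; congr 1; ring
    have e2 : Real.exp ((μ - 1) * t - Real.exp t - z * Real.exp (-t))
      = Real.exp (μ * t - Real.exp t - z * Real.exp (-t)) * Real.exp (-t) := by
      rw [← Real.exp_add]; congr 1; ring
    rw [e1, e2]; ring

/-- Symmetric form. -/
lemma gK_eq_sym (μ : ℝ) {y : ℝ} (hy : 0 < y) :
    gK μ (y ^ 2 / 4) = (y / 2) ^ μ * ∫ t : ℝ, Real.exp (μ * t - y * Real.cosh t) := by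
  unfold gK
  rw [← integral_const_mul, ← integral_add_right_eq_self _ (Real.log (y / 2))]
  congr 1; funext t
  have hy2 : 0 < y / 2 := by positivity
  rw [Real.rpow_def_of_pos hy2, ← Real.exp_add, neg_add, Real.exp_add t, Real.exp_add (-t),
    Real.exp_neg (Real.log _), Real.exp_log hy2, Real.cosh_eq]
  congr 1
  field_simp
  ring

lemma integral_sym_eq (ν : ℝ) {y : ℝ} (hy : 0 < y) :
    ∫ t : ℝ, Real.exp (ν * t - y * Real.cosh t) = 2 * besselK ν y := by
  have hi : ∀ ν : ℝ, Integrable (fun t : ℝ => Real.exp (ν * t - y * Real.cosh t)) := by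
    intro ν
    have h := (gK_integrable ν (z := y ^ 2 / 4) (by positivity)).comp_add_right (Real.log (y / 2))
    have h2 := h.const_mul (((y / 2) ^ ν)⁻¹)
    refine h2.congr (ae_of_all _ fun t => ?_)
    have hy2 : 0 < y / 2 := by positivity
    simp only
    rw [Real.rpow_def_of_pos hy2, ← Real.exp_neg, ← Real.exp_add, neg_add, Real.exp_add t,
      Real.exp_add (-t), Real.exp_neg (Real.log _), Real.exp_log hy2, Real.cosh_eq]
    congr 1
    field_simp
    ring
  have hneg : ∫ t in Iic (0:ℝ), Real.exp (ν * t - y * Real.cosh t)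
      = ∫ t in Ioi (0:ℝ), Real.exp (-ν * t - y * Real.cosh t) := by
    have := integral_comp_neg_Ioi (0:ℝ) (fun t : ℝ => Real.exp (ν * t - y * Real.cosh t))
    rw [neg_zero] at this
    rw [← this]
    simp
  rw [← intervalIntegral.integral_Iic_add_Ioi (hi ν).integrableOn (hi ν).integrableOn (b := 0),
    hneg, ← integral_add (hi (-ν)).integrableOn (hi ν).integrableOn]
  unfold besselK
  rw [← integral_const_mul]
  congr 1; funext t
  rw [Real.cosh_eq (ν * t), sub_eq_add_neg, sub_eq_add_neg, Real.exp_add, Real.exp_add]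
  ring_nf

lemma besselK_neg (ν y : ℝ) : besselK (-ν) y = besselK ν y := by
  unfold besselK
  simp [Real.cosh_neg]

lemma gK_eq_besselK (ν : ℝ) {y : ℝ} (hy : 0 < y) :
    gK ν (y ^ 2 / 4) = 2 * (y / 2) ^ ν * besselK ν y := by
  rw [gK_eq_sym ν hy, integral_sym_eq ν hy]; ring

lemma gK_reflect (ν : ℝ) {z : ℝ} (hz : 0 < z) : z ^ ν * gK (-ν) z = gK ν z := by
  have hy : 0 < 2 * Real.sqrt z := by positivity
  have e : z = (2 * Real.sqrt z) ^ 2 / 4 := by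
    rw [mul_pow, Real.sq_sqrt hz.le]; ring
  have h1 := gK_eq_besselK ν hy
  have h2 := gK_eq_besselK (-ν) hy
  rw [← e] at h1 h2
  rw [h1, h2, besselK_neg]
  have e2 : 2 * Real.sqrt z / 2 = Real.sqrt z := by ring
  rw [e2, Real.rpow_neg (Real.sqrt_nonneg _)]
  have e3 : z ^ ν = Real.sqrt z ^ ν * Real.sqrt z ^ ν := by
    rw [← Real.mul_rpow (Real.sqrt_nonneg _) (Real.sqrt_nonneg _), Real.mul_self_sqrt hz.le]
  have e4 : Real.sqrt z ^ ν ≠ 0 := (Real.rpow_pos_of_pos (Real.sqrt_pos.2 hz) _).ne'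
  rw [e3]; field_simp

/-- Gamma function in logarithmic variables. -/
lemma gamma_log {μ : ℝ} (hμ : 0 < μ) :
    Integrable (fun t : ℝ => Real.exp (μ * t - Real.exp t)) ∧
      ∫ t : ℝ, Real.exp (μ * t - Real.exp t) = Real.Gamma μ := by
  have hderiv : ∀ x ∈ (univ : Set ℝ), HasDerivWithinAt Real.exp (Real.exp x) univ x :=
    fun x _ => (Real.hasDerivAt_exp x).hasDerivWithinAt
  have himg : Set.image Real.exp univ = Ioi 0 := by rw [image_univ, Real.range_exp]
  have hfun : (fun t : ℝ => |Real.exp t| • (Real.exp (-Real.exp t) * (Real.exp t) ^ (μ - 1)))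
      = fun t : ℝ => Real.exp (μ * t - Real.exp t) := by
    funext t
    rw [abs_of_pos (Real.exp_pos t), smul_eq_mul, ← Real.exp_mul, ← Real.exp_add, ← Real.exp_add]
    congr 1; ring
  have h1 := integrableOn_image_iff_integrableOn_abs_deriv_smul MeasurableSet.univ hderiv
    Real.exp_injective.injOn (fun s : ℝ => Real.exp (-s) * s ^ (μ - 1))
  have h2 := integral_image_eq_integral_abs_deriv_smul MeasurableSet.univ hderiv
    Real.exp_injective.injOn (fun s : ℝ => Real.exp (-s) * s ^ (μ - 1))
  rw [himg, hfun] at h1 h2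
  refine ⟨?_, ?_⟩
  · exact integrableOn_univ.1 (h1.1 (Real.GammaIntegral_convergent hμ))
  · rw [Real.Gamma_eq_integral hμ, h2, setIntegral_univ]

lemma gK_le_Gamma {μ : ℝ} (hμ : 0 < μ) {z : ℝ} (hz : 0 < z) : gK μ z ≤ Real.Gamma μ := by
  rw [← (gamma_log hμ).2]
  refine integral_mono (gK_integrable μ hz) (gamma_log hμ).1 fun t => ?_
  simp only [Real.exp_le_exp]
  have := mul_pos hz (Real.exp_pos (-t))
  linarith

lemma sqrt_gK_le {ν : ℝ} (hν : -(1/2) < ν) {z : ℝ} (hz : 0 < z) :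
    Real.sqrt z * gK ν z ≤ Real.Gamma (ν + 1/2) := by
  have hν' : 0 < ν + 1/2 := by linarith
  rw [← (gamma_log hν').2, gK, ← integral_const_mul]
  refine integral_mono ((gK_integrable ν hz).const_mul _) (gamma_log hν').1 fun t => ?_
  simp only
  have e : Real.exp (ν * t - Real.exp t - z * Real.exp (-t))
    = Real.exp ((ν + 1/2) * t - Real.exp t) * (Real.exp (-t/2) * Real.exp (- (z * Real.exp (-t)))) := by
    rw [← Real.exp_add, ← Real.exp_add]; congr 1; ring
  rw [e]
  have h1 : Real.sqrt z * Real.exp (-t/2) ≤ Real.exp (z * Real.exp (-t)) := by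
    have h2 := Real.add_one_le_exp (z * Real.exp (-t))
    have h3 : z * Real.exp (-t) = (Real.sqrt z * Real.exp (-t/2)) ^ 2 := by
      rw [mul_pow, Real.sq_sqrt hz.le, ← Real.exp_nat_mul]; congr 2; push_cast; ring
    nlinarith [sq_nonneg (Real.sqrt z * Real.exp (-t/2) - 1/2)]
  have h4 : Real.sqrt z * Real.exp (-t/2) * Real.exp (-(z * Real.exp (-t))) ≤ 1 := by
    rw [Real.exp_neg, ← div_eq_mul_inv, div_le_one (Real.exp_pos _)]; exact h1
  calc _ = Real.exp ((ν + 1/2) * t - Real.exp t) *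
        (Real.sqrt z * Real.exp (-t/2) * Real.exp (-(z * Real.exp (-t)))) := by ring
    _ ≤ Real.exp ((ν + 1/2) * t - Real.exp t) * 1 :=
        mul_le_mul_of_nonneg_left h4 (Real.exp_pos _).le
    _ = _ := mul_one _

lemma gK_tendsto_Gamma {μ : ℝ} (hμ : 0 < μ) :
    Tendsto (gK μ) (𝓝[>] 0) (𝓝 (Real.Gamma μ)) := by
  rw [← (gamma_log hμ).2]
  refine tendsto_integral_filter_of_dominated_convergence
    (fun t : ℝ => Real.exp (μ * t - Real.exp t)) (Eventually.of_forall fun z => by fun_prop) ?_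
    (gamma_log hμ).1 (ae_of_all _ fun t => ?_)
  · filter_upwards [self_mem_nhdsWithin] with z hz
    refine ae_of_all _ fun t => ?_
    rw [Real.norm_of_nonneg (Real.exp_pos _).le, Real.exp_le_exp]
    have := mul_pos (mem_Ioi.1 hz) (Real.exp_pos (-t))
    linarith
  · have : Continuous fun z : ℝ => Real.exp (μ * t - Real.exp t - z * Real.exp (-t)) := by fun_prop
    have h := (this.tendsto 0).mono_left (nhdsWithin_le_nhds (s := Ioi 0))
    simpa using h

/-- Exponential decay at infinity. -/
lemma gK_decay (μ : ℝ) {ε : ℝ} (hε : 0 < ε) (hε1 : ε < 1) :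
    ∃ C : ℝ, 0 < C ∧ ∀ z : ℝ, 1 ≤ z → gK μ z ≤ C * Real.exp (-(2 * (1 - ε) * Real.sqrt z)) := by
  have hInt : Integrable (fun t : ℝ => Real.exp (μ * t - ε * Real.exp t - ε * Real.exp (-t))) := by
    have h := (gK_integrable μ (z := ε ^ 2) (by positivity)).comp_add_right (Real.log ε)
    have h2 := h.const_mul ((ε ^ μ)⁻¹)
    refine h2.congr (ae_of_all _ fun t => ?_)
    simp only
    rw [Real.rpow_def_of_pos hε, ← Real.exp_neg, ← Real.exp_add, neg_add, Real.exp_add t,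
      Real.exp_add (-t), Real.exp_neg (Real.log _), Real.exp_log hε]
    congr 1
    field_simp
    ring
  refine ⟨∫ t : ℝ, Real.exp (μ * t - ε * Real.exp t - ε * Real.exp (-t)),
    integral_exp_pos hInt, fun z hz => ?_⟩
  rw [← integral_mul_const]
  refine integral_mono (gK_integrable μ (by linarith)) (hInt.mul_const _) fun t => ?_
  simp only
  rw [← Real.exp_add, Real.exp_le_exp]
  have hz0 : 0 ≤ z := by linarith
  have h1 : 2 * Real.sqrt z ≤ Real.exp t + z * Real.exp (-t) := by
    have e1 : Real.exp t = (Real.exp (t/2)) ^ 2 := by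
      rw [← Real.exp_nat_mul]; congr 1; push_cast; ring
    have e2 : z * Real.exp (-t) = (Real.sqrt z * Real.exp (-t/2)) ^ 2 := by
      rw [mul_pow, Real.sq_sqrt hz0, ← Real.exp_nat_mul]; congr 2; push_cast; ring
    have e3 : Real.exp (t/2) * Real.exp (-t/2) = 1 := by
      rw [← Real.exp_add]; simp; ring
    have h2 := sq_nonneg (Real.exp (t/2) - Real.sqrt z * Real.exp (-t/2))
    have h3 : Real.exp (t/2) * (Real.sqrt z * Real.exp (-t/2)) = Real.sqrt z := by
      rw [mul_left_comm, e3, mul_one]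
    rw [e1, e2]; nlinarith
  have h2 : ε * Real.exp (-t) ≤ ε * (z * Real.exp (-t)) :=
    mul_le_mul_of_nonneg_left (le_mul_of_one_le_left (Real.exp_pos _).le hz) hε.le
  have h3 := mul_le_mul_of_nonneg_left h1 (by linarith : 0 ≤ 1 - ε)
  nlinarith

end GK

section JI
open Set Topology

/-- Entire function with `I_ν(y) = (y/2)^ν jI ν (y²/4)`. -/
noncomputable def jI (ν z : ℝ) : ℝ :=
  ∑' k : ℕ, z ^ k / (Real.Gamma (ν + (k : ℝ) + 1) * (Nat.factorial k))

lemma gamma_lower {a : ℝ} (ha : 0 < a) (k : ℕ) :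
    min a 1 * Real.Gamma a ≤ Real.Gamma (a + k) := by
  have hG := Real.Gamma_pos_of_pos ha
  induction k with
  | zero =>
    simp only [Nat.cast_zero, add_zero]
    exact mul_le_of_le_one_left hG.le (min_le_right _ _)
  | succ k ih =>
    have hk : 0 < a + k := by positivity
    have e : a + ((k + 1 : ℕ) : ℝ) = (a + k) + 1 := by push_cast; ring
    rw [e, Real.Gamma_add_one hk.ne']
    rcases Nat.eq_zero_or_pos k with rfl | hk1
    · simp only [Nat.cast_zero, add_zero]
      exact mul_le_mul_of_nonneg_right (min_le_left _ _) hG.le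
    · have : (1:ℝ) ≤ k := by exact_mod_cast hk1
      exact ih.trans (le_mul_of_one_le_left (Real.Gamma_pos_of_pos hk).le (by linarith))

lemma jI_term_pos {ν : ℝ} (hν : -1 < ν) (k : ℕ) :
    0 < Real.Gamma (ν + (k : ℝ) + 1) * (Nat.factorial k) := by
  have : 0 < ν + (k : ℝ) + 1 := by have : (0:ℝ) ≤ k := by positivity
                                   linarith
  have := Real.Gamma_pos_of_pos this
  positivity

lemma jI_term_bound {ν : ℝ} (hν : -1 < ν) {R : ℝ} (k : ℕ) {z : ℝ} (hz : |z| ≤ R) :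
    ‖z ^ k / (Real.Gamma (ν + (k : ℝ) + 1) * (Nat.factorial k))‖ ≤
      (min (ν + 1) 1 * Real.Gamma (ν + 1))⁻¹ * (R ^ k / (Nat.factorial k)) := by
  have ha : 0 < ν + 1 := by linarith
  have hp := jI_term_pos hν k
  have hG := Real.Gamma_pos_of_pos ha
  have hm : 0 < min (ν + 1) 1 := lt_min ha one_pos
  have hl := gamma_lower ha k
  rw [show ν + 1 + (k:ℝ) = ν + k + 1 by ring] at hl
  rw [norm_div, norm_pow, Real.norm_eq_abs, Real.norm_of_nonneg hp.le, inv_mul_eq_div, div_div,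
    mul_comm ((Nat.factorial k : ℕ) : ℝ)]
  have hR : 0 ≤ R := (abs_nonneg z).trans hz
  gcongr

lemma jI_bound_summable (ν R : ℝ) : Summable fun k : ℕ =>
    (min (ν + 1) 1 * Real.Gamma (ν + 1))⁻¹ * (R ^ k / (Nat.factorial k)) :=
  (Real.summable_pow_div_factorial R).mul_left _

lemma jI_summable {ν : ℝ} (hν : -1 < ν) (z : ℝ) :
    Summable fun k : ℕ => z ^ k / (Real.Gamma (ν + (k : ℝ) + 1) * (Nat.factorial k)) :=
  Summable.of_norm_bounded (jI_bound_summable ν |z|) fun k => jI_term_bound hν k le_rfl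

lemma jI_hasDerivAt {ν : ℝ} (hν : -1 < ν) (z : ℝ) : HasDerivAt (jI ν) (jI (ν + 1) z) z := by
  have hν1 : -1 < ν + 1 := by linarith
  have hs : Summable (fun k : ℕ => if k = 0 then (0:ℝ) else
      (min (ν + 1 + 1) 1 * Real.Gamma (ν + 1 + 1))⁻¹ *
        ((|z| + 1) ^ (k - 1) / (Nat.factorial (k - 1)))) := by
    rw [← summable_nat_add_iff 1]
    simpa using jI_bound_summable (ν + 1) (|z| + 1)
  have key := hasDerivAt_tsum_of_isPreconnected
    (g := fun (k : ℕ) (w : ℝ) => w ^ k / (Real.Gamma (ν + (k : ℝ) + 1) * (Nat.factorial k)))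
    (g' := fun (k : ℕ) (w : ℝ) => (k * w ^ (k - 1)) /
      (Real.Gamma (ν + (k : ℝ) + 1) * (Nat.factorial k)))
    (t := Metric.ball 0 (|z| + 1)) (y₀ := z) (y := z) hs Metric.isOpen_ball
    (convex_ball _ _).isPreconnected
    (fun k w _ => (hasDerivAt_pow k w).div_const _)
    (fun k w hw => ?_) (by simp) (jI_summable hν z) (by simp)
  · refine key.congr_deriv ?_
    unfold jI
    have hsum : Summable (fun k : ℕ => (k * z ^ (k - 1)) /
      (Real.Gamma (ν + (k : ℝ) + 1) * (Nat.factorial k))) := by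
      rw [← summable_nat_add_iff 1]
      refine (jI_summable hν1 z).congr fun k => ?_
      rw [Nat.factorial_succ]
      push_cast
      rw [show ν + ((k:ℝ) + 1) + 1 = ν + 1 + k + 1 by ring]
      have : (k:ℝ) + 1 ≠ 0 := by positivity
      have := (jI_term_pos hν1 k).ne'
      field_simp
    rw [hsum.tsum_eq_zero_add]
    simp only [Nat.cast_zero, zero_mul, zero_div, zero_add]
    congr 1; funext k
    rw [Nat.factorial_succ]
    push_cast
    rw [show ν + ((k:ℝ) + 1) + 1 = ν + 1 + k + 1 by ring]
    have : (k:ℝ) + 1 ≠ 0 := by positivity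
    have := (jI_term_pos hν1 k).ne'
    field_simp
  · rcases k with _ | k
    · simp
    · have hw' : |w| ≤ |z| + 1 := by
        have := Metric.mem_ball.1 hw
        rw [Real.dist_eq, sub_zero] at this; exact this.le
      have := jI_term_bound hν1 k hw'
      simp only [Nat.add_sub_cancel, Nat.succ_ne_zero, if_false, Nat.add_one_sub_one]
      refine le_trans (le_of_eq ?_) this
      congr 1
      rw [Nat.factorial_succ]
      push_cast
      rw [show ν + ((k:ℝ) + 1) + 1 = ν + 1 + k + 1 by ring]
      have : (k:ℝ) + 1 ≠ 0 := by positivity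
      have := (jI_term_pos hν1 k).ne'
      field_simp

lemma jI_rec {ν : ℝ} (hν : -1 < ν) (z : ℝ) :
    jI ν z = (ν + 1) * jI (ν + 1) z + z * jI (ν + 2) z := by
  have hν1 : -1 < ν + 1 := by linarith
  have hν2 : -1 < ν + 2 := by linarith
  have h0 := jI_summable hν z
  have h1 := (jI_summable hν1 z).mul_left (ν + 1)
  have h2 := (jI_summable hν2 z).mul_left z
  unfold jI
  rw [h0.tsum_eq_zero_add, ← tsum_mul_left, ← tsum_mul_left, h1.tsum_eq_zero_add]
  rw [add_assoc _ (∑' b : ℕ, _) (∑' b : ℕ, _), ← ((summable_nat_add_iff 1).2 h1).tsum_add h2]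
  congr 1
  · have : ν + 1 ≠ 0 := by linarith
    have h3 := Real.Gamma_add_one this
    have h4 := (Real.Gamma_pos_of_pos (by linarith : 0 < ν + 1)).ne'
    simp only [Nat.cast_zero, add_zero, h3]
    field_simp
  · congr 1; funext k
    have hp : 0 < ν + 1 + (k:ℝ) + 1 := by have : (0:ℝ) ≤ k := by positivity
                                          linarith
    have e1 : Real.Gamma (ν + 1 + ((k:ℝ) + 1) + 1) =
        (ν + 1 + k + 1) * Real.Gamma (ν + 1 + k + 1) := by
      rw [← Real.Gamma_add_one hp.ne']; congr 1; ring
    have e2 : Real.Gamma (ν + 2 + (k:ℝ) + 1) =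
        (ν + 1 + k + 1) * Real.Gamma (ν + 1 + k + 1) := by
      rw [← Real.Gamma_add_one hp.ne']; congr 1; ring
    have hG := (Real.Gamma_pos_of_pos hp).ne'
    rw [Nat.factorial_succ]
    push_cast
    rw [e1, e2, show ν + ((k:ℝ) + 1) + 1 = ν + 1 + k + 1 by ring]
    have : (k:ℝ) + 1 ≠ 0 := by positivity
    have := hp.ne'
    field_simp
    ring

lemma jI_pos {ν : ℝ} (hν : -1 < ν) {z : ℝ} (hz : 0 ≤ z) : 0 < jI ν z := by
  refine (jI_summable hν z).tsum_pos (fun k => div_nonneg (by positivity) (jI_term_pos hν k).le) 0 ?_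
  exact div_pos (by simp) (jI_term_pos hν 0)

lemma jI_zero {ν : ℝ} : jI ν 0 = (Real.Gamma (ν + 1))⁻¹ := by
  unfold jI
  rw [tsum_eq_single 0]
  · simp
  · intro k hk; simp [hk]

lemma besselI_eq (ν : ℝ) {y : ℝ} (hy : 0 < y) : besselI ν y = (y / 2) ^ ν * jI ν (y ^ 2 / 4) := by
  unfold besselI jI
  rw [← tsum_mul_left]
  congr 1; funext k
  rw [Real.rpow_add (by positivity), mul_div_assoc]
  congr 2
  rw [Real.rpow_mul (by positivity)]
  norm_num
  congr 1; ring

/-- Wronskian. -/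
lemma wronskian {ν : ℝ} (hν : -(1/2) < ν) {z : ℝ} (hz : 0 < z) :
    z ^ (ν + 1) * (gK (-ν) z * jI (ν + 1) z + gK (-ν - 1) z * jI ν z) = 1 := by
  have hν1 : -1 < ν := by linarith
  have hν2 : -1 < ν + 1 := by linarith
  set W : ℝ → ℝ := fun z => z ^ (ν + 1) * (gK (-ν) z * jI (ν + 1) z + gK (-ν - 1) z * jI ν z)
    with hW
  have hder : ∀ w ∈ Ioi (0:ℝ), HasDerivAt W 0 w := by
    intro w hw
    have hw0 : (0:ℝ) < w := hw
    have d1 := Real.hasDerivAt_rpow_const (x := w) (p := ν + 1) (Or.inl hw0.ne')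
    have d2 := gK_hasDerivAt (-ν) hw0
    have d3 := gK_hasDerivAt (-ν - 1) hw0
    have d4 := jI_hasDerivAt hν1 w
    have d5 := jI_hasDerivAt hν2 w
    refine (d1.mul ((d2.mul d5).add (d3.mul d4))).congr_deriv ?_
    have r1 := gK_rec (-ν - 1) hw0
    have r2 := jI_rec hν1 w
    rw [show -ν - 1 + 1 = -ν by ring] at r1
    rw [show ν + 1 + 1 = ν + 2 by ring, show ν + 1 - 1 = ν by ring,
      Real.rpow_add hw0, Real.rpow_one, show -ν - 1 - 1 = -ν - 2 by ring]
    rw [show -ν - 1 - 1 = -ν - 2 by ring] at r1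
    simp only [Pi.add_apply, Pi.mul_apply]
    linear_combination (w ^ ν * (-jI ν w)) * r1 + (w ^ ν * (-gK (-ν) w)) * r2 
  have hconst : ∀ w ∈ Ioi (0:ℝ), W w = W z := by
    intro w hw
    refine (convex_Ioi (0:ℝ)).is_const_of_fderivWithin_eq_zero (𝕜 := ℝ)
      (fun x hx => (hder x hx).differentiableAt.differentiableWithinAt) (fun x hx => ?_) hw hz
    rw [fderivWithin_of_isOpen isOpen_Ioi hx]
    have := (hder x hx).hasFDerivAt.fderiv
    rw [this]; ext; simp
  have e1 : ∀ w ∈ Ioi (0:ℝ), W w = w * gK ν w * jI (ν + 1) w + gK (ν + 1) w * jI ν w := by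
    intro w hw
    have hw0 : (0:ℝ) < w := hw
    have r1 := gK_reflect ν hw0
    have r2 := gK_reflect (ν + 1) hw0
    rw [show -(ν + 1) = -ν - 1 by ring] at r2
    rw [hW, ← r1, ← r2]
    simp only
    rw [Real.rpow_add hw0, Real.rpow_one]; ring
  have hjc : ∀ μ, -1 < μ → Tendsto (jI μ) (𝓝[>] 0) (𝓝 ((Real.Gamma (μ + 1))⁻¹)) := by
    intro μ hμ
    rw [← jI_zero]
    exact (jI_hasDerivAt hμ 0).continuousAt.tendsto.mono_left nhdsWithin_le_nhds
  have t1 : Tendsto (fun w => w * gK ν w) (𝓝[>] 0) (𝓝 0) := by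
    have hs : Tendsto (fun w : ℝ => Real.sqrt w * Real.Gamma (ν + 1/2)) (𝓝[>] 0) (𝓝 0) := by
      have : Continuous fun w : ℝ => Real.sqrt w * Real.Gamma (ν + 1/2) := by fun_prop
      have h := (this.tendsto 0).mono_left (nhdsWithin_le_nhds (s := Ioi 0))
      simpa using h
    refine tendsto_of_tendsto_of_tendsto_of_le_of_le' tendsto_const_nhds hs ?_ ?_
    · filter_upwards [self_mem_nhdsWithin] with w hw
      exact mul_nonneg (le_of_lt hw) (gK_pos ν hw).le
    · filter_upwards [self_mem_nhdsWithin] with w hw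
      have h := sqrt_gK_le hν hw
      have h2 := mul_le_mul_of_nonneg_left h (Real.sqrt_nonneg w)
      rw [← mul_assoc, Real.mul_self_sqrt (le_of_lt hw)] at h2
      exact h2
  have t2 := (t1.mul (hjc (ν + 1) hν2)).add
    ((gK_tendsto_Gamma (by linarith : 0 < ν + 1)).mul (hjc ν hν1))
  have hG := (Real.Gamma_pos_of_pos (by linarith : 0 < ν + 1)).ne'
  rw [zero_mul, zero_add, mul_inv_cancel₀ hG] at t2
  have t3 : Tendsto (fun _ : ℝ => W z) (𝓝[>] 0) (𝓝 1) := by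
    refine t2.congr' ?_
    filter_upwards [self_mem_nhdsWithin] with w hw
    rw [← hconst w hw, e1 w hw]
  exact tendsto_nhds_unique tendsto_const_nhds t3

end JI

section UV
open Set Topology

/-- the argument `z = α² x² / 4` -/
noncomputable def zz (α x : ℝ) : ℝ := α ^ 2 * x ^ 2 / 4

noncomputable def kk (ν α : ℝ) : ℝ := (α / 2) ^ (2 * ν) / 2

noncomputable def uu (ν α β x : ℝ) : ℝ := kk ν α * (exp (-(β * x)) * gK (-ν) (zz α x))
noncomputable def du (ν α β x : ℝ) : ℝ :=
  kk ν α * (exp (-(β * x)) * (-β * gK (-ν) (zz α x) - α ^ 2 * x / 2 * gK (-ν - 1) (zz α x)))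
noncomputable def vv (ν α β x : ℝ) : ℝ := exp (-(β * x)) * jI ν (zz α x)
noncomputable def dv (ν α β x : ℝ) : ℝ :=
  exp (-(β * x)) * (-β * jI ν (zz α x) + α ^ 2 * x / 2 * jI (ν + 1) (zz α x))
noncomputable def mm (ν β x : ℝ) : ℝ := x ^ (2 * ν + 1) * exp (2 * β * x)

lemma zz_pos {α x : ℝ} (hα : 0 < α) (hx : 0 < x) : 0 < zz α x := by unfold zz; positivity

lemma zz_hasDerivAt (α x : ℝ) : HasDerivAt (zz α) (α ^ 2 * x / 2) x := by
  unfold zz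
  refine ((((hasDerivAt_pow 2 x).const_mul (α ^ 2)).div_const 4)).congr_deriv ?_
  simp; ring

lemma exp_hasDerivAt (c x : ℝ) : HasDerivAt (fun x => exp (-(c * x))) (-c * exp (-(c * x))) x := by
  refine (((hasDerivAt_id x).const_mul c).neg.exp).congr_deriv ?_
  simp; ring

lemma kk_pos {ν α : ℝ} (hα : 0 < α) : 0 < kk ν α := by unfold kk; positivity

lemma uu_pos {ν α β x : ℝ} (hα : 0 < α) (hx : 0 < x) : 0 < uu ν α β x := by
  have := kk_pos (ν := ν) hα
  have := gK_pos (-ν) (zz_pos hα hx)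
  unfold uu; positivity

lemma vv_pos {ν α β x : ℝ} (hν : -(1/2) < ν) : 0 < vv ν α β x := by
  have := jI_pos (by linarith : -1 < ν) (by unfold zz; positivity : 0 ≤ zz α x)
  unfold vv; positivity

lemma mm_pos {ν β x : ℝ} (hx : 0 < x) : 0 < mm ν β x := by unfold mm; positivity

lemma uu_hasDerivAt {ν α β x : ℝ} (hα : 0 < α) (hx : 0 < x) :
    HasDerivAt (uu ν α β) (du ν α β x) x := by
  have h1 := exp_hasDerivAt β x
  have h2 := (gK_hasDerivAt (-ν) (zz_pos hα hx)).comp x (zz_hasDerivAt α x)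
  unfold uu du
  refine ((h1.mul h2).const_mul (kk ν α)).congr_deriv ?_
  simp only [Function.comp]
  ring

lemma du_hasDerivAt {ν α β x : ℝ} (hα : 0 < α) (hx : 0 < x) :
    HasDerivAt (du ν α β) ((-(2 * ν + 1 + 2 * β * x) * du ν α β x
      - ((2 * ν + 1) * β - (α ^ 2 - β ^ 2) * x) * uu ν α β x) / x) x := by
  have h1 := exp_hasDerivAt β x
  have hz := zz_pos hα hx
  have h2 := (gK_hasDerivAt (-ν) hz).comp x (zz_hasDerivAt α x)
  have h3 := (gK_hasDerivAt (-ν - 1) hz).comp x (zz_hasDerivAt α x)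
  have h4 : HasDerivAt (fun x : ℝ => α ^ 2 * x / 2) (α ^ 2 / 2) x := by
    refine (((hasDerivAt_id x).const_mul (α ^ 2)).div_const 2).congr_deriv ?_
    simp
  have r1 := gK_rec (-ν - 1) hz
  rw [show -ν - 1 + 1 = -ν by ring] at r1
  unfold du
  refine ((h1.mul ((h2.const_mul (-β)).sub (h4.mul h3))).const_mul (kk ν α)).congr_deriv ?_
  simp only [Function.comp, Pi.mul_apply, Pi.sub_apply, Pi.add_apply]
  rw [eq_div_iff hx.ne']
  unfold uu
  generalize gK (-ν) (zz α x) = g0 at *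
  generalize gK (-ν - 1) (zz α x) = g1 at *
  generalize gK (-ν - 1 - 1) (zz α x) = g2 at *
  generalize exp (-(β * x)) = e
  unfold zz at r1
  linear_combination kk ν α * e * α ^ 2 * x * r1

lemma vv_hasDerivAt {ν α β x : ℝ} (hν : -(1/2) < ν) :
    HasDerivAt (vv ν α β) (dv ν α β x) x := by
  have h1 := exp_hasDerivAt β x
  have h2 := (jI_hasDerivAt (by linarith : -1 < ν) (zz α x)).comp x (zz_hasDerivAt α x)
  unfold vv dv
  refine (h1.mul h2).congr_deriv ?_
  simp only [Function.comp]
  ring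

lemma dv_hasDerivAt {ν α β x : ℝ} (hν : -(1/2) < ν) (hx : 0 < x) :
    HasDerivAt (dv ν α β) ((-(2 * ν + 1 + 2 * β * x) * dv ν α β x
      - ((2 * ν + 1) * β - (α ^ 2 - β ^ 2) * x) * vv ν α β x) / x) x := by
  have h1 := exp_hasDerivAt β x
  have h2 := (jI_hasDerivAt (by linarith : -1 < ν) (zz α x)).comp x (zz_hasDerivAt α x)
  have h3 := (jI_hasDerivAt (by linarith : -1 < ν + 1) (zz α x)).comp x (zz_hasDerivAt α x)
  have h4 : HasDerivAt (fun x : ℝ => α ^ 2 * x / 2) (α ^ 2 / 2) x := by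
    refine (((hasDerivAt_id x).const_mul (α ^ 2)).div_const 2).congr_deriv ?_
    simp
  have r1 := jI_rec (by linarith : -1 < ν) (zz α x)
  unfold dv
  refine (h1.mul ((h2.const_mul (-β)).add (h4.mul h3))).congr_deriv ?_
  simp only [Function.comp, Pi.mul_apply, Pi.sub_apply, Pi.add_apply]
  rw [eq_div_iff hx.ne', show ν + 1 + 1 = ν + 2 by ring]
  unfold vv
  generalize jI ν (zz α x) = g0 at *
  generalize jI (ν + 1) (zz α x) = g1 at *
  generalize jI (ν + 2) (zz α x) = g2 at *
  generalize exp (-(β * x)) = e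
  unfold zz at r1
  linear_combination - e * α ^ 2 * x * r1

lemma dv_continuous {ν α β : ℝ} (hν : -(1/2) < ν) : Continuous (dv ν α β) := by
  have hz : Continuous (zz α) := by unfold zz; fun_prop
  have h1 : Continuous (jI ν) :=
    continuous_iff_continuousAt.2 fun z => (jI_hasDerivAt (by linarith : -1 < ν) z).continuousAt
  have h2 : Continuous (jI (ν + 1)) :=
    continuous_iff_continuousAt.2 fun z => (jI_hasDerivAt (by linarith : -1 < ν + 1) z).continuousAt
  have h1' := h1.comp hz
  have h2' := h2.comp hz
  unfold dv
  simp only [Function.comp_def] at h1' h2'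
  fun_prop

lemma vv_continuous {ν α β : ℝ} (hν : -(1/2) < ν) : Continuous (vv ν α β) :=
  continuous_iff_continuousAt.2 fun _ => (vv_hasDerivAt hν).continuousAt

lemma mm_hasDerivAt {ν β x : ℝ} (hx : 0 < x) :
    HasDerivAt (mm ν β) (mm ν β x * (2 * ν + 1 + 2 * β * x) / x) x := by
  have h1 := Real.hasDerivAt_rpow_const (x := x) (p := 2 * ν + 1) (Or.inl hx.ne')
  have h2 := exp_hasDerivAt (-(2 * β)) x
  have e : mm ν β = fun x => x ^ (2 * ν + 1) * exp (-(-(2 * β) * x)) := by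
    funext y; unfold mm; congr 2; ring
  rw [e]
  refine (h1.mul h2).congr_deriv ?_
  rw [eq_div_iff hx.ne', Real.rpow_sub hx, Real.rpow_one]
  field_simp

lemma zz_rpow {α x : ℝ} (hα : 0 < α) (hx : 0 < x) (μ : ℝ) :
    zz α x ^ μ = (α / 2) ^ (2 * μ) * x ^ (2 * μ) := by
  have : zz α x = ((α / 2) * x) ^ (2:ℝ) := by
    unfold zz; rw [Real.rpow_two]; ring
  rw [this, ← Real.rpow_mul (by positivity), Real.mul_rpow (by positivity) hx.le]

lemma uv_wronskian {ν α β x : ℝ} (hν : -(1/2) < ν) (hα : 0 < α) (hx : 0 < x) :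
    mm ν β x * (uu ν α β x * dv ν α β x - du ν α β x * vv ν α β x) = 1 := by
  have h := wronskian hν (zz_pos hα hx)
  rw [zz_rpow hα hx, show 2 * (ν + 1) = 2 * ν + 2 by ring, Real.rpow_add hx,
    Real.rpow_add (by positivity)] at h
  unfold mm uu dv du vv kk
  rw [Real.rpow_add hx, Real.rpow_one]
  have e : exp (2 * β * x) * exp (-(β * x)) * exp (-(β * x)) = 1 := by
    rw [← Real.exp_add, ← Real.exp_add, ← Real.exp_zero]; congr 1; ring
  rw [Real.rpow_two, Real.rpow_two] at h
  generalize gK (-ν) (zz α x) = g0 at *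
  generalize gK (-ν - 1) (zz α x) = g1 at *
  generalize jI (ν + 1) (zz α x) = j1 at *
  generalize jI ν (zz α x) = j0 at *
  generalize exp (2 * β * x) = e1 at *
  generalize exp (-(β * x)) = e2 at *
  linear_combination ((α / 2) ^ (2 * ν) * x ^ (2 * ν) * (α^2/4 * x ^ 2) * (g0 * j1 + g1 * j0)) * e + h

lemma mu_eq {ν α β x : ℝ} (hα : 0 < α) (hx : 0 < x) :
    mm ν β x * uu ν α β x = x * exp (β * x) * gK ν (zz α x) / 2 := by
  have h := gK_reflect ν (zz_pos hα hx)
  rw [zz_rpow hα hx] at h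
  have e : exp (2 * β * x) * exp (-(β * x)) = exp (β * x) := by
    rw [← Real.exp_add]; congr 1; ring
  unfold mm uu kk
  rw [← h, ← e, Real.rpow_add hx, Real.rpow_one]
  ring

lemma mdu_eq {ν α β x : ℝ} (hα : 0 < α) (hx : 0 < x) :
    mm ν β x * du ν α β x =
      -β * (x * exp (β * x) * gK ν (zz α x) / 2) - exp (β * x) * gK (ν + 1) (zz α x) := by
  have h := gK_reflect (ν + 1) (zz_pos hα hx)
  rw [zz_rpow hα hx, show 2 * (ν + 1) = 2 * ν + 2 by ring, Real.rpow_add hx,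
    Real.rpow_add (by positivity), Real.rpow_two, Real.rpow_two,
    show -(ν + 1) = -ν - 1 by ring] at h
  have e : exp (2 * β * x) * exp (-(β * x)) = exp (β * x) := by
    rw [← Real.exp_add]; congr 1; ring
  rw [← mu_eq hα hx, ← h, ← e]
  unfold mm uu du kk
  rw [Real.rpow_add hx, Real.rpow_one]
  ring

lemma sqrt_zz {α x : ℝ} (hα : 0 < α) (hx : 0 < x) : √(zz α x) = α * x / 2 := by
  rw [show zz α x = (α * x / 2) ^ 2 by unfold zz; ring, Real.sqrt_sq (by positivity)]

/-- boundedness of `m u` and `m u'` near zero -/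
lemma mu_bdd {ν α β : ℝ} (hν : -(1/2) < ν) (hα : 0 < α) :
    ∃ C > 0, ∀ x, 0 < x → x ≤ 1 → |mm ν β x * uu ν α β x| ≤ C ∧ |mm ν β x * du ν α β x| ≤ C := by
  set C1 := exp |β| * (Gamma (ν + 1/2) / α) with hC1
  set C2 := exp |β| * Gamma (ν + 1) with hC2
  have hG1 := Gamma_pos_of_pos (by linarith : 0 < ν + 1/2)
  have hG2 := Gamma_pos_of_pos (by linarith : 0 < ν + 1)
  have hC1p : 0 < C1 := by positivity
  have hC2p : 0 < C2 := by positivity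
  refine ⟨C1 + (|β| * C1 + C2), by positivity, fun x hx hx1 => ?_⟩
  have hb : exp (β * x) ≤ exp |β| := by
    apply Real.exp_le_exp.2
    calc β * x ≤ |β * x| := le_abs_self _
      _ = |β| * x := by rw [abs_mul, abs_of_pos hx]
      _ ≤ |β| := mul_le_of_le_one_right (abs_nonneg _) hx1
  have h1 : |mm ν β x * uu ν α β x| ≤ C1 := by
    rw [abs_of_pos (mul_pos (mm_pos hx) (uu_pos hα hx)), mu_eq hα hx]
    have := sqrt_gK_le hν (zz_pos hα hx)
    rw [sqrt_zz hα hx] at this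
    have h3 : x * gK ν (zz α x) / 2 ≤ Gamma (ν + 1/2) / α := by
      rw [le_div_iff₀ hα]; linarith
    calc x * exp (β * x) * gK ν (zz α x) / 2 = exp (β * x) * (x * gK ν (zz α x) / 2) := by ring
      _ ≤ _ := by
        apply mul_le_mul hb h3 _ (Real.exp_pos _).le
        have := gK_pos ν (zz_pos hα hx); positivity
  have h2 : |mm ν β x * du ν α β x| ≤ |β| * C1 + C2 := by
    rw [mdu_eq hα hx, ← mu_eq hα hx]
    refine (abs_sub _ _).trans (add_le_add ?_ ?_)
    · rw [abs_mul, abs_neg]; gcongr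
    · have := gK_pos (ν + 1) (zz_pos hα hx)
      rw [abs_of_pos (by positivity)]
      have := gK_le_Gamma (by linarith : 0 < ν + 1) (zz_pos hα hx)
      rw [hC2]; gcongr
  have : 0 ≤ |β| * C1 := by positivity
  exact ⟨by linarith, by linarith⟩

lemma gK_exp_tendsto {μ α β : ℝ} (hα : 0 < α) (hβ : |β| < α) :
    Tendsto (fun x => x * exp (β * x) * gK μ (zz α x)) atTop (𝓝 0) ∧
    Tendsto (fun x => exp (β * x) * gK μ (zz α x)) atTop (𝓝 0) := by
  set ε := (1 - |β| / α) / 2 with hε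
  have hq : |β| / α < 1 := by rw [div_lt_one hα]; exact hβ
  have hq0 : 0 ≤ |β| / α := by positivity
  obtain ⟨C, hC, hb⟩ := gK_decay μ (ε := ε) (by linarith) (by linarith)
  set δ := (α - |β|) / 2 with hδ
  have hδp : 0 < δ := by linarith
  have hle : ∀ x ≥ 2 / α, exp (β * x) * gK μ (zz α x) ≤ C * exp (-(δ * x)) := by
    intro x hx
    have hx0 : 0 < x := lt_of_lt_of_le (by positivity) hx
    have h2 : 2 ≤ α * x := by
      have := (div_le_iff₀ hα).1 hx; linarith
    have hz1 : 1 ≤ zz α x := by unfold zz; nlinarith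
    have := hb _ hz1
    rw [sqrt_zz hα hx0] at this
    calc exp (β * x) * gK μ (zz α x) ≤ exp (β * x) * (C * exp (-(2 * (1 - ε) * (α * x / 2)))) := by
          gcongr
      _ = C * exp (β * x + -(2 * (1 - ε) * (α * x / 2))) := by rw [Real.exp_add]; ring
      _ ≤ _ := by
        gcongr
        have h5 : (1 - ε) * α = (α + |β|) / 2 := by rw [hε]; field_simp; ring
        have : 2 * (1 - ε) * (α * x / 2) = (α + |β|) / 2 * x := by rw [← h5]; ring
        rw [this, hδ]
        have := le_abs_self β
        nlinarith
  have t1 : Tendsto (fun x : ℝ => exp (-(δ * x))) atTop (𝓝 0) := by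
    have := Real.tendsto_pow_mul_exp_neg_atTop_nhds_zero 0
    have h := this.comp (tendsto_id.const_mul_atTop hδp)
    simpa [Function.comp_def] using h
  have t2 : Tendsto (fun x : ℝ => x * exp (-(δ * x))) atTop (𝓝 0) := by
    have := Real.tendsto_pow_mul_exp_neg_atTop_nhds_zero 1
    have h := (this.comp (tendsto_id.const_mul_atTop hδp)).const_mul δ⁻¹
    simp only [Function.comp_def, pow_one, mul_zero, id] at h
    refine h.congr fun x => ?_
    field_simp
  constructor
  · refine squeeze_zero' ?_ ?_ (by simpa using t2.const_mul C)
    · filter_upwards [eventually_gt_atTop 0] with x hx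
      have := gK_pos μ (zz_pos hα hx); positivity
    · filter_upwards [eventually_ge_atTop (2 / α)] with x hx
      have hx0 : 0 < x := lt_of_lt_of_le (by positivity) hx
      have := mul_le_mul_of_nonneg_left (hle x hx) hx0.le
      linarith
  · refine squeeze_zero' ?_ ?_ (by simpa using t1.const_mul C)
    · filter_upwards [eventually_gt_atTop 0] with x hx
      have := gK_pos μ (zz_pos hα hx); positivity
    · filter_upwards [eventually_ge_atTop (2 / α)] with x hx
      exact hle x hx

lemma mu_tendsto {ν α β : ℝ} (hα : 0 < α) (hβ : |β| < α) :
    Tendsto (fun x => mm ν β x * uu ν α β x) atTop (𝓝 0) ∧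
    Tendsto (fun x => mm ν β x * du ν α β x) atTop (𝓝 0) := by
  have h1 := (gK_exp_tendsto (μ := ν) hα hβ).1
  have h2 := (gK_exp_tendsto (μ := ν + 1) hα hβ).2
  constructor
  · have := h1.div_const 2
    rw [zero_div] at this
    refine this.congr' ?_
    filter_upwards [eventually_gt_atTop 0] with x hx
    rw [mu_eq hα hx]
  · have := ((h1.div_const 2).const_mul (-β)).sub h2
    rw [zero_div, mul_zero, sub_zero] at this
    refine this.congr' ?_
    filter_upwards [eventually_gt_atTop 0] with x hx
    rw [mdu_eq hα hx]

lemma mm_tendsto_zero {ν β : ℝ} (hν : -(1/2) < ν) : Tendsto (mm ν β) (𝓝[>] 0) (𝓝 0) := by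
  have h1 : Tendsto (fun x : ℝ => x ^ (2 * ν + 1)) (𝓝 0) (𝓝 0) := by
    have := (Real.continuousAt_rpow_const 0 (2 * ν + 1) (Or.inr (by linarith))).tendsto
    rwa [Real.zero_rpow (by linarith)] at this
  have h2 : Tendsto (fun x : ℝ => exp (2 * β * x)) (𝓝 0) (𝓝 1) := by
    have : Continuous fun x : ℝ => exp (2 * β * x) := by fun_prop
    simpa using this.tendsto 0
  have := (h1.mul h2).mono_left (nhdsWithin_le_nhds (s := Ioi 0))
  rw [zero_mul] at this
  exact this

end UV

section TT
open Set Topology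

noncomputable def qq (α β c : ℝ) : ℝ := α ^ 2 - (c - β) ^ 2
noncomputable def wq (ν α β c : ℝ) : ℝ := (qq α β c) ^ (ν - 1/2)
noncomputable def Ti (n : ℕ) (ν α β x : ℝ) : ℝ :=
  ∫ c in (0:ℝ)..(α + β), c ^ n * wq ν α β c * exp (-(c * x))

lemma qq_nonneg {α β c : ℝ} (hβ : |β| < α) (h0 : 0 ≤ c) (h1 : c ≤ α + β) : 0 ≤ qq α β c := by
  have := abs_lt.1 hβ
  have e : qq α β c = (α + β - c) * (α - β + c) := by unfold qq; ring
  rw [e]; apply mul_nonneg <;> linarith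

lemma qq_pos {α β c : ℝ} (hβ : |β| < α) (h0 : 0 ≤ c) (h1 : c < α + β) : 0 < qq α β c := by
  have := abs_lt.1 hβ
  have e : qq α β c = (α + β - c) * (α - β + c) := by unfold qq; ring
  rw [e]; apply mul_pos <;> linarith

lemma wq_nonneg {ν α β c : ℝ} (hβ : |β| < α) (h0 : 0 ≤ c) (h1 : c ≤ α + β) : 0 ≤ wq ν α β c :=
  Real.rpow_nonneg (qq_nonneg hβ h0 h1) _

lemma wq_int {ν α β : ℝ} (hν : -(1/2) < ν) (hβ : |β| < α) :
    IntervalIntegrable (wq ν α β) volume 0 (α + β) := by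
  have hb := abs_lt.1 hβ
  have h1 : IntervalIntegrable (fun c : ℝ => c ^ (ν - 1/2)) volume 0 (α + β) :=
    intervalIntegral.intervalIntegrable_rpow' (by linarith)
  have h2 := (h1.comp_sub_left (α + β)).symm
  simp only [sub_zero, sub_self] at h2
  have h3 : ContinuousOn (fun c : ℝ => (α - β + c) ^ (ν - 1/2)) (uIcc 0 (α + β)) := by
    rw [uIcc_of_le (by linarith)]
    refine ContinuousOn.rpow_const (by fun_prop) fun c hc => Or.inl ?_
    have := hc.1; linarith
  refine (h2.mul_continuousOn h3).congr fun c hc => ?_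
  rw [uIoc_of_le (by linarith)] at hc
  unfold wq
  rw [show qq α β c = (α + β - c) * (α - β + c) by unfold qq; ring,
    Real.mul_rpow (by linarith [hc.2]) (by linarith [hc.1])]

lemma wq_mul_int {ν α β : ℝ} (hν : -(1/2) < ν) (hβ : |β| < α) {f : ℝ → ℝ} (hf : Continuous f)
    {a b : ℝ} (ha : 0 ≤ a) (ha' : a ≤ α + β) (hb : 0 ≤ b) (hb' : b ≤ α + β) :
    IntervalIntegrable (fun c => f c * wq ν α β c) volume a b := by
  refine ((wq_int hν hβ).continuousOn_mul hf.continuousOn).mono_set ?_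
  rw [uIcc_of_le (ha.trans ha')]
  exact uIcc_subset_Icc ⟨ha, ha'⟩ ⟨hb, hb'⟩

lemma Ti_integrand_int {ν α β : ℝ} (hν : -(1/2) < ν) (hβ : |β| < α) (n : ℕ) (x : ℝ) :
    IntervalIntegrable (fun c => c ^ n * wq ν α β c * exp (-(c * x))) volume 0 (α + β) := by
  have hb := abs_lt.1 hβ
  have := wq_mul_int hν hβ (f := fun c => c ^ n * exp (-(c * x))) (by fun_prop)
    (a := 0) (b := α + β) le_rfl (by linarith) (by linarith) le_rfl
  refine this.congr fun c _ => ?_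
  ring

lemma Ti_hasDerivAt {ν α β : ℝ} (hν : -(1/2) < ν) (hβ : |β| < α) (n : ℕ) (x : ℝ) :
    HasDerivAt (Ti n ν α β) (-Ti (n + 1) ν α β x) x := by
  have hb := abs_lt.1 hβ
  have hL : 0 ≤ α + β := by linarith
  have key := intervalIntegral.hasDerivAt_integral_of_dominated_loc_of_deriv_le
    (μ := volume) (a := 0) (b := α + β) (x₀ := x) (s := Metric.ball x 1)
    (F := fun x c => c ^ n * wq ν α β c * exp (-(c * x)))
    (F' := fun x c => -(c ^ (n + 1) * wq ν α β c * exp (-(c * x))))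
    (bound := fun c => ((α + β) ^ (n + 1) * exp ((α + β) * (|x| + 1))) * wq ν α β c)
    (Metric.ball_mem_nhds x one_pos)
    (Eventually.of_forall fun y => by
      have := (Ti_integrand_int hν hβ n y).def'.aestronglyMeasurable; exact this)
    (Ti_integrand_int hν hβ n x)
    ((Ti_integrand_int hν hβ (n + 1) x).neg.def'.aestronglyMeasurable)
    (Eventually.of_forall fun c hc y hy => ?_)
    ((wq_int hν hβ).const_mul _)
    (Eventually.of_forall fun c hc y hy => ?_)
  · refine key.2.congr_deriv ?_
    rw [intervalIntegral.integral_neg]; rfl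
  · rw [uIoc_of_le hL] at hc
    have hw := wq_nonneg (ν := ν) hβ hc.1.le hc.2
    have hc0 := hc.1.le
    rw [norm_neg, Real.norm_of_nonneg (by positivity)]
    have hy' : |y - x| < 1 := by rw [← Real.dist_eq]; exact hy
    have h1 : -(c * y) ≤ (α + β) * (|x| + 1) := by
      have h2 : -y ≤ |x| + 1 := by
        have := neg_abs_le x; have := (abs_lt.1 hy').1; linarith
      calc -(c * y) = c * (-y) := by ring
        _ ≤ c * (|x| + 1) := by gcongr
        _ ≤ _ := by gcongr; exact hc.2
    have h3 := hc.2
    calc c ^ (n + 1) * wq ν α β c * exp (-(c * y))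
        ≤ (α + β) ^ (n + 1) * wq ν α β c * exp ((α + β) * (|x| + 1)) := by gcongr
      _ = _ := by ring
  · refine ((exp_hasDerivAt c y).const_mul (c ^ n * wq ν α β c)).congr_deriv ?_
    ring

lemma Ti_nonneg {ν α β : ℝ} (hβ : |β| < α) (n : ℕ) (x : ℝ) : 0 ≤ Ti n ν α β x := by
  have hb := abs_lt.1 hβ
  refine intervalIntegral.integral_nonneg (by linarith) fun c hc => ?_
  have := wq_nonneg (ν := ν) hβ hc.1 hc.2
  have := hc.1
  positivity

lemma Ti_le_zero {ν α β : ℝ} (hν : -(1/2) < ν) (hβ : |β| < α) (n : ℕ) {x : ℝ} (hx : 0 ≤ x) :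
    Ti n ν α β x ≤ Ti n ν α β 0 := by
  have hb := abs_lt.1 hβ
  refine intervalIntegral.integral_mono_on (by linarith) (Ti_integrand_int hν hβ n x)
    (Ti_integrand_int hν hβ n 0) fun c hc => ?_
  have := wq_nonneg (ν := ν) hβ hc.1 hc.2
  have h0 := hc.1
  have : c * 0 ≤ c * x := by gcongr
  gcongr

/-- fundamental identity -/
lemma wq_ftc {ν α β : ℝ} (hν : -(1/2) < ν) (hβ : |β| < α) {a : ℝ} (ha : 0 ≤ a) (ha' : a ≤ α + β)
    (x : ℝ) :
    ∫ c in a..(α + β), (((2 * ν + 1) * (c - β) + x * qq α β c) * exp (-(c * x))) * wq ν α β c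
      = qq α β a ^ (ν + 1/2) * exp (-(a * x)) := by
  have hq : Continuous (qq α β) := by unfold qq; fun_prop
  have hqL : qq α β (α + β) = 0 := by unfold qq; ring
  have key := intervalIntegral.integral_eq_sub_of_hasDerivAt_of_le ha'
    (f := fun c => -(qq α β c ^ (ν + 1/2) * exp (-(c * x))))
    (f' := fun c => (((2 * ν + 1) * (c - β) + x * qq α β c) * exp (-(c * x))) * wq ν α β c)
    ?_ ?_ (wq_mul_int hν hβ (by fun_prop) ha ha' (ha.trans ha') le_rfl)
  · rw [key, hqL, Real.zero_rpow (by linarith)]; ring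
  · apply ContinuousOn.neg
    apply ContinuousOn.mul _ (by fun_prop)
    exact ContinuousOn.rpow_const hq.continuousOn fun _ _ => Or.inr (by linarith)
  · intro c hc
    have hp := qq_pos hβ (ha.trans hc.1.le) hc.2
    have h1 : HasDerivAt (qq α β) (-(2 * (c - β))) c := by
      unfold qq
      refine ((((hasDerivAt_id c).sub_const β).pow 2).const_sub (α ^ 2)).congr_deriv ?_
      simp
    have h2 := h1.rpow_const (p := ν + 1/2) (Or.inl hp.ne')
    have h3 : HasDerivAt (fun c => exp (-(c * x))) (-x * exp (-(c * x))) c := by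
      have := exp_hasDerivAt x c
      simpa [mul_comm] using this
    refine (h2.mul h3).neg.congr_deriv ?_
    have e : qq α β c ^ (ν + 1/2) = qq α β c * wq ν α β c := by
      unfold wq
      rw [show ν + 1/2 = 1 + (ν - 1/2) by ring, Real.rpow_add hp, Real.rpow_one]
    rw [e, show ν + 1/2 - 1 = ν - 1/2 by ring]
    unfold wq
    ring

lemma Ti_ode {ν α β : ℝ} (hν : -(1/2) < ν) (hβ : |β| < α) (x : ℝ) :
    x * Ti 2 ν α β x - (2 * ν + 1 + 2 * β * x) * Ti 1 ν α β x +
      ((2 * ν + 1) * β - (α ^ 2 - β ^ 2) * x) * Ti 0 ν α β x = -(α ^ 2 - β ^ 2) ^ (ν + 1/2) := by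
  have hb := abs_lt.1 hβ
  have h := wq_ftc hν hβ le_rfl (by linarith : 0 ≤ α + β) x
  have q0 : qq α β 0 = α ^ 2 - β ^ 2 := by unfold qq; ring
  rw [q0] at h
  simp only [zero_mul, neg_zero, Real.exp_zero, mul_one] at h
  rw [← h]
  unfold Ti
  rw [← intervalIntegral.integral_const_mul, ← intervalIntegral.integral_const_mul,
    ← intervalIntegral.integral_const_mul, ← intervalIntegral.integral_sub,
    ← intervalIntegral.integral_add, ← intervalIntegral.integral_neg]
  · congr 1; funext c; unfold qq; ring
  · exact ((Ti_integrand_int hν hβ 2 x).const_mul _).sub ((Ti_integrand_int hν hβ 1 x).const_mul _)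
  · exact (Ti_integrand_int hν hβ 0 x).const_mul _
  · exact (Ti_integrand_int hν hβ 2 x).const_mul _
  · exact (Ti_integrand_int hν hβ 1 x).const_mul _

lemma x_int_exp {a b x : ℝ} (hab : a ≤ b) (ha : 0 ≤ a) (hx : 0 ≤ x) :
    x * ∫ c in a..b, exp (-(c * x)) ≤ 1 := by
  rw [← intervalIntegral.integral_const_mul]
  have := intervalIntegral.integral_eq_sub_of_hasDerivAt_of_le hab
    (f := fun c => -exp (-(c * x))) (f' := fun c => x * exp (-(c * x))) (by fun_prop)
    (fun c _ => by
      have := (exp_hasDerivAt x c).neg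
      simp only [mul_comm x] at this
      refine this.congr_deriv ?_
      ring) (Continuous.intervalIntegrable (by fun_prop) _ _)
  rw [this]
  have h1 : exp (-(a * x)) ≤ 1 := Real.exp_le_one_iff.2 (by nlinarith)
  have h2 := Real.exp_pos (-(b * x))
  linarith

lemma T0_eq (ν α β x : ℝ) : Ti 0 ν α β x = ∫ c in (0:ℝ)..(α+β), exp (-(c * x)) * wq ν α β c := by
  unfold Ti; congr 1; funext c; ring

/-- (a) -/
lemma T0_bound_a {ν α β : ℝ} (hν : -(1/2) < ν) (hβ : |β| < α) (hβ0 : β ≤ 0) {x : ℝ} (hx : 0 ≤ x) :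
    (2 * ν + 1) * (-β) * Ti 0 ν α β x ≤ (α ^ 2 - β ^ 2) ^ (ν + 1/2) := by
  have hb := abs_lt.1 hβ
  have h := wq_ftc hν hβ le_rfl (by linarith : 0 ≤ α + β) x
  have q0 : qq α β 0 = α ^ 2 - β ^ 2 := by unfold qq; ring
  have hq : Continuous (qq α β) := by unfold qq; fun_prop
  rw [q0] at h
  simp only [zero_mul, neg_zero, Real.exp_zero, mul_one] at h
  rw [← h, T0_eq, ← intervalIntegral.integral_const_mul]
  refine intervalIntegral.integral_mono_on (by linarith)
    ((wq_mul_int hν hβ (by fun_prop) le_rfl (by linarith) (by linarith) le_rfl).const_mul _)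
    (wq_mul_int hν hβ (by fun_prop) le_rfl (by linarith) (by linarith) le_rfl) fun c hc => ?_
  have hw := wq_nonneg (ν := ν) hβ hc.1 hc.2
  have hqn := qq_nonneg hβ hc.1 hc.2
  have hc0 := hc.1
  rw [← mul_assoc]
  refine mul_le_mul_of_nonneg_right (mul_le_mul_of_nonneg_right ?_ (Real.exp_pos _).le) hw
  have : 0 ≤ (2 * ν + 1) * c := mul_nonneg (by linarith) hc0
  have : 0 ≤ x * qq α β c := by positivity
  nlinarith

/-- if `q ≤ Q` then, for r ≥ 2, `x T0 ≤ Q^p` -/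
lemma T0_bound_b {ν α β Q : ℝ} (hν : 1/2 ≤ ν) (hβ : |β| < α)
    (hQ : ∀ c, 0 ≤ c → c ≤ α + β → qq α β c ≤ Q) {x : ℝ} (hx : 0 ≤ x) :
    x * Ti 0 ν α β x ≤ Q ^ (ν - 1/2) := by
  have hb := abs_lt.1 hβ
  have hQ0 : 0 ≤ Q := (qq_nonneg hβ le_rfl (by linarith)).trans (hQ 0 le_rfl (by linarith))
  have h1 : Ti 0 ν α β x ≤ Q ^ (ν - 1/2) * ∫ c in (0:ℝ)..(α+β), exp (-(c * x)) := by
    rw [T0_eq, ← intervalIntegral.integral_const_mul]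
    refine intervalIntegral.integral_mono_on (by linarith)
      (wq_mul_int (by linarith) hβ (by fun_prop) le_rfl (by linarith) (by linarith) le_rfl)
      (Continuous.intervalIntegrable (by fun_prop) _ _) fun c hc => ?_
    rw [mul_comm]
    refine mul_le_mul_of_nonneg_right ?_ (Real.exp_pos _).le
    exact Real.rpow_le_rpow (qq_nonneg hβ hc.1 hc.2) (hQ c hc.1 hc.2) (by linarith)
  have h2 := x_int_exp (by linarith : 0 ≤ α + β) le_rfl hx
  have h3 : 0 ≤ Q ^ (ν - 1/2) := by positivity
  calc x * Ti 0 ν α β x ≤ x * (Q ^ (ν - 1/2) * ∫ c in (0:ℝ)..(α+β), exp (-(c * x))) := by gcongr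
    _ = Q ^ (ν - 1/2) * (x * ∫ c in (0:ℝ)..(α+β), exp (-(c * x))) := by ring
    _ ≤ _ := mul_le_of_le_one_right h3 h2

noncomputable def cc (α β : ℝ) : ℝ := β + √(β ^ 2 + (α ^ 2 - β ^ 2) / 2)

lemma gam_pos {α β : ℝ} (hβ : |β| < α) : 0 < α ^ 2 - β ^ 2 := by
  have hb := abs_lt.1 hβ
  nlinarith

lemma cc_facts {α β : ℝ} (hβ : |β| < α) : 0 < cc α β ∧ cc α β ≤ α + β ∧ |β| < cc α β - β ∧
    qq α β (cc α β) = (α ^ 2 - β ^ 2) / 2 ∧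
    α ^ 2 - β ^ 2 = 2 * cc α β * (cc α β - 2 * β) := by
  have hb := abs_lt.1 hβ
  have hg := gam_pos hβ
  have hs : √(β ^ 2 + (α ^ 2 - β ^ 2) / 2) ^ 2 = β ^ 2 + (α ^ 2 - β ^ 2) / 2 :=
    Real.sq_sqrt (by positivity)
  have h1 : |β| < √(β ^ 2 + (α ^ 2 - β ^ 2) / 2) := by
    rw [← Real.sqrt_sq_eq_abs]
    exact Real.sqrt_lt_sqrt (sq_nonneg _) (by linarith)
  have h2 : √(β ^ 2 + (α ^ 2 - β ^ 2) / 2) ≤ α := by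
    apply Real.sqrt_le_iff.2 ⟨by linarith [abs_nonneg β], by linarith⟩
  have h3 := neg_abs_le β
  unfold cc qq
  refine ⟨by linarith, by linarith, by linarith, ?_, ?_⟩
  · rw [add_sub_cancel_left, hs]; ring
  · nlinarith

/-- (c) -/
lemma T0_bound_c {ν α β K : ℝ} (hν : -(1/2) < ν) (hν' : ν < 1/2) (hβ : |β| < α) 
    (hK : (α ^ 2 - β ^ 2) ≤ K * cc α β * (cc α β - β)) {x : ℝ} (hx : 0 ≤ x) :
    (α ^ 2 - β ^ 2) * x * Ti 0 ν α β x ≤ (α ^ 2 - β ^ 2) ^ (ν + 1/2) *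
      (2 + K / (2 * ν + 1) * (cc α β * x * exp (-(cc α β * x)))) := by
  have hb := abs_lt.1 hβ
  obtain ⟨c0, cL, cb, cq, cg⟩ := cc_facts hβ
  have hg := gam_pos hβ
  set γ := α ^ 2 - β ^ 2 with hγ
  set c1 := cc α β
  have hr : 0 < 2 * ν + 1 := by linarith
  have hcb : 0 < c1 - β := lt_of_le_of_lt (abs_nonneg _) cb
  have hs1 : IntervalIntegrable (fun c => exp (-(c * x)) * wq ν α β c) volume 0 c1 :=
    wq_mul_int hν hβ (by fun_prop) le_rfl (by linarith) (by linarith) cL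
  have hs2 : IntervalIntegrable (fun c => exp (-(c * x)) * wq ν α β c) volume c1 (α + β) :=
    wq_mul_int hν hβ (by fun_prop) (by linarith) (by linarith) (by linarith) le_rfl
  have hG : γ * γ ^ (ν - 1/2) = γ ^ (ν + 1/2) := by
    rw [show ν + 1/2 = 1 + (ν - 1/2) by ring, Real.rpow_add hg, Real.rpow_one]
  have p1 : (∫ c in (0:ℝ)..c1, exp (-(c * x)) * wq ν α β c) ≤
      (2 * γ ^ (ν - 1/2)) * ∫ c in (0:ℝ)..c1, exp (-(c * x)) := by
    rw [← intervalIntegral.integral_const_mul]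
    refine intervalIntegral.integral_mono_on c0.le hs1
      (Continuous.intervalIntegrable (by fun_prop) _ _) fun c hc => ?_
    rw [mul_comm]
    refine mul_le_mul_of_nonneg_right ?_ (Real.exp_pos _).le
    have hq : γ / 2 ≤ qq α β c := by
      have h1 : (c - β) ^ 2 ≤ (c1 - β) ^ 2 := by
        apply sq_le_sq'
        · have := hc.1; have := le_abs_self β; linarith
        · have := hc.2; linarith
      rw [← cq]; unfold qq; linarith
    calc wq ν α β c ≤ (γ / 2) ^ (ν - 1/2) :=
          Real.rpow_le_rpow_of_nonpos (by positivity) hq (by linarith)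
      _ = (2:ℝ) ^ (-(ν - 1/2)) * γ ^ (ν - 1/2) := by
          rw [Real.div_rpow hg.le (by norm_num), Real.rpow_neg (by norm_num)]; field_simp
      _ ≤ (2:ℝ) ^ (1:ℝ) * γ ^ (ν - 1/2) := by
          gcongr
          · norm_num
          · linarith
      _ = _ := by rw [Real.rpow_one]
  have p2 : (∫ c in c1..(α + β), exp (-(c * x)) * wq ν α β c) ≤
      exp (-(c1 * x)) / ((c1 - β) * (2 * ν + 1)) * γ ^ (ν + 1/2) := by
    have h := wq_ftc hν hβ c0.le cL 0
    simp only [zero_mul, mul_zero, neg_zero, Real.exp_zero, mul_one, add_zero, cq] at h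
    have h5 : (γ / 2) ^ (ν + 1/2) ≤ γ ^ (ν + 1/2) :=
      Real.rpow_le_rpow (by positivity) (by linarith) (by linarith)
    refine le_trans ?_ (mul_le_mul_of_nonneg_left h5 (by positivity))
    rw [← h, ← intervalIntegral.integral_const_mul]
    refine intervalIntegral.integral_mono_on cL hs2
      ((wq_mul_int hν hβ (by fun_prop) c0.le cL (by linarith) le_rfl).const_mul _) fun c hc => ?_
    have hw := wq_nonneg (ν := ν) hβ (c0.le.trans hc.1) hc.2
    rw [← mul_assoc]
    refine mul_le_mul_of_nonneg_right ?_ hw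
    have e1 : exp (-(c * x)) ≤ exp (-(c1 * x)) := by
      apply Real.exp_le_exp.2
      have := mul_le_mul_of_nonneg_right hc.1 hx
      linarith
    have e2 : exp (-(c1 * x)) / ((c1 - β) * (2 * ν + 1)) * ((2 * ν + 1) * (c - β)) =
        exp (-(c1 * x)) * ((c - β) / (c1 - β)) := by field_simp
    rw [e2]
    have e3 : 1 ≤ (c - β) / (c1 - β) := by
      rw [one_le_div hcb]; linarith [hc.1]
    exact e1.trans (le_mul_of_one_le_right (Real.exp_pos _).le e3)
  have h2 := x_int_exp c0.le le_rfl hx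
  rw [T0_eq, ← intervalIntegral.integral_add_adjacent_intervals hs1 hs2, mul_add]
  have hGp : 0 < γ ^ (ν + 1/2) := by positivity
  have hGp' : 0 < γ ^ (ν - 1/2) := by positivity
  have b1 : γ * x * (∫ c in (0:ℝ)..c1, exp (-(c * x)) * wq ν α β c) ≤ γ ^ (ν + 1/2) * 2 := by
    calc _ ≤ γ * x * ((2 * γ ^ (ν - 1/2)) * ∫ c in (0:ℝ)..c1, exp (-(c * x))) := by gcongr
      _ = 2 * (γ * γ ^ (ν - 1/2)) * (x * ∫ c in (0:ℝ)..c1, exp (-(c * x))) := by ring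
      _ ≤ 2 * (γ * γ ^ (ν - 1/2)) * 1 := by gcongr
      _ = _ := by rw [hG]; ring
  have b2 : γ * x * (∫ c in c1..(α + β), exp (-(c * x)) * wq ν α β c) ≤ γ ^ (ν + 1/2) *
      (K / (2 * ν + 1) * (c1 * x * exp (-(c1 * x)))) := by
    calc _ ≤ γ * x * (exp (-(c1 * x)) / ((c1 - β) * (2 * ν + 1)) * γ ^ (ν + 1/2)) := by gcongr
      _ ≤ (K * c1 * (c1 - β)) * x *
          (exp (-(c1 * x)) / ((c1 - β) * (2 * ν + 1)) * γ ^ (ν + 1/2)) := by gcongr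
      _ = _ := by field_simp
  linarith

/-- (d) -/
lemma T0_bound_d {ν α β : ℝ} (hν : -(1/2) < ν) (hν' : ν < 1/2) (hβ : |β| < α) (hβ0 : 0 ≤ β)
    {x : ℝ} (hx : 0 ≤ x) :
    (2 * ν + 1) * β * Ti 0 ν α β x ≤ 4 * (α ^ 2 / (α ^ 2 - β ^ 2)) * (α ^ 2 - β ^ 2) ^ (ν + 1/2) := by
  have hb := abs_lt.1 hβ
  have hg := gam_pos hβ
  set γ := α ^ 2 - β ^ 2 with hγ
  have hα : 0 < α := by linarith
  have hr : 0 < 2 * ν + 1 := by linarith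
  have hs1 : IntervalIntegrable (wq ν α β) volume 0 β := by
    simpa using wq_mul_int hν hβ (f := fun _ => 1) (by fun_prop) le_rfl (by linarith) hβ0 (by linarith)
  have hs2 : IntervalIntegrable (wq ν α β) volume β (α + β) := by
    simpa using wq_mul_int hν hβ (f := fun _ => 1) (by fun_prop) hβ0 (by linarith)
      (by linarith : 0 ≤ α + β) le_rfl
  have h0 : Ti 0 ν α β x ≤ ∫ c in (0:ℝ)..(α + β), wq ν α β c := by
    refine (Ti_le_zero hν hβ 0 hx).trans (le_of_eq ?_)
    unfold Ti; congr 1; funext c; simp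
  have h1 : (∫ c in (0:ℝ)..β, wq ν α β c) ≤ β * γ ^ (ν - 1/2) := by
    have : (∫ c in (0:ℝ)..β, wq ν α β c) ≤ ∫ c in (0:ℝ)..β, γ ^ (ν - 1/2) := by
      refine intervalIntegral.integral_mono_on hβ0 hs1 (by simp) fun c hc => ?_
      refine Real.rpow_le_rpow_of_nonpos hg ?_ (by linarith)
      unfold qq
      nlinarith [hc.1, hc.2]
    simpa using this
  have hInt : IntervalIntegrable (fun c => (α + β - c) ^ (ν - 1/2)) volume β (α + β) := by
    have h1 : IntervalIntegrable (fun c : ℝ => c ^ (ν - 1/2)) volume 0 α :=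
      intervalIntegral.intervalIntegrable_rpow' (by linarith)
    have h2 := (h1.comp_sub_left (α + β)).symm
    simpa using h2
  have h2 : (∫ c in β..(α + β), wq ν α β c) ≤ α ^ (2 * ν) * (2 / (2 * ν + 1)) := by
    have e1 : (∫ c in β..(α + β), wq ν α β c) ≤
        ∫ c in β..(α + β), α ^ (ν - 1/2) * (α + β - c) ^ (ν - 1/2) := by
      refine intervalIntegral.integral_mono_on_of_le_Ioo (by linarith) hs2 (hInt.const_mul _)
        fun c hc => ?_
      rw [← Real.mul_rpow hα.le (by linarith [hc.2])]
      refine Real.rpow_le_rpow_of_nonpos (mul_pos hα (by linarith [hc.2])) ?_ (by linarith)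
      unfold qq
      nlinarith [hc.1, hc.2]
    refine e1.trans (le_of_eq ?_)
    rw [intervalIntegral.integral_const_mul,
      intervalIntegral.integral_comp_sub_left (fun c => c ^ (ν - 1/2))]
    simp only [sub_self, add_sub_cancel_right]
    rw [integral_rpow (Or.inl (by linarith)), Real.zero_rpow (by linarith)]
    have e : α ^ (2 * ν) = α ^ (ν - 1/2) * α ^ ((2 * ν + 1) / 2) := by
      rw [← Real.rpow_add hα]; congr 1; ring
    rw [e, show ν - 1/2 + 1 = (2 * ν + 1) / 2 by ring, sub_zero]
    generalize α ^ ((2 * ν + 1) / 2) = t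
    field_simp
  rw [← intervalIntegral.integral_add_adjacent_intervals hs1 hs2] at h0
  have hG : γ ^ (ν + 1/2) = γ * γ ^ (ν - 1/2) := by
    rw [show ν + 1/2 = 1 + (ν - 1/2) by ring, Real.rpow_add hg, Real.rpow_one]
  have hA : α ^ (2 * ν) * β ≤ α ^ 2 * γ ^ (ν - 1/2) := by
    have e1 : (α ^ 2) ^ (ν - 1/2) ≤ γ ^ (ν - 1/2) :=
      Real.rpow_le_rpow_of_nonpos hg (by nlinarith) (by linarith)
    have e2 : α ^ (2 * ν) * α = α ^ 2 * (α ^ 2) ^ (ν - 1/2) := by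
      rw [← Real.rpow_two, ← Real.rpow_mul hα.le, ← Real.rpow_add hα]
      nth_rewrite 2 [← Real.rpow_one α]
      rw [← Real.rpow_add hα]
      congr 1; ring
    calc α ^ (2 * ν) * β ≤ α ^ (2 * ν) * α := by gcongr; linarith
      _ = _ := e2
      _ ≤ _ := by gcongr
  have hp : 0 < γ ^ (ν - 1/2) := by positivity
  calc (2 * ν + 1) * β * Ti 0 ν α β x
      ≤ (2 * ν + 1) * β * (β * γ ^ (ν - 1/2) + α ^ (2 * ν) * (2 / (2 * ν + 1))) := by
        gcongr; linarith
    _ = (2 * ν + 1) * (β * β) * γ ^ (ν - 1/2) + 2 * (α ^ (2 * ν) * β) := by field_simp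
    _ ≤ 2 * (α ^ 2) * γ ^ (ν - 1/2) + 2 * (α ^ 2 * γ ^ (ν - 1/2)) := by
        gcongr
        · linarith
        · nlinarith
    _ = _ := by rw [hG]; field_simp; ring

/-- (e1) -/
lemma T0_bound_e1 {ν α β : ℝ} (hν : 1/2 ≤ ν) (hβ : |β| < α) {x : ℝ} (hx : 0 ≤ x) :
    Ti 0 ν α β x ≤ 2 * α ^ (2 * ν) := by
  have hb := abs_lt.1 hβ
  have hα : 0 < α := by linarith
  have hs1 : IntervalIntegrable (wq ν α β) volume 0 (α + β) := wq_int (by linarith) hβ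
  have h0 : Ti 0 ν α β x ≤ ∫ c in (0:ℝ)..(α + β), wq ν α β c := by
    refine (Ti_le_zero (by linarith) hβ 0 hx).trans (le_of_eq ?_)
    unfold Ti; congr 1; funext c; simp
  have h1 : (∫ c in (0:ℝ)..(α + β), wq ν α β c) ≤ ∫ c in (0:ℝ)..(α + β), (α ^ 2) ^ (ν - 1/2) := by
    refine intervalIntegral.integral_mono_on (by linarith) hs1 (by simp) fun c hc => ?_
    refine Real.rpow_le_rpow (qq_nonneg hβ hc.1 hc.2) ?_ (by linarith)
    unfold qq; nlinarith
  rw [intervalIntegral.integral_const] at h1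
  have e2 : α * (α ^ 2) ^ (ν - 1/2) = α ^ (2 * ν) := by
    rw [← Real.rpow_two, ← Real.rpow_mul hα.le]
    nth_rewrite 1 [← Real.rpow_one α]
    rw [← Real.rpow_add hα]
    congr 1; ring
  have hp : 0 < (α ^ 2) ^ (ν - 1/2) := by positivity
  simp only [sub_zero, smul_eq_mul] at h1
  calc _ ≤ _ := h0
    _ ≤ _ := h1
    _ ≤ (2 * α) * (α ^ 2) ^ (ν - 1/2) := by gcongr; linarith
    _ = _ := by rw [← e2]; ring

/-- (e2) -/
lemma T0_bound_e2 {ν α β : ℝ} (hν : 1/2 < ν) (hβ : |β| < α) {x : ℝ} (hx : 0 ≤ x) :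
    Ti 0 ν α β x ≤ √(π / (ν - 1/2)) * α ^ (2 * ν) := by
  have hb := abs_lt.1 hβ
  have hα : 0 < α := by linarith
  have hs1 : IntervalIntegrable (wq ν α β) volume 0 (α + β) := wq_int (by linarith) hβ
  have hp0 : 0 < ν - 1/2 := by linarith
  have h0 : Ti 0 ν α β x ≤ ∫ c in (0:ℝ)..(α + β), wq ν α β c := by
    refine (Ti_le_zero (by linarith) hβ 0 hx).trans (le_of_eq ?_)
    unfold Ti; congr 1; funext c; simp
  set b := (ν - 1/2) / α ^ 2 with hbdef
  have hbp : 0 < b := by positivity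
  have hgi : Integrable (fun c : ℝ => exp (-b * (c - β) ^ 2)) :=
    (integrable_exp_neg_mul_sq hbp).comp_sub_right β
  have h1 : (∫ c in (0:ℝ)..(α + β), wq ν α β c) ≤
      ∫ c in (0:ℝ)..(α + β), (α ^ 2) ^ (ν - 1/2) * exp (-b * (c - β) ^ 2) := by
    refine intervalIntegral.integral_mono_on (by linarith) hs1
      (Continuous.intervalIntegrable (by fun_prop) _ _) fun c hc => ?_
    have e1 : qq α β c ≤ α ^ 2 * exp (-((c - β) ^ 2 / α ^ 2)) := by
      have := Real.add_one_le_exp (-((c - β) ^ 2 / α ^ 2))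
      have h2 : α ^ 2 * (-((c - β) ^ 2 / α ^ 2) + 1) = qq α β c := by unfold qq; field_simp; ring
      rw [← h2]; gcongr
    calc wq ν α β c ≤ (α ^ 2 * exp (-((c - β) ^ 2 / α ^ 2))) ^ (ν - 1/2) :=
          Real.rpow_le_rpow (qq_nonneg hβ hc.1 hc.2) e1 (by linarith)
      _ = _ := by
          rw [Real.mul_rpow (by positivity) (by positivity), ← Real.exp_mul]
          congr 2; rw [hbdef]; ring
  have h3 : (∫ c in (0:ℝ)..(α + β), (α ^ 2) ^ (ν - 1/2) * exp (-b * (c - β) ^ 2)) ≤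
      (α ^ 2) ^ (ν - 1/2) * √(π / b) := by
    rw [intervalIntegral.integral_const_mul]
    gcongr
    rw [intervalIntegral.integral_of_le (by linarith), ← integral_gaussian b,
      ← integral_sub_right_eq_self (fun c => exp (-b * c ^ 2)) β]
    exact setIntegral_le_integral hgi (Eventually.of_forall fun c => (Real.exp_pos _).le)
  have e2 : α * (α ^ 2) ^ (ν - 1/2) = α ^ (2 * ν) := by
    rw [← Real.rpow_two, ← Real.rpow_mul hα.le]
    nth_rewrite 1 [← Real.rpow_one α]
    rw [← Real.rpow_add hα]
    congr 1; ring
  have e3 : √(π / b) = α * √(π / (ν - 1/2)) := by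
    rw [show π / b = α ^ 2 * (π / (ν - 1/2)) by rw [hbdef]; field_simp,
      Real.sqrt_mul (by positivity), Real.sqrt_sq hα.le]
  calc _ ≤ _ := h0
    _ ≤ _ := h1
    _ ≤ _ := h3
    _ = _ := by rw [← e2, e3]; ring

end TT

section Core
open Set Topology

/-- Slope lemma. -/
lemma slope_lemma {a b p q φ A B : ℝ → ℝ} {a' b' x H : ℝ} (ha : HasDerivAt a a' x)
    (hb : HasDerivAt b b' x) (hp : ContinuousAt p x) (hq : ContinuousAt q x)
    (hφ : ∀ t, |φ t| ≤ H)
    (hpi : ∀ᶠ y in 𝓝 x, IntervalIntegrable (fun t => p t * φ t) volume x y)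
    (hqi : ∀ᶠ y in 𝓝 x, IntervalIntegrable (fun t => q t * φ t) volume x y)
    (hA : ∀ᶠ y in 𝓝 x, A y = A x + ∫ t in x..y, p t * φ t)
    (hB : ∀ᶠ y in 𝓝 x, B y = B x - ∫ t in x..y, q t * φ t) :
    ∀ ε > 0, ∀ᶠ y in 𝓝 x, |(a y * A y + b y * B y) - (a x * A x + b x * B x)
      - (a' * A x + b' * B x) * (y - x)| ≤ (|a x * p x - b x * q x| * H + ε) * |y - x| := by
  intro ε hε
  have hH : 0 ≤ H := (abs_nonneg _).trans (hφ 0)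
  set κ := |a x * p x - b x * q x| with hκ
  set δ := ε / (2 * (H + 1)) with hδ
  have hδp : 0 < δ := by positivity
  have hδH : δ * H ≤ ε / 2 := by
    rw [hδ, div_mul_eq_mul_div, div_le_div_iff₀ (by positivity) (by norm_num)]
    nlinarith
  have h1 : HasDerivAt (fun y => a y * A x + b y * B x) (a' * A x + b' * B x) x :=
    (ha.mul_const _).add (hb.mul_const _)
  have h2 := (hasDerivAt_iff_isLittleO.1 h1).def (half_pos hε)
  have hc : ContinuousAt (fun z : ℝ × ℝ => |a z.1 * p z.2 - b z.1 * q z.2|) (x, x) := by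
    have ca : ContinuousAt (fun z : ℝ × ℝ => a z.1) (x, x) :=
      ContinuousAt.comp (f := Prod.fst) (x := (x, x)) ha.continuousAt continuousAt_fst
    have cb : ContinuousAt (fun z : ℝ × ℝ => b z.1) (x, x) :=
      ContinuousAt.comp (f := Prod.fst) (x := (x, x)) hb.continuousAt continuousAt_fst
    have cp : ContinuousAt (fun z : ℝ × ℝ => p z.2) (x, x) :=
      ContinuousAt.comp (f := Prod.snd) (x := (x, x)) hp continuousAt_snd
    have cq : ContinuousAt (fun z : ℝ × ℝ => q z.2) (x, x) :=
      ContinuousAt.comp (f := Prod.snd) (x := (x, x)) hq continuousAt_snd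
    exact ((ca.mul cp).sub (cb.mul cq)).abs
  have h3 : ∀ᶠ z : ℝ × ℝ in 𝓝 (x, x), |a z.1 * p z.2 - b z.1 * q z.2| < κ + δ :=
    hc.eventually (gt_mem_nhds (by simp only [hκ]; linarith))
  obtain ⟨η, hη, hball⟩ := Metric.eventually_nhds_iff.1 h3
  filter_upwards [h2, hpi, hqi, hA, hB, Metric.ball_mem_nhds x hη] with y h2 hpi hqi hA hB hy
  have hy' : |y - x| < η := by rw [← Real.dist_eq]; exact hy
  have e : (a y * A y + b y * B y) - (a x * A x + b x * B x) - (a' * A x + b' * B x) * (y - x)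
      = ((a y * A x + b y * B x) - (a x * A x + b x * B x) - (y - x) • (a' * A x + b' * B x)) +
        ∫ t in x..y, (a y * p t - b y * q t) * φ t := by
    have : (∫ t in x..y, (a y * p t - b y * q t) * φ t) =
        a y * (∫ t in x..y, p t * φ t) - b y * ∫ t in x..y, q t * φ t := by
      rw [← intervalIntegral.integral_const_mul, ← intervalIntegral.integral_const_mul,
        ← intervalIntegral.integral_sub (hpi.const_mul _) (hqi.const_mul _)]
      congr 1; funext t; ring
    rw [this, hA, hB, smul_eq_mul]; ring
  rw [e]
  have h4 : ‖∫ t in x..y, (a y * p t - b y * q t) * φ t‖ ≤ ((κ + δ) * H) * |y - x| := by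
    refine intervalIntegral.norm_integral_le_of_norm_le_const fun t ht => ?_
    rw [norm_mul]
    have ht' : |t - x| ≤ |y - x| := by
      have := uIoc_subset_uIcc ht
      exact abs_sub_left_of_mem_uIcc this
    have := hball (y := (y, t)) (by
      rw [Prod.dist_eq, max_lt_iff, Real.dist_eq, Real.dist_eq]
      exact ⟨hy', lt_of_le_of_lt ht' hy'⟩)
    exact mul_le_mul this.le (hφ t) (norm_nonneg _) (by positivity)
  rw [Real.norm_eq_abs] at h4
  rw [Real.norm_eq_abs, Real.norm_eq_abs] at h2
  refine (abs_add_le _ _).trans ?_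
  have := abs_nonneg (y - x)
  nlinarith

/-- From slope estimate to derivative estimate. -/
lemma deriv_of_slope {G : ℝ → ℝ} {d e K x : ℝ} (hd : HasDerivAt G d x)
    (hs : ∀ ε > 0, ∀ᶠ y in 𝓝 x, |G y - G x - e * (y - x)| ≤ (K + ε) * |y - x|) : |d - e| ≤ K := by
  refine le_of_forall_pos_le_add fun ε hε => ?_
  have h2 := (hasDerivAt_iff_isLittleO.1 hd).def (half_pos hε)
  have h3 : ∀ᶠ y in 𝓝[>] x, |d - e| ≤ K + ε := by
    filter_upwards [nhdsWithin_le_nhds (hs _ (half_pos hε)), nhdsWithin_le_nhds h2,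
      self_mem_nhdsWithin] with y h1 h2 hy
    have hyx : 0 < y - x := sub_pos.2 hy
    rw [Real.norm_eq_abs, Real.norm_eq_abs, smul_eq_mul, abs_sub_comm] at h2
    have h4 : |(d - e) * (y - x)| ≤ (K + ε) * |y - x| := by
      calc |(d - e) * (y - x)|
          = |((y - x) * d - (G y - G x)) + (G y - G x - e * (y - x))| := by congr 1; ring
        _ ≤ _ := abs_add_le _ _
        _ ≤ ε / 2 * |y - x| + (K + ε / 2) * |y - x| := add_le_add h2 h1
        _ = _ := by ring
    rw [abs_mul] at h4
    exact le_of_mul_le_mul_right h4 (abs_pos.2 hyx.ne')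
  exact h3.exists.choose_spec

lemma hasDerivAt_of_slope {G : ℝ → ℝ} {e x : ℝ}
    (hs : ∀ ε > 0, ∀ᶠ y in 𝓝 x, |G y - G x - e * (y - x)| ≤ (0 + ε) * |y - x|) :
    HasDerivAt G e x := by
  rw [hasDerivAt_iff_isLittleO, Asymptotics.isLittleO_iff]
  intro c hc
  filter_upwards [hs c hc] with y hy
  rw [Real.norm_eq_abs, Real.norm_eq_abs, smul_eq_mul, mul_comm (y - x)]
  simpa using hy

/-- Comparison with barrier. -/
lemma barrier {Φ Ψ Ψ' L : ℝ → ℝ} {a b : ℝ} (hab : a ≤ b) (hΦ : ContinuousOn Φ (Icc a b))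
    (hL : ∀ x ∈ Icc a b, ∀ ε > 0, ∀ᶠ y in 𝓝 x, |Φ y - Φ x| ≤ (L x + ε) * |y - x|)
    (hΨ : ∀ x ∈ Icc a b, HasDerivAt Ψ (Ψ' x) x) (hΨ' : ∀ x ∈ Icc a b, L x ≤ Ψ' x)
    (hpos : 0 ≤ Ψ a) : |Φ b| ≤ Ψ b + |Φ a| := by
  have key := image_le_of_liminf_slope_right_le_deriv_boundary (f := fun x => |Φ x|)
    (a := a) (b := b) hΦ.abs (B := fun x => Ψ x + (|Φ a| - Ψ a)) (B' := Ψ') (by simp)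
    (fun x hx => ((hΨ x hx).add_const _).continuousAt.continuousWithinAt)
    (fun x hx => ((hΨ x (Ico_subset_Icc_self hx)).add_const _).hasDerivWithinAt)
    (fun x hx r hr => ?_) (right_mem_Icc.2 hab)
  · linarith
  · apply Eventually.frequently
    have hx' := Ico_subset_Icc_self hx
    have := hL x hx' ((r - L x) / 2) (by linarith [hΨ' x hx'])
    filter_upwards [nhdsWithin_le_nhds this, self_mem_nhdsWithin] with z hz hzx
    have hzx' : 0 < z - x := sub_pos.2 hzx
    rw [slope_def_field, div_lt_iff₀ hzx']
    rw [abs_of_pos hzx'] at hz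
    have := abs_sub_abs_le_abs_sub (Φ z) (Φ x)
    have := hΨ' x hx'
    nlinarith

lemma barrier_back {Φ Ψ Ψ' L : ℝ → ℝ} {a b : ℝ} (hab : a ≤ b) (hΦ : ContinuousOn Φ (Icc a b))
    (hL : ∀ x ∈ Icc a b, ∀ ε > 0, ∀ᶠ y in 𝓝 x, |Φ y - Φ x| ≤ (L x + ε) * |y - x|)
    (hΨ : ∀ x ∈ Icc a b, HasDerivAt Ψ (Ψ' x) x) (hΨ' : ∀ x ∈ Icc a b, Ψ' x ≤ - L x)
    (hpos : 0 ≤ Ψ b) : |Φ a| ≤ Ψ a + |Φ b| := by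
  have hm : ∀ x ∈ Icc (-b) (-a), -x ∈ Icc a b := fun x hx => ⟨by linarith [hx.2], by linarith [hx.1]⟩
  have := barrier (Φ := fun x => Φ (-x)) (Ψ := fun x => Ψ (-x)) (Ψ' := fun x => -Ψ' (-x))
    (L := fun x => L (-x)) (a := -b) (b := -a) (by linarith)
    (hΦ.comp (by fun_prop) hm)
    (fun x hx ε hε => ?_) (fun x hx => ?_) (fun x hx => by linarith [hΨ' _ (hm x hx)])
    (by simpa using hpos)
  · simpa using this
  · have h1 := hL _ (hm x hx) ε hε
    have h2 : Tendsto (fun y : ℝ => -y) (𝓝 x) (𝓝 (-x)) := continuous_neg.tendsto x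
    filter_upwards [h2.eventually h1] with y hy
    rw [show -y - -x = -(y - x) by ring, abs_neg] at hy
    exact hy
  · refine ((hΨ _ (hm x hx)).comp x (hasDerivAt_neg x)).congr_deriv ?_
    ring

end Core

section Core2
open Set Topology

noncomputable def tn (n : ℕ) (ν α β x : ℝ) : ℝ := Ti n ν α β x / (α ^ 2 - β ^ 2) ^ (ν + 1/2)
noncomputable def hU (ν α β t : ℝ) : ℝ := mm ν β t * vv ν α β t / t
noncomputable def hV (ν α β t : ℝ) : ℝ := mm ν β t * uu ν α β t / t

lemma G_pos {α β : ℝ} (hβ : |β| < α) (ν : ℝ) : 0 < (α ^ 2 - β ^ 2) ^ (ν + 1/2) :=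
  Real.rpow_pos_of_pos (gam_pos hβ) _

lemma tn_hasDerivAt {ν α β : ℝ} (hν : -(1/2) < ν) (hβ : |β| < α) (n : ℕ) (x : ℝ) :
    HasDerivAt (tn n ν α β) (-tn (n + 1) ν α β x) x := by
  refine ((Ti_hasDerivAt hν hβ n x).div_const _).congr_deriv ?_
  unfold tn; ring

lemma tn_nonneg {ν α β : ℝ} (hβ : |β| < α) (n : ℕ) (x : ℝ) : 0 ≤ tn n ν α β x :=
  div_nonneg (Ti_nonneg hβ n x) (G_pos hβ ν).le

lemma tn_le {ν α β : ℝ} (hν : -(1/2) < ν) (hβ : |β| < α) (n : ℕ) {x : ℝ} (hx : 0 ≤ x) :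
    tn n ν α β x ≤ tn n ν α β 0 :=
  div_le_div_of_nonneg_right (Ti_le_zero hν hβ n hx) (G_pos hβ ν).le

lemma tn_ode {ν α β : ℝ} (hν : -(1/2) < ν) (hβ : |β| < α) (x : ℝ) :
    x * tn 2 ν α β x - (2 * ν + 1 + 2 * β * x) * tn 1 ν α β x +
      ((2 * ν + 1) * β - (α ^ 2 - β ^ 2) * x) * tn 0 ν α β x = -1 := by
  have h := Ti_ode hν hβ x
  have hG := (G_pos hβ ν).ne'
  unfold tn
  generalize (α ^ 2 - β ^ 2) ^ (ν + 1/2) = g at *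
  field_simp
  linear_combination h

lemma prim_hasDerivAt {ν α β x : ℝ} (hν : -(1/2) < ν) (hβ : |β| < α) (hx : 0 < x) {y dy : ℝ → ℝ}
    (hy : HasDerivAt y (dy x) x) (hdy : HasDerivAt dy ((-(2 * ν + 1 + 2 * β * x) * dy x
      - ((2 * ν + 1) * β - (α ^ 2 - β ^ 2) * x) * y x) / x) x) :
    HasDerivAt (fun x => mm ν β x * (dy x * tn 0 ν α β x + y x * tn 1 ν α β x))
      (mm ν β x * y x / x) x := by
  have hm := mm_hasDerivAt (ν := ν) (β := β) hx
  have h0 := tn_hasDerivAt hν hβ 0 x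
  have h1 := tn_hasDerivAt hν hβ 1 x
  have ho := tn_ode hν hβ x
  refine (hm.mul ((hdy.mul h0).add (hy.mul h1))).congr_deriv ?_
  simp only [Pi.add_apply, Pi.mul_apply, zero_add, Nat.reduceAdd]
  generalize tn 0 ν α β x = t0 at *
  generalize tn 1 ν α β x = t1 at *
  generalize tn 2 ν α β x = t2 at *
  generalize mm ν β x = m at *
  generalize y x = Y at *
  generalize dy x = dY at *
  field_simp
  linear_combination -(m * Y) * ho

lemma mm_continuous {ν β : ℝ} (hν : -(1/2) < ν) : Continuous (mm ν β) := by
  unfold mm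
  refine Continuous.mul (Continuous.rpow_const continuous_id fun _ => Or.inr (by linarith)) ?_
  fun_prop

lemma mm_zero {ν β : ℝ} (hν : -(1/2) < ν) : mm ν β 0 = 0 := by
  unfold mm; rw [Real.zero_rpow (by linarith), zero_mul]

lemma tn_continuous {ν α β : ℝ} (hν : -(1/2) < ν) (hβ : |β| < α) (n : ℕ) :
    Continuous (tn n ν α β) :=
  continuous_iff_continuousAt.2 fun x => (tn_hasDerivAt hν hβ n x).continuousAt

lemma hU_nonneg {ν α β t : ℝ} (hν : -(1/2) < ν) (ht : 0 < t) : 0 ≤ hU ν α β t := by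
  have := mm_pos (ν := ν) (β := β) ht
  have := vv_pos (α := α) (β := β) (x := t) hν
  unfold hU; positivity

lemma hV_nonneg {ν α β t : ℝ} (hα : 0 < α) (ht : 0 < t) : 0 ≤ hV ν α β t := by
  have := mm_pos (ν := ν) (β := β) ht
  have := uu_pos (ν := ν) (β := β) hα ht
  unfold hV; positivity

lemma hU_int {ν α β x : ℝ} (hν : -(1/2) < ν) (hβ : |β| < α) (hx : 0 ≤ x) :
    IntervalIntegrable (hU ν α β) volume 0 x ∧ ∫ t in (0:ℝ)..x, hU ν α β t =
      mm ν β x * (dv ν α β x * tn 0 ν α β x + vv ν α β x * tn 1 ν α β x) := by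
  have hc : Continuous (fun x => mm ν β x * (dv ν α β x * tn 0 ν α β x + vv ν α β x * tn 1 ν α β x)) :=
    (mm_continuous hν).mul (((dv_continuous hν).mul (tn_continuous hν hβ 0)).add
      ((vv_continuous hν).mul (tn_continuous hν hβ 1)))
  have hd : ∀ t ∈ Ioo 0 x, HasDerivAt
      (fun x => mm ν β x * (dv ν α β x * tn 0 ν α β x + vv ν α β x * tn 1 ν α β x))
      (hU ν α β t) t := fun t ht =>
    prim_hasDerivAt hν hβ ht.1 (vv_hasDerivAt hν) (dv_hasDerivAt hν ht.1)
  have hi : IntervalIntegrable (hU ν α β) volume 0 x := by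
    rw [intervalIntegrable_iff_integrableOn_Ioc_of_le hx]
    exact intervalIntegral.integrableOn_deriv_of_nonneg hc.continuousOn hd
      fun t ht => hU_nonneg hν ht.1
  refine ⟨hi, ?_⟩
  rw [intervalIntegral.integral_eq_sub_of_hasDerivAt_of_le hx hc.continuousOn hd hi, mm_zero hν]
  ring

lemma alpha_pos {α β : ℝ} (hβ : |β| < α) : 0 < α := (abs_nonneg _).trans_lt hβ

lemma hV_int {ν α β x : ℝ} (hν : -(1/2) < ν) (hβ : |β| < α) (hx : 0 < x) :
    IntegrableOn (hV ν α β) (Ioi x) ∧ ∫ t in Ioi x, hV ν α β t =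
      -(mm ν β x * (du ν α β x * tn 0 ν α β x + uu ν α β x * tn 1 ν α β x)) := by
  have hα := alpha_pos hβ
  have hd : ∀ t, 0 < t → HasDerivAt
      (fun x => mm ν β x * (du ν α β x * tn 0 ν α β x + uu ν α β x * tn 1 ν α β x))
      (hV ν α β t) t := fun t ht =>
    prim_hasDerivAt hν hβ ht (uu_hasDerivAt hα ht) (du_hasDerivAt hα ht)
  have hlim : Tendsto
      (fun x => mm ν β x * (du ν α β x * tn 0 ν α β x + uu ν α β x * tn 1 ν α β x)) atTop (𝓝 0) := by
    obtain ⟨t1, t2⟩ := mu_tendsto (ν := ν) hα hβ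
    have hb : ∀ n, IsBoundedUnder (· ≤ ·) atTop (fun x => ‖tn n ν α β x‖) := fun n => by
      refine ⟨tn n ν α β 0, ?_⟩
      rw [eventually_map]
      filter_upwards [eventually_ge_atTop 0] with x hx
      rw [Real.norm_of_nonneg (tn_nonneg hβ n x)]
      exact tn_le hν hβ n hx
    have := (t2.zero_mul_isBoundedUnder_le (hb 0)).add (t1.zero_mul_isBoundedUnder_le (hb 1))
    rw [add_zero] at this
    refine this.congr fun x => ?_
    ring
  have hcw := (hd x hx).continuousAt.continuousWithinAt (s := Ici x)
  constructor
  · exact integrableOn_Ioi_deriv_of_nonneg hcw (fun t ht => hd t (hx.trans ht))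
      (fun t ht => hV_nonneg hα (hx.trans ht)) hlim
  · rw [integral_Ioi_of_hasDerivAt_of_nonneg hcw (fun t ht => hd t (hx.trans ht))
      (fun t ht => hV_nonneg hα (hx.trans ht)) hlim]
    ring

lemma hU_contAt {ν α β x : ℝ} (hν : -(1/2) < ν) (hx : 0 < x) : ContinuousAt (hU ν α β) x :=
  ((mm_continuous hν).continuousAt.mul (vv_continuous hν).continuousAt).div continuousAt_id hx.ne'

lemma hV_contAt {ν α β x : ℝ} (hν : -(1/2) < ν) (hα : 0 < α) (hx : 0 < x) :
    ContinuousAt (hV ν α β) x :=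
  ((mm_continuous hν).continuousAt.mul (uu_hasDerivAt hα hx).continuousAt).div
    continuousAt_id hx.ne'

/-- data for the core argument -/
noncomputable def UU (ν α β : ℝ) (φ : ℝ → ℝ) (x : ℝ) : ℝ := ∫ t in (0:ℝ)..x, hU ν α β t * φ t
noncomputable def VV (ν α β : ℝ) (φ : ℝ → ℝ) (x : ℝ) : ℝ := ∫ t in Ioi x, hV ν α β t * φ t
noncomputable def FF (ν α β : ℝ) (φ : ℝ → ℝ) (x : ℝ) : ℝ :=
  uu ν α β x * UU ν α β φ x + vv ν α β x * VV ν α β φ x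
noncomputable def dF (ν α β : ℝ) (φ : ℝ → ℝ) (x : ℝ) : ℝ :=
  du ν α β x * UU ν α β φ x + dv ν α β x * VV ν α β φ x

variable {ν α β H : ℝ} {φ : ℝ → ℝ}

lemma hUφ_int (hν : -(1/2) < ν) (hβ : |β| < α) (hφm : Measurable φ) (hφ : ∀ t, |φ t| ≤ H)
    {x : ℝ} (hx : 0 ≤ x) : IntervalIntegrable (fun t => hU ν α β t * φ t) volume 0 x := by
  have h := (hU_int hν hβ hx).1
  rw [intervalIntegrable_iff_integrableOn_Ioc_of_le hx] at h ⊢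
  exact Integrable.mul_bdd (c := H) h hφm.aestronglyMeasurable (Eventually.of_forall hφ)

lemma hVφ_int (hν : -(1/2) < ν) (hβ : |β| < α) (hφm : Measurable φ) (hφ : ∀ t, |φ t| ≤ H)
    {x : ℝ} (hx : 0 < x) : IntegrableOn (fun t => hV ν α β t * φ t) (Ioi x) :=
  Integrable.mul_bdd (c := H) (hV_int hν hβ hx).1 hφm.aestronglyMeasurable (Eventually.of_forall hφ)

lemma UU_bound (hν : -(1/2) < ν) (hβ : |β| < α) (hφ : ∀ t, |φ t| ≤ H)
    {x : ℝ} (hx : 0 ≤ x) : |UU ν α β φ x| ≤ H *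
      (mm ν β x * (dv ν α β x * tn 0 ν α β x + vv ν α β x * tn 1 ν α β x)) := by
  rw [← (hU_int hν hβ hx).2, ← intervalIntegral.integral_const_mul, ← Real.norm_eq_abs]
  unfold UU
  refine intervalIntegral.norm_integral_le_of_norm_le hx (Eventually.of_forall fun t ht => ?_)
    ((hU_int hν hβ hx).1.const_mul H)
  rw [norm_mul, Real.norm_of_nonneg (hU_nonneg hν ht.1), mul_comm]
  exact mul_le_mul_of_nonneg_right (hφ t) (hU_nonneg hν ht.1)

lemma VV_bound (hν : -(1/2) < ν) (hβ : |β| < α) (hφ : ∀ t, |φ t| ≤ H)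
    {x : ℝ} (hx : 0 < x) : |VV ν α β φ x| ≤ H *
      (-(mm ν β x * (du ν α β x * tn 0 ν α β x + uu ν α β x * tn 1 ν α β x))) := by
  rw [← (hV_int hν hβ hx).2, ← integral_const_mul, ← Real.norm_eq_abs]
  unfold VV
  refine norm_integral_le_of_norm_le ((hV_int hν hβ hx).1.const_mul H) ?_
  filter_upwards [ae_restrict_mem measurableSet_Ioi] with t ht
  have h0 := hV_nonneg (ν := ν) (β := β) (alpha_pos hβ) (hx.trans ht)
  rw [norm_mul, Real.norm_of_nonneg h0, mul_comm]
  exact mul_le_mul_of_nonneg_right (hφ t) h0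

lemma FF_bound (hν : -(1/2) < ν) (hβ : |β| < α) (hφ : ∀ t, |φ t| ≤ H)
    {x : ℝ} (hx : 0 < x) : |FF ν α β φ x| ≤ H * tn 0 ν α β x := by
  have h1 := UU_bound hν hβ hφ hx.le
  have h2 := VV_bound hν hβ hφ hx
  have hw := uv_wronskian (β := β) hν (alpha_pos hβ) hx
  have hu := uu_pos (ν := ν) (β := β) (alpha_pos hβ) hx
  have hv := vv_pos (α := α) (β := β) (x := x) hν
  unfold FF
  refine (abs_add_le _ _).trans ?_
  rw [abs_mul, abs_mul, abs_of_pos hu, abs_of_pos hv]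
  refine (add_le_add (mul_le_mul_of_nonneg_left h1 hu.le)
    (mul_le_mul_of_nonneg_left h2 hv.le)).trans (le_of_eq ?_)
  linear_combination (H * tn 0 ν α β x) * hw

lemma UU_split (hν : -(1/2) < ν) (hβ : |β| < α) (hφm : Measurable φ) (hφ : ∀ t, |φ t| ≤ H)
    {x y : ℝ} (hx : 0 < x) (hy : 0 < y) :
    IntervalIntegrable (fun t => hU ν α β t * φ t) volume x y ∧
    UU ν α β φ y = UU ν α β φ x + ∫ t in x..y, hU ν α β t * φ t := by
  have h1 := hUφ_int hν hβ hφm hφ hx.le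
  have h2 := hUφ_int hν hβ hφm hφ hy.le
  have h3 := h1.symm.trans h2
  refine ⟨h3, ?_⟩
  unfold UU
  rw [intervalIntegral.integral_add_adjacent_intervals h1 h3]

lemma VV_split (hν : -(1/2) < ν) (hβ : |β| < α) (hφm : Measurable φ) (hφ : ∀ t, |φ t| ≤ H)
    {x y : ℝ} (hx : 0 < x) (hy : 0 < y) :
    IntervalIntegrable (fun t => hV ν α β t * φ t) volume x y ∧
    VV ν α β φ y = VV ν α β φ x - ∫ t in x..y, hV ν α β t * φ t := by
  have hh := hVφ_int hν hβ hφm hφ (lt_min hx hy)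
  have h1 := hVφ_int hν hβ hφm hφ hx
  have h2 := hVφ_int hν hβ hφm hφ hy
  refine ⟨?_, ?_⟩
  · rw [intervalIntegrable_iff]
    refine hh.mono_set ?_
    intro t ht
    exact ht.1
  · unfold VV
    rw [← intervalIntegral.integral_Ioi_sub_Ioi' h1 h2]; ring

lemma slope_core (hν : -(1/2) < ν) (hβ : |β| < α) (hφm : Measurable φ) (hφ : ∀ t, |φ t| ≤ H)
    {x : ℝ} (hx : 0 < x) {a b : ℝ → ℝ} {a' b' : ℝ} (ha : HasDerivAt a a' x)
    (hb : HasDerivAt b b' x) : 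
    ∀ ε > 0, ∀ᶠ y in 𝓝 x, |(a y * UU ν α β φ y + b y * VV ν α β φ y) -
      (a x * UU ν α β φ x + b x * VV ν α β φ x)
      - (a' * UU ν α β φ x + b' * VV ν α β φ x) * (y - x)| ≤
      (|a x * hU ν α β x - b x * hV ν α β x| * H + ε) * |y - x| := by
  have hpos : ∀ᶠ y in 𝓝 x, 0 < y := lt_mem_nhds hx
  refine slope_lemma ha hb (hU_contAt hν hx) (hV_contAt hν (alpha_pos hβ) hx) hφ ?_ ?_ ?_ ?_
  · filter_upwards [hpos] with y hy using (UU_split hν hβ hφm hφ hx hy).1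
  · filter_upwards [hpos] with y hy using (VV_split hν hβ hφm hφ hx hy).1
  · filter_upwards [hpos] with y hy using (UU_split hν hβ hφm hφ hx hy).2
  · filter_upwards [hpos] with y hy using (VV_split hν hβ hφm hφ hx hy).2

lemma FF_hasDerivAt (hν : -(1/2) < ν) (hβ : |β| < α) (hφm : Measurable φ) (hφ : ∀ t, |φ t| ≤ H)
    {x : ℝ} (hx : 0 < x) : HasDerivAt (FF ν α β φ) (dF ν α β φ x) x := by
  have h := slope_core hν hβ hφm hφ hx (uu_hasDerivAt (ν := ν) (β := β) (alpha_pos hβ) hx)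
    (vv_hasDerivAt (ν := ν) (α := α) (β := β) (x := x) hν)
  refine hasDerivAt_of_slope fun ε hε => ?_
  have e : uu ν α β x * hU ν α β x - vv ν α β x * hV ν α β x = 0 := by unfold hU hV; ring
  have := h ε hε
  rw [e, abs_zero, zero_mul] at this
  exact this

lemma dF_deriv_bound (hν : -(1/2) < ν) (hβ : |β| < α) (hφm : Measurable φ) (hφ : ∀ t, |φ t| ≤ H)
    {x d : ℝ} (hx : 0 < x) (hd : HasDerivAt (dF ν α β φ) d x) :
    |x * d| ≤ H + |2 * ν + 1 + 2 * β * x| * |dF ν α β φ x| +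
      |(2 * ν + 1) * β - (α ^ 2 - β ^ 2) * x| * |FF ν α β φ x| := by
  have h := slope_core hν hβ hφm hφ hx (du_hasDerivAt (ν := ν) (β := β) (alpha_pos hβ) hx)
    (dv_hasDerivAt (ν := ν) (α := α) (β := β) (x := x) hν hx)
  have h2 := deriv_of_slope hd h
  have hw := uv_wronskian (β := β) hν (alpha_pos hβ) hx
  have e : du ν α β x * hU ν α β x - dv ν α β x * hV ν α β x = -(1 / x) := by
    unfold hU hV; field_simp; linear_combination -hw
  rw [e, abs_neg, abs_of_pos (one_div_pos.2 hx)] at h2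
  set r := 2 * ν + 1 + 2 * β * x
  set s := (2 * ν + 1) * β - (α ^ 2 - β ^ 2) * x
  have e2 : x * d = x * (d - ((-r * du ν α β x - s * uu ν α β x) / x * UU ν α β φ x +
      (-r * dv ν α β x - s * vv ν α β x) / x * VV ν α β φ x)) +
      (-(r * dF ν α β φ x) + -(s * FF ν α β φ x)) := by
    unfold dF FF; field_simp; ring
  rw [e2, add_assoc]
  refine (abs_add_le _ _).trans (add_le_add ?_ ((abs_add_le _ _).trans (le_of_eq ?_)))
  · rw [abs_mul, abs_of_pos hx]
    calc _ ≤ x * (1 / x * H) := by gcongr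
      _ = H := by field_simp
  · rw [abs_neg, abs_neg, abs_mul, abs_mul]

/-- slope bound for `Φ = m F'`. -/
lemma Phi_slope (hν : -(1/2) < ν) (hβ : |β| < α) (hφm : Measurable φ) (hφ : ∀ t, |φ t| ≤ H)
    {x : ℝ} (hx : 0 < x) : ∀ ε > 0, ∀ᶠ y in 𝓝 x,
      |mm ν β y * dF ν α β φ y - mm ν β x * dF ν α β φ x| ≤
      (mm ν β x / x * (1 + |(2 * ν + 1) * β - (α ^ 2 - β ^ 2) * x| * tn 0 ν α β x) * H + ε)
        * |y - x| := by
  intro ε hε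
  have h := slope_core hν hβ hφm hφ hx
    ((mm_hasDerivAt (ν := ν) (β := β) hx).mul (du_hasDerivAt (ν := ν) (β := β) (alpha_pos hβ) hx))
    ((mm_hasDerivAt (ν := ν) (β := β) hx).mul
      (dv_hasDerivAt (ν := ν) (α := α) (β := β) (x := x) hν hx)) ε hε
  have hw := uv_wronskian (β := β) hν (alpha_pos hβ) hx
  have hF := FF_bound hν hβ hφ hx
  have hm := mm_pos (ν := ν) (β := β) hx
  have e : (mm ν β * du ν α β) x * hU ν α β x - (mm ν β * dv ν α β) x * hV ν α β x
      = -(mm ν β x / x) := by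
    simp only [Pi.mul_apply]
    unfold hU hV; field_simp; linear_combination -hw
  rw [e, abs_neg, abs_of_pos (by positivity)] at h
  simp only [Pi.mul_apply] at h
  set s := (2 * ν + 1) * β - (α ^ 2 - β ^ 2) * x
  filter_upwards [h] with y hy
  set m := mm ν β x
  set X := mm ν β y * dF ν α β φ y - m * dF ν α β φ x with hX
  have h3 : |X - (-(m / x * s * FF ν α β φ x)) * (y - x)| ≤ (m / x * H + ε) * |y - x| := by
    refine le_trans (le_of_eq ?_) hy
    congr 1
    rw [hX]
    unfold dF FF; field_simp; ring
  have h4 : |(-(m / x * s * FF ν α β φ x)) * (y - x)| ≤ (m / x * |s| * (H * tn 0 ν α β x)) * |y - x| := by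
    rw [abs_mul, abs_neg, abs_mul, abs_mul, abs_of_pos (by positivity : 0 < m / x)]
    gcongr
  have h5 := abs_add_le (X - (-(m / x * s * FF ν α β φ x)) * (y - x)) ((-(m / x * s * FF ν α β φ x)) * (y - x))
  rw [sub_add_cancel] at h5
  calc |X| ≤ _ := h5
    _ ≤ _ := add_le_add h3 h4
    _ = _ := by ring

lemma Phi_contAt (hν : -(1/2) < ν) (hβ : |β| < α) (hφm : Measurable φ) (hφ : ∀ t, |φ t| ≤ H)
    {x : ℝ} (hx : 0 < x) : ContinuousAt (fun y => mm ν β y * dF ν α β φ y) x := by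
  set K := mm ν β x / x * (1 + |(2 * ν + 1) * β - (α ^ 2 - β ^ 2) * x| * tn 0 ν α β x) * H + 1
  rw [ContinuousAt, tendsto_iff_dist_tendsto_zero]
  have h := Phi_slope hν hβ hφm hφ hx 1 one_pos
  have h0 : Tendsto (fun y => K * |y - x|) (𝓝 x) (𝓝 0) := by
    have : Continuous fun y => K * |y - x| := by fun_prop
    simpa using this.tendsto x
  refine squeeze_zero' (Eventually.of_forall fun _ => dist_nonneg) ?_ h0
  filter_upwards [h] with y hy
  rw [Real.dist_eq]; exact hy

lemma Phi_zero (hν : -(1/2) < ν) (hβ : |β| < α) (hφ : ∀ t, |φ t| ≤ H) :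
    Tendsto (fun y => mm ν β y * dF ν α β φ y) (𝓝[>] 0) (𝓝 0) := by
  have hα := alpha_pos hβ
  have hH : 0 ≤ H := (abs_nonneg _).trans (hφ 0)
  obtain ⟨C, hC, hb⟩ := mu_bdd (β := β) hν hα
  have hI : ∀ᶠ y in 𝓝[>] (0:ℝ), 0 < y ∧ y ≤ 1 := by
    filter_upwards [Ioo_mem_nhdsGT (zero_lt_one' ℝ)] with y hy using ⟨hy.1, hy.2.le⟩
  have tU : Tendsto (UU ν α β φ) (𝓝[>] 0) (𝓝 0) := by
    have hc : Continuous (fun x => H * (mm ν β x *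
        (dv ν α β x * tn 0 ν α β x + vv ν α β x * tn 1 ν α β x))) :=
      continuous_const.mul ((mm_continuous hν).mul (((dv_continuous hν).mul (tn_continuous hν hβ 0)).add
      ((vv_continuous hν).mul (tn_continuous hν hβ 1))))
    have := (hc.tendsto 0).mono_left (nhdsWithin_le_nhds (s := Ioi 0))
    rw [mm_zero hν, zero_mul, mul_zero] at this
    refine squeeze_zero_norm' ?_ this
    filter_upwards [self_mem_nhdsWithin] with y hy
    exact UU_bound hν hβ hφ (le_of_lt hy)
  have t1 : Tendsto (fun y => (mm ν β y * dv ν α β y)) (𝓝[>] 0) (𝓝 0) := by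
    have := (((mm_continuous (β := β) hν).mul (dv_continuous (α := α) (β := β) hν)).tendsto 0).mono_left
      (nhdsWithin_le_nhds (s := Ioi 0))
    rw [Pi.mul_apply, mm_zero hν, zero_mul] at this
    exact this
  have b1 : IsBoundedUnder (· ≤ ·) (𝓝[>] (0:ℝ)) (fun y => ‖mm ν β y * du ν α β y‖) := by
    refine ⟨C, ?_⟩
    rw [eventually_map]
    filter_upwards [hI] with y hy using (hb y hy.1 hy.2).2
  have b2 : IsBoundedUnder (· ≤ ·) (𝓝[>] (0:ℝ)) (fun y => ‖VV ν α β φ y‖) := by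
    refine ⟨H * (C * tn 0 ν α β 0 + C * tn 1 ν α β 0), ?_⟩
    rw [eventually_map]
    filter_upwards [hI] with y hy
    refine (VV_bound hν hβ hφ hy.1).trans (mul_le_mul_of_nonneg_left ?_ hH)
    refine (le_abs_self _).trans ?_
    rw [abs_neg, mul_add]
    refine (abs_add_le _ _).trans ?_
    rw [← mul_assoc, ← mul_assoc, abs_mul _ (tn 0 ν α β y), abs_mul _ (tn 1 ν α β y),
      abs_of_nonneg (tn_nonneg hβ 0 y), abs_of_nonneg (tn_nonneg hβ 1 y)]
    exact add_le_add (mul_le_mul (hb y hy.1 hy.2).2 (tn_le hν hβ 0 hy.1.le) (tn_nonneg hβ 0 y) hC.le)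
      (mul_le_mul (hb y hy.1 hy.2).1 (tn_le hν hβ 1 hy.1.le) (tn_nonneg hβ 1 y) hC.le)
  have := (tU.zero_mul_isBoundedUnder_le b1).add (t1.zero_mul_isBoundedUnder_le b2)
  rw [add_zero] at this
  refine this.congr fun y => ?_
  unfold dF; ring

/-- Forward barrier. -/
lemma Phi_forward (hν : -(1/2) < ν) (hβ : |β| < α) (hφm : Measurable φ) (hφ : ∀ t, |φ t| ≤ H)
    {x : ℝ} (hx : 0 < x) {b b' : ℝ → ℝ} (hb : ∀ y, 0 < y → y ≤ x → HasDerivAt b (b' y) y)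
    (hb0 : ∀ y, 0 < y → y ≤ x → 0 ≤ b y)
    (hN : ∀ y, 0 < y → y ≤ x →
      1 + |(2 * ν + 1) * β - (α ^ 2 - β ^ 2) * y| * tn 0 ν α β y ≤
        y * b' y + (2 * ν + 1 + 2 * β * y) * b y) :
    |dF ν α β φ x| ≤ H * b x := by
  have hH : 0 ≤ H := (abs_nonneg _).trans (hφ 0)
  have hm := mm_pos (ν := ν) (β := β) hx
  have key : ∀ a, 0 < a → a ≤ x → |mm ν β x * dF ν α β φ x| ≤
      H * (mm ν β x * b x) + |mm ν β a * dF ν α β φ a| := by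
    intro a ha hax
    refine barrier (Φ := fun y => mm ν β y * dF ν α β φ y) (Ψ := fun y => H * (mm ν β y * b y))
      (Ψ' := fun y => H * (mm ν β y * (2 * ν + 1 + 2 * β * y) / y * b y + mm ν β y * b' y))
      hax (fun y hy => (Phi_contAt hν hβ hφm hφ (ha.trans_le hy.1)).continuousWithinAt)
      (fun y hy => Phi_slope hν hβ hφm hφ (ha.trans_le hy.1))
      (fun y hy => ?_) (fun y hy => ?_) ?_
    · exact ((mm_hasDerivAt (ha.trans_le hy.1)).mul (hb y (ha.trans_le hy.1) hy.2)).const_mul H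
    · have hy0 := ha.trans_le hy.1
      have := hN y hy0 hy.2
      have hmy := mm_pos (ν := ν) (β := β) hy0
      calc _ ≤ mm ν β y / y * (y * b' y + (2 * ν + 1 + 2 * β * y) * b y) * H := by gcongr
        _ = _ := by field_simp; ring
    · have := hb0 a ha hax
      have := mm_pos (ν := ν) (β := β) ha
      positivity
  have hlim := (Phi_zero (φ := φ) hν hβ hφ).abs.const_add (H * (mm ν β x * b x))
  rw [abs_zero, add_zero] at hlim
  have := ge_of_tendsto hlim (b := |mm ν β x * dF ν α β φ x|) (by
    filter_upwards [Ioo_mem_nhdsGT hx] with a ha using key a ha.1 ha.2.le)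
  rw [abs_mul, abs_of_pos hm] at this
  have h2 : mm ν β x * |dF ν α β φ x| ≤ mm ν β x * (H * b x) := by linarith
  exact le_of_mul_le_mul_left h2 hm

/-- Backward barrier. -/
lemma Phi_backward (hν : -(1/2) < ν) (hβ : |β| < α) (hβ0 : β < 0)
    (hφm : Measurable φ) (hφ : ∀ t, |φ t| ≤ H)
    {x : ℝ} (hx : 0 < x) {b b' : ℝ → ℝ} (hb : ∀ y, x ≤ y → HasDerivAt b (b' y) y)
    (hb0 : ∀ y, x ≤ y → 0 ≤ b y)
    (hN : ∀ y, x ≤ y →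
      y * b' y + (2 * ν + 1 + 2 * β * y) * b y ≤
      - (1 + |(2 * ν + 1) * β - (α ^ 2 - β ^ 2) * y| * tn 0 ν α β y)) :
    |dF ν α β φ x| ≤ H * b x := by
  have hH : 0 ≤ H := (abs_nonneg _).trans (hφ 0)
  have hm := mm_pos (ν := ν) (β := β) hx
  have key : ∀ a, x ≤ a → |mm ν β x * dF ν α β φ x| ≤
      H * (mm ν β x * b x) + |mm ν β a * dF ν α β φ a| := by
    intro a hax
    refine barrier_back (Φ := fun y => mm ν β y * dF ν α β φ y) (Ψ := fun y => H * (mm ν β y * b y))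
      (Ψ' := fun y => H * (mm ν β y * (2 * ν + 1 + 2 * β * y) / y * b y + mm ν β y * b' y))
      hax (fun y hy => (Phi_contAt hν hβ hφm hφ (hx.trans_le hy.1)).continuousWithinAt)
      (fun y hy => Phi_slope hν hβ hφm hφ (hx.trans_le hy.1))
      (fun y hy => ?_) (fun y hy => ?_) ?_
    · exact ((mm_hasDerivAt (hx.trans_le hy.1)).mul (hb y hy.1)).const_mul H
    · have hy0 := hx.trans_le hy.1
      have := hN y hy.1
      have hmy := mm_pos (ν := ν) (β := β) hy0
      have h3 : mm ν β y / y * (y * b' y + (2 * ν + 1 + 2 * β * y) * b y) * H ≤ mm ν β y / y * 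
         (- (1 + |(2 * ν + 1) * β - (α ^ 2 - β ^ 2) * y| * tn 0 ν α β y)) * H := by gcongr
      refine le_trans (le_of_eq ?_) (h3.trans (le_of_eq (by ring)))
      field_simp; ring
    · have := hb0 a hax
      have := mm_pos (ν := ν) (β := β) (hx.trans_le hax)
      positivity
  -- small values at infinity
  have hmt : Tendsto (mm ν β) atTop (𝓝 0) := by
    have h := tendsto_rpow_mul_exp_neg_mul_atTop_nhds_zero (2 * ν + 1) (-(2 * β)) (by linarith)
    refine h.congr fun y => ?_
    unfold mm; congr 2; ring
  set S := H * tn 0 ν α β 0 with hS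
  have hfin : |mm ν β x * dF ν α β φ x| ≤ H * (mm ν β x * b x) := by
    refine le_of_forall_pos_le_add fun ε hε => ?_
    have hS0 : 0 ≤ S := mul_nonneg hH (tn_nonneg hβ 0 0)
    have ev : ∀ᶠ y in atTop, mm ν β y * (2 * S + 1) < ε := by
      have := hmt.mul_const (2 * S + 1)
      rw [zero_mul] at this
      exact this.eventually (gt_mem_nhds hε)
    obtain ⟨X, hX⟩ := (ev.and (eventually_ge_atTop x)).exists_forall_of_atTop
    set Y := max X x
    have hY0 : 0 < Y := hx.trans_le (le_max_right _ _)
    obtain ⟨y, hy, hyd⟩ := exists_hasDerivAt_eq_slope (FF ν α β φ) (dF ν α β φ) (lt_add_one Y)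
      (fun t ht => (FF_hasDerivAt hν hβ hφm hφ (hY0.trans_le ht.1)).continuousAt.continuousWithinAt)
      (fun t ht => FF_hasDerivAt hν hβ hφm hφ (hY0.trans ht.1))
    have hFb : ∀ t, 0 < t → |FF ν α β φ t| ≤ S := fun t ht =>
      (FF_bound hν hβ hφ ht).trans (mul_le_mul_of_nonneg_left (tn_le hν hβ 0 ht.le) hH)
    have hd : |dF ν α β φ y| ≤ 2 * S + 1 := by
      rw [hyd, add_sub_cancel_left, div_one]
      refine (abs_sub _ _).trans ?_
      have := hFb (Y + 1) (by linarith)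
      have := hFb Y hY0
      linarith
    have hyY : Y ≤ y := hy.1.le
    have h1 := hX y ((le_max_left _ _).trans hyY)
    have hmy := mm_pos (ν := ν) (β := β) (hY0.trans_le hyY)
    refine (key y h1.2).trans ?_
    rw [abs_mul (mm ν β y), abs_of_pos hmy]
    have := mul_le_mul_of_nonneg_left hd hmy.le
    linarith [h1.1]
  rw [abs_mul, abs_of_pos hm] at hfin
  have h2 : mm ν β x * |dF ν α β φ x| ≤ mm ν β x * (H * b x) := by linarith
  exact le_of_mul_le_mul_left h2 hm

end Core2

section Bounds
open Set Topology

variable {ν α β H : ℝ} {φ : ℝ → ℝ}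

lemma combine (hν : -(1/2) < ν) (hβ : |β| < α) (hφm : Measurable φ) (hφ : ∀ t, |φ t| ≤ H)
    {x d N B : ℝ} (hx : 0 < x) (hd : HasDerivAt (dF ν α β φ) d x)
    (hN : 1 + |(2 * ν + 1) * β - (α ^ 2 - β ^ 2) * x| * tn 0 ν α β x ≤ N)
    (hB : |2 * ν + 1 + 2 * β * x| * |dF ν α β φ x| ≤ H * B) : |x * d| ≤ H * (N + B) := by
  have hH : 0 ≤ H := (abs_nonneg _).trans (hφ 0)
  have h1 := dF_deriv_bound hν hβ hφm hφ hx hd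
  have h2 := FF_bound hν hβ hφ hx
  have h3 := mul_le_mul_of_nonneg_left h2 (abs_nonneg ((2 * ν + 1) * β - (α ^ 2 - β ^ 2) * x))
  have h4 := mul_le_mul_of_nonneg_left hN hH
  linarith

lemma lin_hasDerivAt (r c y : ℝ) : HasDerivAt (fun y => r + c * y) c y := by
  refine (((hasDerivAt_id y).const_mul c).const_add r).congr_deriv ?_
  simp

/-- β ≤ 0 -/
lemma core_neg (hν : -(1/2) < ν) (hβ : |β| < α) (hφm : Measurable φ) (hφ : ∀ t, |φ t| ≤ H)
    {x d N : ℝ} (hx : 0 < x) (hd : HasDerivAt (dF ν α β φ) d x) (hβ0 : β ≤ 0)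
    (hN : ∀ y, 0 < y → 1 + |(2 * ν + 1) * β - (α ^ 2 - β ^ 2) * y| * tn 0 ν α β y ≤ N) :
    |x * d| ≤ H * (2 * N) := by
  have hH : 0 ≤ H := (abs_nonneg _).trans (hφ 0)
  have hN0 : 0 ≤ N := by
    refine le_trans ?_ (hN x hx)
    have := tn_nonneg (ν := ν) hβ 0 x
    positivity
  rw [two_mul]
  refine combine hν hβ hφm hφ hx hd (hN x hx) ?_
  rcases lt_trichotomy (2 * ν + 1 + 2 * β * x) 0 with h | h | h
  · have hβn : β < 0 := by
      rcases hβ0.lt_or_eq with h1 | h1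
      · exact h1
      · rw [h1] at h; linarith
    have hneg : ∀ y, x ≤ y → 2 * ν + 1 + 2 * β * y < 0 := fun y hy => by nlinarith
    have := Phi_backward hν hβ hβn hφm hφ hx (b := fun y => N * (-(2 * ν + 1 + 2 * β * y)⁻¹))
      (b' := fun y => N * (-(-(2 * β) / (2 * ν + 1 + 2 * β * y) ^ 2)))
      (fun y hy => ((lin_hasDerivAt (2 * ν + 1) (2 * β) y).inv (hneg y hy).ne).neg.const_mul N)
      (fun y hy => mul_nonneg hN0 (neg_nonneg.2 (inv_nonpos.2 (hneg y hy).le)))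
      (fun y hy => ?_)
    · have h3 := mul_le_mul_of_nonneg_left this (abs_nonneg (2 * ν + 1 + 2 * β * x))
      refine h3.trans (le_of_eq ?_)
      have h' : 2 * ν + 1 + 2 * β * x ≠ 0 := h.ne
      rw [abs_of_neg h]; field_simp
    · have h5 := hneg y hy
      have hy0 := hx.trans_le hy
      have h6 := hN y hy0
      have e : (2 * ν + 1 + 2 * β * y) * (N * (-(2 * ν + 1 + 2 * β * y)⁻¹)) = -N := by
        have := h5.ne; field_simp
      have h7 : y * (N * (-(-(2 * β) / (2 * ν + 1 + 2 * β * y) ^ 2))) ≤ 0 := by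
        have : 0 ≤ -(2 * β) / (2 * ν + 1 + 2 * β * y) ^ 2 := by
          apply div_nonneg <;> nlinarith
        have := mul_nonneg (mul_nonneg hy0.le hN0) this
        linarith
      linarith
  · rw [h, abs_zero, zero_mul]; positivity
  · have hpos : ∀ y, y ≤ x → 0 < 2 * ν + 1 + 2 * β * y := fun y hy => by nlinarith
    have := Phi_forward hν hβ hφm hφ hx (b := fun y => N * (2 * ν + 1 + 2 * β * y)⁻¹)
      (b' := fun y => N * (-(2 * β) / (2 * ν + 1 + 2 * β * y) ^ 2))
      (fun y _ hy => ((lin_hasDerivAt (2 * ν + 1) (2 * β) y).inv (hpos y hy).ne').const_mul N)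
      (fun y _ hy => mul_nonneg hN0 (inv_nonneg.2 (hpos y hy).le))
      (fun y hy0 hy => ?_)
    · have h3 := mul_le_mul_of_nonneg_left this (abs_nonneg (2 * ν + 1 + 2 * β * x))
      refine h3.trans (le_of_eq ?_)
      rw [abs_of_pos h]; field_simp
    · have h5 := hpos y hy
      have h6 := hN y hy0
      have e : (2 * ν + 1 + 2 * β * y) * (N * (2 * ν + 1 + 2 * β * y)⁻¹) = N := by
        have := h5.ne'; field_simp
      have h7 : 0 ≤ y * (N * (-(2 * β) / (2 * ν + 1 + 2 * β * y) ^ 2)) := by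
        have : 0 ≤ -(2 * β) / (2 * ν + 1 + 2 * β * y) ^ 2 := by
          apply div_nonneg <;> nlinarith
        positivity
      linarith

/-- β > 0, r ≥ 2 -/
lemma core_pos_ge (hν : 1/2 ≤ ν) (hβ : |β| < α) (hφm : Measurable φ) (hφ : ∀ t, |φ t| ≤ H)
    {x d N : ℝ} (hx : 0 < x) (hd : HasDerivAt (dF ν α β φ) d x) (hβ0 : 0 < β)
    (hN : ∀ y, 0 < y → 1 + |(2 * ν + 1) * β - (α ^ 2 - β ^ 2) * y| * tn 0 ν α β y ≤ N) :
    |x * d| ≤ H * (9/4 * N) := by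
  have hν' : -(1/2) < ν := by linarith
  have hH : 0 ≤ H := (abs_nonneg _).trans (hφ 0)
  have hN0 : 0 ≤ N := by
    refine le_trans ?_ (hN x hx)
    have := tn_nonneg (ν := ν) hβ 0 x
    positivity
  have h := combine hν' hβ hφm hφ hx hd (hN x hx) (B := 5/4 * N) ?_
  · refine h.trans (le_of_eq ?_); ring
  · have hpos : ∀ y, 0 < y → 0 < 2 * ν + 1 + 2 * β * y := fun y hy => by nlinarith
    have := Phi_forward hν' hβ hφm hφ hx (b := fun y => (5/4 * N) * (2 * ν + 1 + 2 * β * y)⁻¹)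
      (b' := fun y => (5/4 * N) * (-(2 * β) / (2 * ν + 1 + 2 * β * y) ^ 2))
      (fun y hy _ => ((lin_hasDerivAt (2 * ν + 1) (2 * β) y).inv (hpos y hy).ne').const_mul _)
      (fun y hy _ => mul_nonneg (by positivity) (inv_nonneg.2 (hpos y hy).le))
      (fun y hy0 hy => ?_)
    · have h3 := mul_le_mul_of_nonneg_left this (abs_nonneg (2 * ν + 1 + 2 * β * x))
      refine h3.trans (le_of_eq ?_)
      have := hpos x hx
      rw [abs_of_pos this]; field_simp
    · have h5 := hpos y hy0
      have h6 := hN y hy0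
      have e : y * ((5/4 * N) * (-(2 * β) / (2 * ν + 1 + 2 * β * y) ^ 2)) +
        (2 * ν + 1 + 2 * β * y) * ((5/4 * N) * (2 * ν + 1 + 2 * β * y)⁻¹) =
        5/4 * N * (1 - 2 * β * y / (2 * ν + 1 + 2 * β * y) ^ 2) := by
        have := h5.ne'; field_simp; ring
      rw [e]
      have h8 : 2 * β * y / (2 * ν + 1 + 2 * β * y) ^ 2 ≤ 1/8 := by
        rw [div_le_iff₀ (by positivity)]
        have : 0 < β * y := by positivity
        nlinarith [sq_nonneg (2 * ν + 1 - 2 * β * y)]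
      nlinarith

lemma mul_exp_neg_le_one (t : ℝ) : t * exp (-t) ≤ 1 := by
  have := Real.add_one_le_exp t
  rw [Real.exp_neg]
  rw [← div_eq_mul_inv, div_le_one (Real.exp_pos _)]
  linarith

/-- β > 0, r < 2 -/
lemma core_pos_lt (hν : -(1/2) < ν) (hν' : ν < 1/2) (hβ : |β| < α) (hφm : Measurable φ)
    (hφ : ∀ t, |φ t| ≤ H)
    {x d N c1 : ℝ} (hx : 0 < x) (hd : HasDerivAt (dF ν α β φ) d x) (hβ0 : 0 < β)
    (hc1 : 2 * β ≤ c1) (hN5 : 5 ≤ N)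
    (hN : ∀ y, 0 < y → 1 + |(2 * ν + 1) * β - (α ^ 2 - β ^ 2) * y| * tn 0 ν α β y ≤
      N + 2 / (2 * ν + 1) * (c1 * y * exp (-(c1 * y)))) :
    |x * d| ≤ H * (N * (3 + 6 / (2 * ν + 1))) := by
  have hH : 0 ≤ H := (abs_nonneg _).trans (hφ 0)
  set r := 2 * ν + 1 with hr
  have hr0 : 0 < r := by linarith
  have hr2 : r < 2 := by linarith
  have hc0 : 0 < c1 := by linarith
  have hp1 : ∀ y, 0 < y → 0 < 1 + 2 * β * y := fun y hy => by positivity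
  have hE : ∀ y, 0 < y → exp (-(c1 / 2 * y)) ≤ 1 := fun y hy =>
    Real.exp_le_one_iff.2 (by have : 0 < c1 / 2 * y := by positivity
                              linarith)
  have key := Phi_forward hν hβ hφm hφ hx
    (b := fun y => (2 * N / r + 8 / r * (1 - exp (-(c1 / 2 * y)))) * (1 + 2 * β * y)⁻¹)
    (b' := fun y => (8 / r * (-(-(c1 / 2) * exp (-(c1 / 2 * y))))) * (1 + 2 * β * y)⁻¹ +
      (2 * N / r + 8 / r * (1 - exp (-(c1 / 2 * y)))) * (-(2 * β) / (1 + 2 * β * y) ^ 2))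
    (fun y hy _ => ((((exp_hasDerivAt (c1 / 2) y).const_sub 1).const_mul (8 / r)).const_add
      (2 * N / r)).mul ((lin_hasDerivAt 1 (2 * β) y).inv (hp1 y hy).ne'))
    (fun y hy _ => by
      have := hp1 y hy
      have h1 : 0 ≤ 1 - exp (-(c1 / 2 * y)) := by linarith [hE y hy]
      positivity)
    (fun y hy _ => ?_)
  · have hs := hp1 x hx
    have hNx : 1 + |r * β - (α ^ 2 - β ^ 2) * x| * tn 0 ν α β x ≤ N + 2 / r := by
      refine (hN x hx).trans ?_
      have := mul_le_mul_of_nonneg_left (mul_exp_neg_le_one (c1 * x)) (by positivity : 0 ≤ 2 / r)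
      linarith
    have hrx : 0 < r + 2 * β * x := by positivity
    have hE0 := Real.exp_pos (-(c1 / 2 * x))
    set E := exp (-(c1 / 2 * x))
    have hBB : (r + 2 * β * x) * ((2 * N / r + 8 / r * (1 - E)) * (1 + 2 * β * x)⁻¹) ≤
        (2 * N + 8) * (1 + 1 / r) - (2 * N + 8) * min 1 (1 / r) := by
      have f1 : (r + 2 * β * x) / (1 + 2 * β * x) ≤ max r 1 := by
        rw [div_le_iff₀ hs]
        have h1 := le_max_left r 1
        have h2 := le_max_right r 1
        have h3 : 0 < 2 * β * x := by positivity
        nlinarith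
      have f2 : 2 * N / r + 8 / r * (1 - E) ≤ (2 * N + 8) / r := by
        rw [add_div]
        have : 8 / r * (1 - E) ≤ 8 / r * 1 := by gcongr; linarith
        linarith
      calc _ = (2 * N / r + 8 / r * (1 - E)) * ((r + 2 * β * x) / (1 + 2 * β * x)) := by
            rw [div_eq_mul_inv (r + 2 * β * x)]; ring
        _ ≤ (2 * N + 8) / r * max r 1 := by
            gcongr
        _ = _ := by
          rcases le_total r 1 with h | h
          · have : 1 ≤ 1 / r := by rw [le_div_iff₀ hr0]; linarith
            rw [max_eq_right h, min_eq_left this]; ring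
          · have : 1 / r ≤ 1 := by rw [div_le_iff₀ hr0]; linarith
            rw [max_eq_left h, min_eq_right this]; field_simp; ring
    have := combine hν hβ hφm hφ hx hd hNx
      (B := (r + 2 * β * x) * ((2 * N / r + 8 / r * (1 - E)) * (1 + 2 * β * x)⁻¹)) (by
        have h3 := mul_le_mul_of_nonneg_left key (abs_nonneg (r + 2 * β * x))
        refine h3.trans (le_of_eq ?_)
        rw [abs_of_pos hrx]; ring)
    refine this.trans (mul_le_mul_of_nonneg_left ?_ hH)
    refine (add_le_add_right hBB _).trans ?_
    set w := 1 / r with hw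
    have e1 : 2 / r = 2 * w := by rw [hw]; ring
    have e2 : 6 / r = 6 * w := by rw [hw]; ring
    have hw2 : 1 / 2 < w := by rw [hw, div_lt_div_iff₀ (by norm_num) hr0]; linarith
    rw [e1, e2]
    rcases le_total 1 w with h | h
    · rw [min_eq_left h]; nlinarith
    · rw [min_eq_right h]; nlinarith
  · have hs := hp1 y hy
    refine (hN y hy).trans ?_
    have hE1 := hE y hy
    have hE0 := Real.exp_pos (-(c1 / 2 * y))
    have hEE : exp (-(c1 * y)) = exp (-(c1 / 2 * y)) * exp (-(c1 / 2 * y)) := by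
      rw [← Real.exp_add]; congr 1; ring
    have hE2 : (1 + c1 * y) * exp (-(c1 / 2 * y)) ≤ 2 := by
      have := Real.add_one_le_exp (c1 / 2 * y)
      rw [Real.exp_neg, ← div_eq_mul_inv, div_le_iff₀ (Real.exp_pos _)]
      linarith
    rw [hEE]
    set E := exp (-(c1 / 2 * y))
    set Y := 2 * β * y with hY
    have hY0 : 0 < Y := by positivity
    have hYt : Y ≤ c1 * y := by rw [hY]; gcongr
    set τ := c1 * y with hτ
    have hτ0 : 0 < τ := by positivity
    set S := 2 * N / r + 8 / r * (1 - E) with hS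
    have hS0 : 2 * N / r ≤ S := by
      have : 0 ≤ 8 / r * (1 - E) := mul_nonneg (by positivity) (by linarith)
      linarith
    have hSp : 0 < S := lt_of_lt_of_le (by positivity) hS0
    have e : y * (8 / r * (-(-(c1 / 2) * E)) * (1 + Y)⁻¹ + S * (-(2 * β) / (1 + Y) ^ 2)) +
        (r + Y) * (S * (1 + Y)⁻¹) =
        4 / r * τ * E / (1 + Y) + S * ((r + r * Y + Y ^ 2) / (1 + Y) ^ 2) := by
      have h1 : y * (2 * β) = Y := by rw [hY]; ring
      have h2 : y * c1 = τ := by rw [hτ]; ring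
      have h3 : y * (8 / r * (-(-(c1 / 2) * E)) * (1 + Y)⁻¹ + S * (-(2 * β) / (1 + Y) ^ 2)) =
        4 / r * (y * c1) * E * (1 + Y)⁻¹ - S * ((y * (2 * β)) / (1 + Y) ^ 2) := by ring
      rw [h3, h1, h2]
      clear_value S Y τ
      field_simp
      ring
    rw [e]
    have g1 : r / 2 ≤ (r + r * Y + Y ^ 2) / (1 + Y) ^ 2 := by
      rw [le_div_iff₀ (by positivity)]
      nlinarith [sq_nonneg Y]
    have g2 : N ≤ S * ((r + r * Y + Y ^ 2) / (1 + Y) ^ 2) := by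
      calc N = 2 * N / r * (r / 2) := by field_simp
        _ ≤ _ := by gcongr
    have g3 : 2 / r * (τ * (E * E)) ≤ 4 / r * τ * E / (1 + Y) := by
      rw [le_div_iff₀ hs]
      have h1 : (1 + Y) * E ≤ 2 := le_trans (by gcongr) hE2
      calc 2 / r * (τ * (E * E)) * (1 + Y) = 2 / r * τ * E * ((1 + Y) * E) := by ring
        _ ≤ 2 / r * τ * E * 2 := by gcongr
        _ = _ := by ring
    linarith

lemma abs_sub_mul_le {a b t M : ℝ} (ht : 0 ≤ t) (ha : 0 ≤ a) (hb : 0 ≤ b) (h1 : a * t ≤ M)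
    (h2 : b * t ≤ M) : |a - b| * t ≤ M := by
  rcases le_total a b with h | h
  · rw [abs_of_nonpos (by linarith)]; nlinarith
  · rw [abs_of_nonneg (by linarith)]; nlinarith

lemma tn_of_Ti {k M : ℝ} {x : ℝ} (hβ : |β| < α)
    (h : k * Ti 0 ν α β x ≤ (α ^ 2 - β ^ 2) ^ (ν + 1/2) * M) : k * tn 0 ν α β x ≤ M := by
  unfold tn
  rw [← mul_div_assoc, div_le_iff₀ (G_pos hβ ν)]
  linarith

/-- Result for r < 2. -/
lemma core_lt (hν : -(1/2) < ν) (hν' : ν < 1/2) (hβ : |β| < α) (hφm : Measurable φ)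
    (hφ : ∀ t, |φ t| ≤ H) {x d : ℝ} (hx : 0 < x) (hd : HasDerivAt (dF ν α β φ) d x) :
    |x * d| ≤ H * ((1 + 4 * (α ^ 2 / (α ^ 2 - β ^ 2))) * (3 + 6 / (2 * ν + 1))) := by
  have hH : 0 ≤ H := (abs_nonneg _).trans (hφ 0)
  have hg := gam_pos hβ
  have hρ : 1 ≤ α ^ 2 / (α ^ 2 - β ^ 2) := by
    rw [one_le_div hg]; nlinarith [sq_nonneg β]
  have hr : 0 < 2 * ν + 1 := by linarith
  obtain ⟨c0, cL, cb, cq, cg⟩ := cc_facts hβ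
  rcases le_or_gt β 0 with h | h
  · refine (core_neg hν hβ hφm hφ hx hd h (N := 4 + 4 / (2 * ν + 1)) fun y hy => ?_).trans
      (mul_le_mul_of_nonneg_left ?_ hH)
    · have h1 : (2 * ν + 1) * (-β) * tn 0 ν α β y ≤ 1 :=
        tn_of_Ti hβ (by rw [mul_one]; exact T0_bound_a hν hβ h hy.le)
      have hK : (α ^ 2 - β ^ 2) ≤ 4 * cc α β * (cc α β - β) := by
        rw [cg]; nlinarith
      have h2 := tn_of_Ti hβ (T0_bound_c hν hν' hβ hK hy.le)
      have h3 := mul_le_mul_of_nonneg_left (mul_exp_neg_le_one (cc α β * y))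
        (by positivity : 0 ≤ 4 / (2 * ν + 1))
      have e : |(2 * ν + 1) * β - (α ^ 2 - β ^ 2) * y| =
          (2 * ν + 1) * (-β) + (α ^ 2 - β ^ 2) * y := by
        rw [abs_of_nonpos]
        · ring
        · have : 0 ≤ (2 * ν + 1) * (-β) := mul_nonneg hr.le (by linarith)
          have : 0 ≤ (α ^ 2 - β ^ 2) * y := by positivity
          linarith
      rw [e, add_mul]
      linarith
    · have e1 : 6 / (2 * ν + 1) = 6 * (1 / (2 * ν + 1)) := by ring
      have e2 : 4 / (2 * ν + 1) = 4 * (1 / (2 * ν + 1)) := by ring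
      rw [e1, e2]
      have : 0 < 1 / (2 * ν + 1) := by positivity
      nlinarith
  · have habs : |β| = β := abs_of_pos h
    refine core_pos_lt hν hν' hβ hφm hφ hx hd h (c1 := cc α β) (by linarith) (by linarith)
      fun y hy => ?_
    have hK : (α ^ 2 - β ^ 2) ≤ 2 * cc α β * (cc α β - β) := by
      rw [cg]; nlinarith
    have h1 : (2 * ν + 1) * β * tn 0 ν α β y ≤ 4 * (α ^ 2 / (α ^ 2 - β ^ 2)) :=
      tn_of_Ti hβ (by rw [mul_comm (_ ^ _)]; exact T0_bound_d hν hν' hβ h.le hy.le)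
    have h2 := tn_of_Ti hβ (T0_bound_c hν hν' hβ hK hy.le)
    have h3 : 0 ≤ 2 / (2 * ν + 1) * (cc α β * y * exp (-(cc α β * y))) := by positivity
    rw [add_assoc]
    refine add_le_add_right ?_ 1
    exact abs_sub_mul_le (tn_nonneg hβ 0 y) (by positivity) (by positivity) (by linarith)
      (by linarith)

lemma num1 (h : 2 ≤ 2 * ν + 1) (h4 : 2 * ν + 1 ≤ 4) :
    9/4 * ((2 * ν + 1) * 2) ≤ 5 * √(2 * ν + 1) + 5 * √(2 * ν) := by
  have hs2 : 2.5 * (2 * ν + 1) ≤ 5 * √(2 * ν + 1) := by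
    have : (2 * ν + 1) / 2 ≤ √(2 * ν + 1) := by
      apply Real.le_sqrt_of_sq_le
      nlinarith
    linarith
  have hs3 : 2 * (2 * ν + 1) ≤ 5 * √(2 * ν) := by
    have : 2 * (2 * ν + 1) / 5 ≤ √(2 * ν) := by
      apply Real.le_sqrt_of_sq_le
      nlinarith
    linarith
  linarith

lemma num2 (h4 : 4 < 2 * ν + 1) :
    (2 * ν + 1) * √(π / (ν - 1/2)) ≤ 3.56 * √(2 * ν + 1) := by
  have hπ := Real.pi_lt_d2
  have hp : 0 < ν - 1/2 := by linarith
  have a1 : √(π / (ν - 1/2)) * √(2 * ν + 1) ≤ 3.56 := by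
    rw [← Real.sqrt_mul (by have := Real.pi_pos; positivity)]
    apply Real.sqrt_le_iff.2 ⟨by norm_num, ?_⟩
    rw [div_mul_eq_mul_div, div_le_iff₀ hp]
    have : π * (2 * ν + 1) ≤ 3.15 * (2 * ν + 1) := by gcongr
    linarith
  have hss : √(2 * ν + 1) * √(2 * ν + 1) = 2 * ν + 1 := Real.mul_self_sqrt (by linarith)
  calc _ = (√(π / (ν - 1/2)) * √(2 * ν + 1)) * √(2 * ν + 1) := by rw [mul_assoc, hss]; ring
    _ ≤ _ := by gcongr

lemma num3 (h4 : 4 < 2 * ν + 1) : 1 ≤ 3.56 * √(2 * ν + 1) := by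
  have : 1 ≤ √(2 * ν + 1) := Real.le_sqrt_of_sq_le (by linarith)
  linarith

lemma num4 (h4 : 4 < 2 * ν + 1) :
    9/4 * (3.56 * √(2 * ν + 1)) ≤ 5 * √(2 * ν + 1) + 5 * √(2 * ν) := by
  have : √(2 * ν + 1) ≤ (5/3.01) * √(2 * ν) := by
    have e : (5/3.01 : ℝ) = √((5/3.01)^2) := (Real.sqrt_sq (by norm_num)).symm
    rw [e, ← Real.sqrt_mul (by positivity)]
    apply Real.sqrt_le_sqrt
    norm_num
    linarith
  linarith

set_option maxHeartbeats 1000000 in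
/-- Result for r ≥ 2. -/
lemma core_ge (hν : 1/2 ≤ ν) (hβ : |β| < α) (hφm : Measurable φ)
    (hφ : ∀ t, |φ t| ≤ H) {x d : ℝ} (hx : 0 < x) (hd : HasDerivAt (dF ν α β φ) d x) :
    |x * d| ≤ H * (10 + (5 * √(2 * ν + 1) + 5 * √(2 * ν)) *
      (α ^ 2 / (α ^ 2 - β ^ 2)) ^ (ν + 1/2)) := by
  have hν0 : -(1/2) < ν := by linarith
  have hH : 0 ≤ H := (abs_nonneg _).trans (hφ 0)
  have hα := alpha_pos hβ
  have hb := abs_lt.1 hβ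
  have hg := gam_pos hβ
  have hρ : 1 ≤ α ^ 2 / (α ^ 2 - β ^ 2) := by
    rw [one_le_div hg]; nlinarith [sq_nonneg β]
  have hr : 2 ≤ 2 * ν + 1 := by linarith
  set γ := α ^ 2 - β ^ 2 with hγ
  set R := (α ^ 2 / γ) ^ (ν + 1/2) with hR
  have hR1 : 1 ≤ R := Real.one_le_rpow hρ (by linarith)
  have hG : γ * γ ^ (ν - 1/2) = γ ^ (ν + 1/2) := by
    rw [show ν + 1/2 = 1 + (ν - 1/2) by ring, Real.rpow_add hg, Real.rpow_one]
  set s := √(2 * ν + 1) with hs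
  set s' := √(2 * ν) with hs'
  have hss : s * s = 2 * ν + 1 := Real.mul_self_sqrt (by linarith)
  have hss' : s' * s' = 2 * ν := Real.mul_self_sqrt (by linarith)
  have hs0 : 0 ≤ s := Real.sqrt_nonneg _
  have hs0' : 0 ≤ s' := Real.sqrt_nonneg _
  rcases le_or_gt β 0 with h | h
  · refine (core_neg hν0 hβ hφm hφ hx hd h (N := 3) fun y hy => ?_).trans
      (mul_le_mul_of_nonneg_left ?_ hH)
    · have h1 : (2 * ν + 1) * (-β) * tn 0 ν α β y ≤ 1 :=
        tn_of_Ti hβ (by rw [mul_one]; exact T0_bound_a hν0 hβ h hy.le)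
      have h2 : γ * y * tn 0 ν α β y ≤ 1 := by
        apply tn_of_Ti hβ
        have := T0_bound_b (Q := γ) hν hβ (fun c hc _ => by unfold qq; nlinarith) hy.le
        rw [← hγ, mul_one, ← hG, mul_assoc]
        exact mul_le_mul_of_nonneg_left this hg.le
      have e : |(2 * ν + 1) * β - γ * y| = (2 * ν + 1) * (-β) + γ * y := by
        rw [abs_of_nonpos]
        · ring
        · have : 0 ≤ (2 * ν + 1) * (-β) := mul_nonneg (by linarith) (by linarith)
          have : 0 ≤ γ * y := by positivity
          linarith
      rw [e, add_mul]
      linarith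
    · have : 0 ≤ (5 * s + 5 * s') * R := by positivity
      linarith
  · have hαR : α ^ (2 * ν) * α = γ ^ (ν + 1/2) * R := by
      rw [hR, Real.div_rpow (by positivity) hg.le, mul_div_cancel₀ _ (by positivity),
        ← Real.rpow_two, ← Real.rpow_mul hα.le]
      nth_rewrite 2 [← Real.rpow_one α]
      rw [← Real.rpow_add hα]
      congr 1; ring
    have hγt : ∀ y, 0 < y → γ * y * tn 0 ν α β y ≤ R := by
      intro y hy
      apply tn_of_Ti hβ
      have := T0_bound_b (Q := α ^ 2) hν hβ (fun c hc _ => by unfold qq; nlinarith) hy.le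
      rw [← hγ]
      have e : γ ^ (ν + 1/2) * R = α ^ 2 * (α ^ 2) ^ (ν - 1/2) := by
        rw [hR, Real.div_rpow (by positivity) hg.le, mul_div_cancel₀ _ (by positivity),
          show ν + 1/2 = 1 + (ν - 1/2) by ring, Real.rpow_add (by positivity), Real.rpow_one]
      rw [e, mul_assoc]
      have hp : 0 < (α ^ 2) ^ (ν - 1/2) := by positivity
      calc γ * (y * Ti 0 ν α β y) ≤ γ * (α ^ 2) ^ (ν - 1/2) := by gcongr
        _ ≤ _ := by gcongr; rw [hγ]; nlinarith [sq_nonneg β]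
    have main : ∀ Bt k, (∀ y, 0 < y → Ti 0 ν α β y ≤ Bt * α ^ (2 * ν)) →
        0 ≤ Bt → (2 * ν + 1) * Bt ≤ k → 1 ≤ k → 9/4 * k ≤ 5 * s + 5 * s' →
        |x * d| ≤ H * (10 + (5 * s + 5 * s') * R) := by
      intro Bt k hBt hB0 hk hk1 hk2
      refine (core_pos_ge hν hβ hφm hφ hx hd h (N := 1 + k * R) fun y hy => ?_).trans
        (mul_le_mul_of_nonneg_left ?_ hH)
      · refine add_le_add_right ?_ 1
        refine abs_sub_mul_le (tn_nonneg hβ 0 y) (by positivity) (by positivity) ?_ ?_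
        · apply tn_of_Ti hβ
          rw [← hγ]
          have hα2 : 0 < α ^ (2 * ν) := by positivity
          calc (2 * ν + 1) * β * Ti 0 ν α β y ≤ (2 * ν + 1) * α * (Bt * α ^ (2 * ν)) := by
                refine mul_le_mul ?_ (hBt y hy) (Ti_nonneg hβ 0 y) (by positivity)
                gcongr
                exact hb.2.le
            _ = ((2 * ν + 1) * Bt) * (α ^ (2 * ν) * α) := by ring
            _ ≤ k * (α ^ (2 * ν) * α) := by gcongr
            _ = _ := by rw [hαR]; ring
        · refine (hγt y hy).trans ?_
          nlinarith
      · nlinarith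
    rcases le_or_gt (2 * ν + 1) 4 with h4 | h4
    · exact main 2 ((2 * ν + 1) * 2) (fun y hy => T0_bound_e1 hν hβ hy.le) (by norm_num) le_rfl
        (by linarith) (num1 hr h4)
    · exact main (√(π / (ν - 1/2))) (3.56 * s) (fun y hy => T0_bound_e2 (by linarith) hβ hy.le)
        (Real.sqrt_nonneg _) (num2 h4) (num3 h4) (num4 h4)

end Bounds

section Density
open Set Topology

lemma gauss_lin {b : ℝ} (hb : 0 < b) (β k : ℝ) :
    Integrable (fun t : ℝ => exp (β * t - b * t ^ 2 + k)) ∧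
    ∫ t : ℝ, exp (β * t - b * t ^ 2 + k) = √(π / b) * exp (β ^ 2 / (4 * b) + k) := by
  have e : (fun t : ℝ => exp (β * t - b * t ^ 2 + k)) =
      fun t => exp (-b * (t - β / (2 * b)) ^ 2) * exp (β ^ 2 / (4 * b) + k) := by
    funext t
    rw [← Real.exp_add]; congr 1; field_simp; ring
  rw [e]
  constructor
  · exact ((integrable_exp_neg_mul_sq hb).comp_sub_right (β / (2 * b))).mul_const _
  · rw [integral_mul_const, integral_sub_right_eq_self (fun t => exp (-b * t ^ 2)),
      integral_gaussian]

lemma gamma_scaled {μ c : ℝ} (hμ : 0 < μ) (hc : 0 < c) :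
    Integrable (fun w : ℝ => exp (μ * w - c * exp w)) ∧
    ∫ w : ℝ, exp (μ * w - c * exp w) = Real.Gamma μ * c ^ (-μ) := by
  obtain ⟨h1, h2⟩ := gamma_log hμ
  have e : (fun w : ℝ => exp (μ * w - c * exp w)) =
      fun w => (fun t => exp (μ * t - exp t)) (w + log c) * c ^ (-μ) := by
    funext w
    simp only
    rw [Real.rpow_def_of_pos hc, ← Real.exp_add, Real.exp_add w, Real.exp_log hc]
    congr 1; ring
  rw [e]
  constructor
  · exact (h1.comp_add_right (log c)).mul_const _
  · rw [integral_mul_const, integral_add_right_eq_self (fun t => exp (μ * t - exp t)), h2]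

lemma gK_total {ν α β : ℝ} (hν : -(1/2) < ν) (hβ : |β| < α) :
    Integrable (fun t : ℝ => exp (β * t) * gK ν (zz α t)) ∧
    ∫ t : ℝ, exp (β * t) * gK ν (zz α t) =
      2 * √π / α * (Real.Gamma (ν + 1/2) * (1 - β ^ 2 / α ^ 2) ^ (-(ν + 1/2))) := by
  have hα : 0 < α := (abs_nonneg _).trans_lt hβ
  have hc : 0 < 1 - β ^ 2 / α ^ 2 := by
    rw [sub_pos, div_lt_one (by positivity)]
    exact sq_lt_sq.2 (by rwa [abs_of_pos hα])
  have hμ : 0 < ν + 1/2 := by linarith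
  obtain ⟨g1, g2⟩ := gamma_scaled hμ hc
  have hb : ∀ w : ℝ, 0 < α ^ 2 / 4 * exp (-w) := fun w => by positivity
  have hF : ∀ t w : ℝ, exp (β * t) * exp (ν * w - exp w - zz α t * exp (-w)) =
      exp (β * t - (α ^ 2 / 4 * exp (-w)) * t ^ 2 + (ν * w - exp w)) := by
    intro t w
    rw [← Real.exp_add]; congr 1; unfold zz; ring
  have hval : ∀ w : ℝ, √(π / (α ^ 2 / 4 * exp (-w))) *
      exp (β ^ 2 / (4 * (α ^ 2 / 4 * exp (-w))) + (ν * w - exp w)) =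
      2 * √π / α * exp ((ν + 1/2) * w - (1 - β ^ 2 / α ^ 2) * exp w) := by
    intro w
    have e1 : π / (α ^ 2 / 4 * exp (-w)) = (2 / α * exp (w / 2)) ^ 2 * π := by
      rw [mul_pow, ← Real.exp_nat_mul, Real.exp_neg]
      rw [show ((2 : ℕ) : ℝ) * (w / 2) = w by push_cast; ring]
      have := Real.exp_pos w
      field_simp
      ring
    rw [e1, Real.sqrt_mul (by positivity), Real.sqrt_sq (by positivity)]
    have e2 : β ^ 2 / (4 * (α ^ 2 / 4 * exp (-w))) = β ^ 2 / α ^ 2 * exp w := by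
      rw [Real.exp_neg]; have := Real.exp_pos w; field_simp
    rw [e2]
    have e3 : exp (w / 2) * exp (β ^ 2 / α ^ 2 * exp w + (ν * w - exp w)) =
        exp ((ν + 1/2) * w - (1 - β ^ 2 / α ^ 2) * exp w) := by
      rw [← Real.exp_add]; congr 1; ring
    rw [← e3]; ring
  set F : ℝ × ℝ → ℝ := fun p => exp (β * p.1) * exp (ν * p.2 - exp p.2 - zz α p.1 * exp (-p.2))
    with hFdef
  have hFc : Continuous F := by
    have : Continuous (zz α) := by unfold zz; fun_prop
    rw [hFdef]; fun_prop
  have hFi : Integrable F (volume.prod volume) := by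
    rw [integrable_prod_iff' hFc.aestronglyMeasurable]
    constructor
    · refine Eventually.of_forall fun w => ?_
      simp only [hFdef, hF]
      exact (gauss_lin (hb w) β _).1
    · have : (fun w : ℝ => ∫ t : ℝ, ‖F (t, w)‖) =
          fun w => 2 * √π / α * exp ((ν + 1/2) * w - (1 - β ^ 2 / α ^ 2) * exp w) := by
        funext w
        rw [← hval w, ← (gauss_lin (hb w) β _).2]
        congr 1; funext t
        simp only [hFdef, hF]
        rw [Real.norm_eq_abs, abs_of_pos (Real.exp_pos _)]
      rw [this]
      exact g1.const_mul _
  have hin : (fun t : ℝ => exp (β * t) * gK ν (zz α t)) = fun t => ∫ w, F (t, w) := by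
    funext t
    simp only [hFdef]
    rw [integral_const_mul]; rfl
  rw [hin]
  refine ⟨hFi.integral_prod_left, ?_⟩
  have := integral_integral_swap (f := fun t w => F (t, w)) hFi
  rw [this, ← g2, ← integral_const_mul]
  congr 1; funext w
  rw [← hval w, ← (gauss_lin (hb w) β _).2]
  congr 1; funext t
  simp only [hFdef, hF]

/-- Weighted Bessel K kernel. -/
noncomputable def Kw (ν α β t : ℝ) : ℝ := exp (β * t) * |t| ^ ν * besselK ν (α * |t|)

lemma Kw_eq {ν α β t : ℝ} (hα : 0 < α) (ht : t ≠ 0) :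
    Kw ν α β t = (α / 2) ^ (-ν) / 2 * (exp (β * t) * gK ν (zz α t)) := by
  have ht' : 0 < |t| := abs_pos.2 ht
  have h := gK_eq_besselK ν (y := α * |t|) (by positivity)
  have e : (α * |t|) ^ 2 / 4 = zz α t := by unfold zz; rw [mul_pow, sq_abs]
  rw [e, show α * |t| / 2 = α / 2 * |t| by ring,
    Real.mul_rpow (by positivity) ht'.le] at h
  unfold Kw
  rw [h, Real.rpow_neg (by positivity)]
  have : 0 < (α / 2) ^ ν := by positivity
  generalize (α / 2) ^ ν = A at *
  field_simp

lemma Kw_ae {ν α β : ℝ} (hα : 0 < α) :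
    (fun t => (α / 2) ^ (-ν) / 2 * (exp (β * t) * gK ν (zz α t))) =ᵐ[volume] Kw ν α β := by
  filter_upwards [Measure.ae_ne volume (0 : ℝ)] with t ht
  exact (Kw_eq hα ht).symm

lemma Kw_total {ν α β : ℝ} (hν : -(1/2) < ν) (hβ : |β| < α) :
    Integrable (Kw ν α β) ∧ ∫ t, Kw ν α β t = (α / 2) ^ (-ν) / 2 *
      (2 * √π / α * (Real.Gamma (ν + 1/2) * (1 - β ^ 2 / α ^ 2) ^ (-(ν + 1/2)))) := by
  have hα : 0 < α := (abs_nonneg _).trans_lt hβ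
  obtain ⟨h1, h2⟩ := gK_total hν hβ
  refine ⟨(h1.const_mul _).congr (Kw_ae hα), ?_⟩
  rw [← integral_congr_ae (Kw_ae hα), integral_const_mul, h2]

end Density

section Params
open Set Topology

/-- parameter facts -/
lemma param_facts (θ : ℝ) {σ : ℝ} (hσ : 0 < σ) :
    |θ / σ ^ 2| < √(θ ^ 2 + σ ^ 2) / σ ^ 2 ∧
    (√(θ ^ 2 + σ ^ 2) / σ ^ 2) ^ 2 - (θ / σ ^ 2) ^ 2 = 1 / σ ^ 2 ∧
    (√(θ ^ 2 + σ ^ 2) / σ ^ 2) ^ 2 / (1 / σ ^ 2) = 1 + θ ^ 2 / σ ^ 2 := by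
  have hs : 0 ≤ θ ^ 2 + σ ^ 2 := by positivity
  refine ⟨?_, ?_, ?_⟩
  · rw [abs_div, abs_of_pos (by positivity : 0 < σ ^ 2)]
    gcongr
    rw [← Real.sqrt_sq_eq_abs]
    apply Real.sqrt_lt_sqrt (by positivity)
    have : 0 < σ ^ 2 := by positivity
    linarith
  · rw [div_pow, Real.sq_sqrt hs]; field_simp; ring
  · rw [div_pow, Real.sq_sqrt hs]; field_simp; ring

lemma vg_eq (r θ : ℝ) {σ : ℝ} (hσ : 0 < σ) (t : ℝ) :
    vgDensity r θ σ t = (σ * √π * Real.Gamma (r / 2))⁻¹ *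
      (2 * √(θ ^ 2 + σ ^ 2)) ^ (-((r - 1) / 2)) *
      Kw ((r - 1) / 2) (√(θ ^ 2 + σ ^ 2) / σ ^ 2) (θ / σ ^ 2) t := by
  unfold vgDensity Kw
  rw [Real.div_rpow (abs_nonneg _) (by positivity), Real.rpow_neg (by positivity),
    show θ * t / σ ^ 2 = θ / σ ^ 2 * t by ring,
    show √(θ ^ 2 + σ ^ 2) * |t| / σ ^ 2 = √(θ ^ 2 + σ ^ 2) / σ ^ 2 * |t| by ring]
  ring

lemma vg_total {r : ℝ} (θ : ℝ) {σ : ℝ} (hr : 0 < r) (hσ : 0 < σ) :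
    Integrable (vgDensity r θ σ) ∧ ∫ t, vgDensity r θ σ t = 1 := by
  obtain ⟨hβ, hg, hρ⟩ := param_facts θ hσ
  have hν : -(1/2) < (r - 1) / 2 := by linarith
  obtain ⟨h1, h2⟩ := Kw_total hν hβ
  have e : vgDensity r θ σ = fun t => (σ * √π * Real.Gamma (r / 2))⁻¹ *
      (2 * √(θ ^ 2 + σ ^ 2)) ^ (-((r - 1) / 2)) *
      Kw ((r - 1) / 2) (√(θ ^ 2 + σ ^ 2) / σ ^ 2) (θ / σ ^ 2) t := funext (vg_eq r θ hσ)
  rw [e]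
  refine ⟨h1.const_mul _, ?_⟩
  rw [integral_const_mul, h2]
  have hS : 0 < √(θ ^ 2 + σ ^ 2) := Real.sqrt_pos.2 (by positivity)
  have hSS : √(θ ^ 2 + σ ^ 2) ^ 2 = θ ^ 2 + σ ^ 2 := Real.sq_sqrt (by positivity)
  set S := √(θ ^ 2 + σ ^ 2) with hSd
  have e1 : (1 : ℝ) - (θ / σ ^ 2) ^ 2 / (S / σ ^ 2) ^ 2 = ((S / σ) ^ 2)⁻¹ := by
    rw [div_pow, div_pow, div_pow, hSS]
    have : 0 < θ ^ 2 + σ ^ 2 := by positivity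
    field_simp; ring
  have e2 : (2 * S) ^ (-((r - 1) / 2)) * (S / σ ^ 2 / 2) ^ (-((r - 1) / 2)) =
      (S / σ) ^ (-(r - 1)) := by
    rw [← Real.mul_rpow (by positivity) (by positivity),
      show 2 * S * (S / σ ^ 2 / 2) = (S / σ) ^ 2 by field_simp,
      ← Real.rpow_two, ← Real.rpow_mul (by positivity)]
    congr 1; ring
  have e3 : (((S / σ) ^ 2)⁻¹) ^ (-((r - 1) / 2 + 1 / 2)) = (S / σ) ^ r := by
    rw [Real.rpow_neg (by positivity), Real.inv_rpow (by positivity), inv_inv, ← Real.rpow_two,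
      ← Real.rpow_mul (by positivity)]
    congr 1; ring
  have e4 : (S / σ) ^ (-(r - 1)) * (S / σ) ^ r = S / σ := by
    rw [← Real.rpow_add (by positivity)]
    rw [show -(r - 1) + r = 1 by ring, Real.rpow_one]
  rw [e1, e3, show (r - 1) / 2 + 1 / 2 = r / 2 by ring]
  have hΓ : 0 < Real.Gamma (r / 2) := Real.Gamma_pos_of_pos (by linarith)
  have hπ : 0 < √π := Real.sqrt_pos.2 Real.pi_pos
  calc _ = ((2 * S) ^ (-((r - 1) / 2)) * (S / σ ^ 2 / 2) ^ (-((r - 1) / 2))) * (S / σ) ^ r *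
        ((σ * √π * Real.Gamma (r / 2))⁻¹ * (√π / (S / σ ^ 2) * Real.Gamma (r / 2))) := by ring
    _ = (S / σ) * ((σ * √π * Real.Gamma (r / 2))⁻¹ * (√π / (S / σ ^ 2) * Real.Gamma (r / 2))) := by
        rw [e2, e4]
    _ = 1 := by field_simp

lemma Kw_htilde {r : ℝ} (θ : ℝ) {σ : ℝ} (hr : 0 < r) (hσ : 0 < σ) {h : ℝ → ℝ}
    (hmeas : Measurable h) {M : ℝ} (hbd : ∀ t, |h t| ≤ M) :
    Integrable (fun t => Kw ((r - 1) / 2) (√(θ ^ 2 + σ ^ 2) / σ ^ 2) (θ / σ ^ 2) t *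
      htilde r θ σ h t) ∧
    ∫ t, Kw ((r - 1) / 2) (√(θ ^ 2 + σ ^ 2) / σ ^ 2) (θ / σ ^ 2) t * htilde r θ σ h t = 0 := by
  obtain ⟨hβ, hg, hρ⟩ := param_facts θ hσ
  obtain ⟨v1, v2⟩ := vg_total θ hr hσ
  have hS : 0 < √(θ ^ 2 + σ ^ 2) := Real.sqrt_pos.2 (by positivity)
  have hΓ : 0 < Real.Gamma (r / 2) := Real.Gamma_pos_of_pos (by linarith)
  have hπ : 0 < √π := Real.sqrt_pos.2 Real.pi_pos
  have hc : 0 < (σ * √π * Real.Gamma (r / 2))⁻¹ *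
      (2 * √(θ ^ 2 + σ ^ 2)) ^ (-((r - 1) / 2)) := by positivity
  set c := (σ * √π * Real.Gamma (r / 2))⁻¹ * (2 * √(θ ^ 2 + σ ^ 2)) ^ (-((r - 1) / 2)) with hcd
  have e : (fun t => Kw ((r - 1) / 2) (√(θ ^ 2 + σ ^ 2) / σ ^ 2) (θ / σ ^ 2) t *
      htilde r θ σ h t) = fun t => c⁻¹ * (h t * vgDensity r θ σ t -
        (∫ s, h s * vgDensity r θ σ s) * vgDensity r θ σ t) := by
    funext t
    have := vg_eq r θ hσ t
    rw [← hcd] at this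
    unfold htilde
    rw [← sub_mul, this]
    field_simp
  have hi : Integrable (fun t => h t * vgDensity r θ σ t) :=
    v1.bdd_mul hmeas.aestronglyMeasurable (Eventually.of_forall fun t => by
      rw [Real.norm_eq_abs]; exact hbd t)
  rw [e]
  refine ⟨(hi.sub (v1.const_mul _)).const_mul _, ?_⟩
  rw [integral_const_mul, integral_sub hi (v1.const_mul _), integral_const_mul, v2]
  simp

lemma vg_neg (r θ σ t : ℝ) : vgDensity r (-θ) σ t = vgDensity r θ σ (-t) := by
  unfold vgDensity
  rw [neg_sq, abs_neg, neg_mul, mul_neg]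

lemma htilde_neg (r θ σ : ℝ) (h : ℝ → ℝ) (t : ℝ) :
    htilde r (-θ) σ (fun s => h (-s)) t = htilde r θ σ h (-t) := by
  unfold htilde
  simp only [vg_neg]
  rw [integral_neg_eq_self (fun t => h t * vgDensity r θ σ t)]

lemma stein_neg {r : ℝ} (θ : ℝ) {σ : ℝ} (hr : 0 < r) (hσ : 0 < σ) {h : ℝ → ℝ}
    (hmeas : Measurable h) {M : ℝ} (hbd : ∀ t, |h t| ≤ M) (y : ℝ) :
    steinSolution r θ σ h (-y) = -steinSolution r (-θ) σ (fun s => h (-s)) y := by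
  obtain ⟨k1, k2⟩ := Kw_htilde θ hr hσ hmeas hbd
  have hI : (∫ t in (0:ℝ)..(-y), Real.exp ((θ / σ ^ 2) * t) * |t| ^ ((r - 1) / 2) *
      besselI ((r - 1) / 2) (Real.sqrt (θ ^ 2 + σ ^ 2) / σ ^ 2 * |t|) * htilde r θ σ h t) =
      -∫ t in (0:ℝ)..y, Real.exp ((-θ / σ ^ 2) * t) * |t| ^ ((r - 1) / 2) *
      besselI ((r - 1) / 2) (Real.sqrt ((-θ) ^ 2 + σ ^ 2) / σ ^ 2 * |t|) *
        htilde r (-θ) σ (fun s => h (-s)) t := by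
    have := intervalIntegral.integral_comp_neg (a := 0) (b := y) (fun t =>
      Real.exp ((θ / σ ^ 2) * t) * |t| ^ ((r - 1) / 2) *
      besselI ((r - 1) / 2) (Real.sqrt (θ ^ 2 + σ ^ 2) / σ ^ 2 * |t|) * htilde r θ σ h t)
    rw [neg_zero] at this
    rw [intervalIntegral.integral_symm (-y) 0, ← this]
    congr 1
    apply intervalIntegral.integral_congr
    intro t _
    simp only [htilde_neg, neg_sq, abs_neg]
    congr 4
    ring
  have hK : (∫ t in Set.Ioi (-y), Real.exp ((θ / σ ^ 2) * t) * |t| ^ ((r - 1) / 2) *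
      besselK ((r - 1) / 2) (Real.sqrt (θ ^ 2 + σ ^ 2) / σ ^ 2 * |t|) * htilde r θ σ h t) =
      -∫ t in Set.Ioi y, Real.exp ((-θ / σ ^ 2) * t) * |t| ^ ((r - 1) / 2) *
      besselK ((r - 1) / 2) (Real.sqrt ((-θ) ^ 2 + σ ^ 2) / σ ^ 2 * |t|) *
        htilde r (-θ) σ (fun s => h (-s)) t := by
    have a := integral_comp_neg_Ioi y (fun t =>
      Kw ((r - 1) / 2) (√(θ ^ 2 + σ ^ 2) / σ ^ 2) (θ / σ ^ 2) t * htilde r θ σ h t)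
    have b := intervalIntegral.integral_Iic_add_Ioi (b := -y) k1.integrableOn k1.integrableOn
    rw [k2, ← a] at b
    have c := eq_neg_of_add_eq_zero_right b
    unfold Kw at c
    rw [c]
    congr 2
    funext t
    simp only [htilde_neg, neg_sq, abs_neg]
    congr 4
    ring
  unfold steinSolution
  rw [hI, hK]
  rw [abs_neg, neg_sq, show -(-θ / σ ^ 2) * y = -(θ / σ ^ 2) * -y by ring]
  ring

lemma stein_pos {r : ℝ} (θ : ℝ) {σ : ℝ} (hr : 0 < r) (hσ : 0 < σ) (h : ℝ → ℝ) {x : ℝ}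
    (hx : 0 < x) :
    steinSolution r θ σ h x = -(1 / σ ^ 2) * FF ((r - 1) / 2) (√(θ ^ 2 + σ ^ 2) / σ ^ 2)
      (θ / σ ^ 2) (htilde r θ σ h) x := by
  unfold steinSolution
  have hS : 0 < √(θ ^ 2 + σ ^ 2) := Real.sqrt_pos.2 (by positivity)
  have hα : 0 < √(θ ^ 2 + σ ^ 2) / σ ^ 2 := by positivity
  set α := √(θ ^ 2 + σ ^ 2) / σ ^ 2 with hαd
  set β := θ / σ ^ 2 with hβd
  set ν := (r - 1) / 2 with hνd
  set φ := htilde r θ σ h with hφd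
  have hA : 0 < (α / 2) ^ ν := by positivity
  have hzz : ∀ t : ℝ, (α * t) ^ 2 / 4 = zz α t := fun t => by unfold zz; ring
  have hIe : ∀ t : ℝ, 0 < t → besselI ν (α * |t|) = (α / 2) ^ ν * t ^ ν * jI ν (zz α t) := by
    intro t ht
    rw [abs_of_pos ht, besselI_eq ν (by positivity), hzz, show α * t / 2 = α / 2 * t by ring,
      Real.mul_rpow (by positivity) ht.le]
  have hUe : ∀ t : ℝ, 0 < t → exp (β * t) * |t| ^ ν * besselI ν (α * |t|) * φ t =
      (α / 2) ^ ν * (hU ν α β t * φ t) := by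
    intro t ht
    rw [hIe t ht, abs_of_pos ht]
    unfold hU mm vv
    rw [Real.rpow_add ht, Real.rpow_one, show 2 * ν = ν + ν by ring, Real.rpow_add ht,
      show 2 * β * t = β * t + β * t by ring, Real.exp_add, Real.exp_neg]
    have := Real.exp_pos (β * t)
    generalize t ^ ν = X
    generalize (α / 2) ^ ν = Y
    field_simp
  have hVe : ∀ t : ℝ, 0 < t → exp (β * t) * |t| ^ ν * besselK ν (α * |t|) * φ t =
      (α / 2) ^ (-ν) * (hV ν α β t * φ t) := by
    intro t ht
    have h1 := Kw_eq (ν := ν) (β := β) hα ht.ne'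
    unfold Kw at h1
    rw [h1]
    unfold hV
    rw [mu_eq hα ht]
    field_simp
  have hI : (∫ t in (0:ℝ)..x, exp (β * t) * |t| ^ ν * besselI ν (α * |t|) * φ t) =
      (α / 2) ^ ν * UU ν α β φ x := by
    unfold UU
    rw [← intervalIntegral.integral_const_mul]
    apply intervalIntegral.integral_congr_ae
    refine Eventually.of_forall fun t ht => ?_
    rw [Set.uIoc_of_le hx.le] at ht
    exact hUe t ht.1
  have hK : (∫ t in Set.Ioi x, exp (β * t) * |t| ^ ν * besselK ν (α * |t|) * φ t) =
      (α / 2) ^ (-ν) * VV ν α β φ x := by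
    unfold VV
    rw [← integral_const_mul]
    apply setIntegral_congr_fun measurableSet_Ioi
    intro t ht
    exact hVe t (hx.trans ht)
  rw [hI, hK, hIe x hx]
  have hu : exp (-β * x) * besselK ν (α * |x|) = (α / 2) ^ (-ν) * x ^ ν * uu ν α β x := by
    have h1 := Kw_eq (ν := ν) (β := 0) hα hx.ne'
    unfold Kw at h1
    rw [zero_mul, Real.exp_zero, one_mul, one_mul, ← gK_reflect ν (zz_pos hα hx), zz_rpow hα hx,
      show 2 * ν = ν + ν by ring, Real.rpow_add hx, abs_of_pos hx] at h1
    have hX : 0 < x ^ ν := by positivity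
    rw [abs_of_pos hx]
    unfold uu kk
    rw [neg_mul, show 2 * ν = ν + ν by ring]
    generalize (α / 2) ^ (ν + ν) = A2 at *
    generalize (α / 2) ^ (-ν) = A3 at *
    have h2 : besselK ν (α * x) = A3 / 2 * (A2 * x ^ ν * gK (-ν) (zz α x)) := by
      apply mul_left_cancel₀ hX.ne'
      rw [h1]; ring
    rw [h2]; ring
  rw [hu]
  have hX : 0 < x ^ ν := by positivity
  unfold FF vv
  rw [abs_of_pos hx, Real.rpow_neg (by positivity), neg_mul]
  generalize x ^ ν = X at *
  generalize (α / 2) ^ ν = A at *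
  field_simp
  ring

end Params

section Final
open Set Topology

lemma budget_lt {r : ℝ} (θ : ℝ) {σ : ℝ} (hr : 0 < r) (hσ : 0 < σ) (h2 : r < 2) :
    (1 + 4 * (1 + θ ^ 2 / σ ^ 2)) * (3 + 6 / r) ≤ 5 + 2 * r * Aconst r θ σ +
      (5 + 4 * θ ^ 2 / σ ^ 2) * (1 + 6 / r + Bconst r θ σ) := by
  unfold Aconst Bconst
  rw [if_neg (not_le.2 h2), if_neg (not_le.2 h2)]
  have hΓ : 0 < Real.Gamma (r / 2) := Real.Gamma_pos_of_pos (by linarith)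
  have h1 : 0 ≤ 2 * r * (12 * Real.Gamma (r / 2) * (1 + θ ^ 2 / σ ^ 2)) := by positivity
  have e : (1 + 4 * (1 + θ ^ 2 / σ ^ 2)) * (3 + 6 / r) =
      (5 + 4 * θ ^ 2 / σ ^ 2) * (1 + 6 / r + 2) := by ring
  rw [e]; linarith

lemma budget_ge {r : ℝ} (θ : ℝ) {σ : ℝ} (hσ : 0 < σ) (h2 : 2 ≤ r) :
    10 + (5 * √r + 5 * √(r - 1)) * (1 + θ ^ 2 / σ ^ 2) ^ (r / 2) ≤ 5 + 2 * r * Aconst r θ σ +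
      (5 + 4 * θ ^ 2 / σ ^ 2) * (1 + 6 / r + Bconst r θ σ) := by
  unfold Aconst Bconst
  rw [if_pos h2, if_pos h2]
  have hρ1 : 1 ≤ 1 + θ ^ 2 / σ ^ 2 := by
    have : 0 ≤ θ ^ 2 / σ ^ 2 := by positivity
    linarith
  have e : 5 + 4 * θ ^ 2 / σ ^ 2 = 1 + 4 * (1 + θ ^ 2 / σ ^ 2) := by ring
  rw [e]
  set ρ := 1 + θ ^ 2 / σ ^ 2
  have hρ : 0 < ρ := by linarith
  have eρ : ρ ^ (r / 2) = ρ * ρ ^ (r / 2 - 1) := by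
    nth_rewrite 2 [← Real.rpow_one ρ]
    rw [← Real.rpow_add hρ]; congr 1; ring
  have hq : 0 < ρ ^ (r / 2 - 1) := by positivity
  have hπ := Real.pi_gt_d2
  have hπ0 := Real.pi_pos
  have a1 : 5 * √r ≤ 2 * r * (2 * √π / √(2 * r - 1)) := by
    have hp : 0 < √(2 * r - 1) := Real.sqrt_pos.2 (by linarith)
    rw [← mul_div_assoc, le_div_iff₀ hp]
    have h5 : 5 * √(2 * r - 1) ≤ 4 * √π * √r := by
      have e5 : (5 : ℝ) = √25 := by
        rw [show (25 : ℝ) = 5 ^ 2 by norm_num, Real.sqrt_sq (by norm_num)]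
      have e4 : (4 : ℝ) = √16 := by
        rw [show (16 : ℝ) = 4 ^ 2 by norm_num, Real.sqrt_sq (by norm_num)]
      rw [e5, e4, ← Real.sqrt_mul (by norm_num), ← Real.sqrt_mul (by norm_num),
        ← Real.sqrt_mul (by positivity)]
      apply Real.sqrt_le_sqrt
      nlinarith
    have hs : √r * √r = r := Real.mul_self_sqrt (by linarith)
    calc 5 * √r * √(2 * r - 1) = √r * (5 * √(2 * r - 1)) := by ring
      _ ≤ √r * (4 * √π * √r) := by gcongr
      _ = 4 * √π * (√r * √r) := by ring
      _ = _ := by rw [hs]; ring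
  have a2 : 5 * √(r - 1) ≤ 4 * √(π * (r - 1) / 2) := by
    have h5 : √(r - 1) ≤ √((4/5) ^ 2 * (π * (r - 1) / 2)) := by
      apply Real.sqrt_le_sqrt
      nlinarith
    rw [Real.sqrt_mul (by norm_num), Real.sqrt_sq (by norm_num)] at h5
    linarith
  have b1 := mul_le_mul_of_nonneg_right a1 (by positivity : 0 ≤ ρ ^ (r / 2))
  have b2 := mul_le_mul_of_nonneg_right a2 (by positivity : 0 ≤ ρ ^ (r / 2))
  have b3 : 4 * √(π * (r - 1) / 2) * ρ ^ (r / 2) =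
      4 * ρ * (√(π * (r - 1) / 2) * ρ ^ (r / 2 - 1)) := by rw [eρ]; ring
  have b4 : 0 ≤ √(π * (r - 1) / 2) * ρ ^ (r / 2 - 1) := by positivity
  have b5 : 0 ≤ 6 / r := by positivity
  have b6 : 0 ≤ ρ * (6 / r) := by positivity
  rw [b3] at b2
  linarith

lemma htilde_facts (r θ σ : ℝ) {h : ℝ → ℝ} (hmeas : Measurable h) {M : ℝ}
    (hbd : ∀ t, |h t| ≤ M) :
    Measurable (htilde r θ σ h) ∧ ∀ t, |htilde r θ σ h t| ≤ ⨆ t : ℝ, |htilde r θ σ h t| := by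
  refine ⟨hmeas.sub_const _, fun t => ?_⟩
  refine le_ciSup (f := fun t => |htilde r θ σ h t|) ⟨M + |∫ t, h t * vgDensity r θ σ t|, ?_⟩ t
  rintro _ ⟨s, rfl⟩
  exact (abs_sub _ _).trans (by linarith [hbd s])

lemma main_pos {r : ℝ} (θ : ℝ) {σ : ℝ} (hr : 0 < r) (hσ : 0 < σ)
    {h : ℝ → ℝ} (hmeas : Measurable h) {M : ℝ} (hbd : ∀ t, |h t| ≤ M) {x : ℝ} (hx : 0 < x)
    {g : ℝ → ℝ} (hg : ∀ᶠ y in 𝓝 x, y ≠ 0 → HasDerivAt (steinSolution r θ σ h) (g y) y)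
    {d : ℝ} (hd : HasDerivAt g d x) :
    |x * d| ≤ (1 / σ ^ 2) * (5 + 2 * r * Aconst r θ σ +
            (5 + 4 * θ ^ 2 / σ ^ 2) * (1 + 6 / r + Bconst r θ σ)) *
          ⨆ t : ℝ, |htilde r θ σ h t| := by
  obtain ⟨hβ, hγ, hρ⟩ := param_facts θ hσ
  obtain ⟨hφm, hφ⟩ := htilde_facts r θ σ hmeas hbd
  have hν : -(1/2) < (r - 1) / 2 := by linarith
  have hr2 : 2 * ((r - 1) / 2) + 1 = r := by ring
  have hH : 0 ≤ ⨆ t : ℝ, |htilde r θ σ h t| := (abs_nonneg _).trans (hφ 0)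
  have hgd : (dF ((r - 1) / 2) (√(θ ^ 2 + σ ^ 2) / σ ^ 2) (θ / σ ^ 2) (htilde r θ σ h)) =ᶠ[𝓝 x]
      fun y => -(σ ^ 2) * g y := by
    filter_upwards [hg, lt_mem_nhds hx] with y hy hy0
    have h1 := (FF_hasDerivAt hν hβ hφm hφ hy0).const_mul (-(1 / σ ^ 2))
    have h2 : HasDerivAt (steinSolution r θ σ h) _ y := h1.congr_of_eventuallyEq (by
      filter_upwards [lt_mem_nhds hy0] with z hz
      exact stein_pos θ hr hσ h hz)
    rw [(hy hy0.ne').unique h2]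
    field_simp
  have hdd := (hd.const_mul (-(σ ^ 2))).congr_of_eventuallyEq hgd
  have key : |x * (-(σ ^ 2) * d)| ≤ (⨆ t : ℝ, |htilde r θ σ h t|) *
      (5 + 2 * r * Aconst r θ σ +
            (5 + 4 * θ ^ 2 / σ ^ 2) * (1 + 6 / r + Bconst r θ σ)) := by
    rcases lt_or_ge r 2 with h2 | h2
    · have := core_lt hν (by linarith) hβ hφm hφ hx hdd
      rw [hγ, hρ, hr2] at this
      exact this.trans (mul_le_mul_of_nonneg_left (budget_lt θ hr hσ h2) hH)
    · have := core_ge (by linarith) hβ hφm hφ hx hdd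
      rw [hγ, hρ, hr2, show 2 * ((r - 1) / 2) = r - 1 by ring,
        show (r - 1) / 2 + 1 / 2 = r / 2 by ring] at this
      exact this.trans (mul_le_mul_of_nonneg_left (budget_ge θ hσ h2) hH)
  have hs : 0 < σ ^ 2 := by positivity
  rw [show x * (-(σ ^ 2) * d) = -(σ ^ 2 * (x * d)) by ring, abs_neg, abs_mul,
    abs_of_pos hs] at key
  rw [one_div, mul_assoc, ← div_eq_inv_mul, le_div_iff₀ hs]
  linarith

end Final

theorem stein_factor_xf''_bounded (r θ σ : ℝ) (hr : 0 < r) (hσ : 0 < σ)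
    (h : ℝ → ℝ) (hmeas : Measurable h) (M : ℝ) (hbd : ∀ t, |h t| ≤ M) :
    ∀ x : ℝ, x ≠ 0 → ∀ g : ℝ → ℝ,
      (∀ᶠ y in nhds x, y ≠ 0 → HasDerivAt (steinSolution r θ σ h) (g y) y) →
      ∀ d : ℝ, HasDerivAt g d x →
      |x * d| ≤
        (1 / σ ^ 2) * (5 + 2 * r * Aconst r θ σ +
            (5 + 4 * θ ^ 2 / σ ^ 2) * (1 + 6 / r + Bconst r θ σ)) *
          ⨆ t : ℝ, |htilde r θ σ h t| := by
  intro x hx g hg d hd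
  rcases lt_or_gt_of_ne hx with hneg | hpos
  · have hbd' : ∀ t, |(fun s => h (-s)) t| ≤ M := fun t => hbd (-t)
    have hmeas' : Measurable (fun s => h (-s)) := hmeas.comp measurable_neg
    have hx' : 0 < -x := by linarith
    have hg' : ∀ᶠ y in nhds (-x), y ≠ 0 →
        HasDerivAt (steinSolution r (-θ) σ (fun s => h (-s))) (g (-y)) y := by
      have ht : Filter.Tendsto (fun y : ℝ => -y) (nhds (-x)) (nhds x) := by
        have := (continuous_neg (G := ℝ)).tendsto (-x)
        rwa [neg_neg] at this
      filter_upwards [ht.eventually hg] with y hy hy0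
      have h1 := (hy (neg_ne_zero.2 hy0)).scomp y (hasDerivAt_neg y)
      have h2 : steinSolution r (-θ) σ (fun s => h (-s)) =
          fun z => -(steinSolution r θ σ h ∘ fun z => -z) z := by
        funext z
        simp only [Function.comp]
        rw [stein_neg θ hr hσ hmeas hbd z, neg_neg]
      rw [h2]
      refine h1.neg.congr_deriv ?_
      simp
    have hd' : HasDerivAt (fun y => g (-y)) (-d) (-x) := by
      have h0 : HasDerivAt g d (- -x) := by rwa [neg_neg]
      refine (h0.scomp (-x) (hasDerivAt_neg (-x))).congr_deriv ?_
      simp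
    have key := main_pos (-θ) hr hσ hmeas' hbd' hx' hg' hd'
    have hsup : (⨆ t : ℝ, |htilde r (-θ) σ (fun s => h (-s)) t|) =
        ⨆ t : ℝ, |htilde r θ σ h t| := by
      simp only [htilde_neg]
      exact (Equiv.neg ℝ).iSup_comp (g := fun t => |htilde r θ σ h t|)
    have hA : Aconst r (-θ) σ = Aconst r θ σ := by unfold Aconst; rw [neg_sq]
    have hB : Bconst r (-θ) σ = Bconst r θ σ := by unfold Bconst; rw [neg_sq]
    rw [hsup, hA, hB, neg_sq, neg_mul_neg] at key
    exact key
  · exact main_pos θ hr hσ hmeas hbd hpos hg hd
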